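/- Let n ≥ 2 and let G satisfy hypotheses (H1)–(H4). If 0 < γ < 1, then there exists λ_s = λ_s(n, γ, G) > 0 such that for every λ > λ_s the unit ball B₁ is a volume-constrained stable critical point of F_{γ,G_λ}: B₁ is a volume-constrained stationary set for F_{γ,G_λ} and δ²F_{γ,G_λ}(B₁)[X] ≥ 0 for every X ∈ C_c^∞(ℝⁿ;ℝⁿ) inducing a volume-preserving flow on B₁. -/

import Mathlib

open MeasureTheory Metric Filter Asymptotics ENNReal
open scoped ENNReal NNReal Topology

noncomputable section

abbrev V (n : ℕ) := EuclideanSpace ℝ (Fin n)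

/-- Divergence of a vector field on `ℝⁿ`. -/
def vdiv {n : ℕ} (φ : V n → V n) (x : V n) : ℝ :=
  ∑ i : Fin n, fderiv ℝ φ x (EuclideanSpace.single i 1) i

/-- The perimeter of a set in `ℝⁿ` (the total variation of its indicator function),
defined by duality against compactly supported `C¹` vector fields bounded by `1`. -/
def perimeter {n : ℕ} (E : Set (V n)) : ℝ≥0∞ :=
  ⨆ φ : {φ : V n → V n // ContDiff ℝ 1 φ ∧ HasCompactSupport φ ∧ ∀ x, ‖φ x‖ ≤ 1},
    ENNReal.ofReal (∫ x in E, vdiv φ.1 x)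

/-- A set of finite perimeter. -/
def HasFinitePerimeter {n : ℕ} (E : Set (V n)) : Prop :=
  MeasurableSet E ∧ perimeter E < ⊤

/-- Real-valued perimeter `P(E)`. -/
def P {n : ℕ} (E : Set (V n)) : ℝ := (perimeter E).toReal

/-- The nonlocal `G`-perimeter `Per_G(E) = ∬_{E × Eᶜ} G(x−y) dx dy`. -/
def PerG {n : ℕ} (G : V n → ℝ) (E : Set (V n)) : ℝ :=
  ∫ x in E, ∫ y in Eᶜ, G (x - y)

/-- The constant `𝐄_{p,n}`: the average over the unit sphere `S^{n-1} ⊆ ℝⁿ` of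
`|e·x|^p` (with respect to the `(n-1)`-dimensional Hausdorff measure), for the
unit vector `e = e₀`. -/
def Kconst (n : ℕ) (p : ℝ) : ℝ :=
  if h : n = 0 then 0 else
    ⨍ x in sphere (0 : V n) 1, |x ⟨0, Nat.pos_of_ne_zero h⟩| ^ p ∂ μH[(n : ℝ) - 1]

/-- Hypotheses (H1)–(H2): `G` is a nonnegative measurable radial kernel on `ℝⁿ`,
integrable, with first moment `∫ |x| G(x) dx = 2/𝐄_{1,n}`. -/
structure H12 {n : ℕ} (G : V n → ℝ) : Prop where
  measurable : Measurable G
  nonneg : ∀ x, 0 ≤ G x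
  radial : ∃ g : ℝ → ℝ, (∀ r, 0 < r → 0 ≤ g r) ∧ ∀ᵐ x : V n ∂volume, G x = g ‖x‖
  integrable : Integrable G (volume : Measure (V n))
  firstMoment : ∫ x : V n, ‖x‖ * G x = 2 / Kconst n 1

/-- Hypotheses (H3)–(H4): `G(x) = o(|x|^{α−n})` at the origin for some `α > 0`, and
`G(x) = o(|x|^{−(n+β)})` at infinity for some `β > 0` if `n ≥ 3`,
resp. `G(x) = o(|x|^{−3})` at infinity if `n = 2`. -/
structure H34 {n : ℕ} (G : V n → ℝ) : Prop where
  origin : ∃ α : ℝ, 0 < α ∧ G =o[𝓝[≠] (0 : V n)] fun x => ‖x‖ ^ (α - (n : ℝ))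
  inftyHi : 3 ≤ n → ∃ β : ℝ, 0 < β ∧
    G =o[Bornology.cobounded (V n)] fun x => ‖x‖ ^ (-((n : ℝ) + β))
  inftyTwo : n = 2 → G =o[Bornology.cobounded (V n)] fun x => ‖x‖ ^ (-3 : ℝ)

/-- The rescaled kernel `G_λ(x) = λ^{n+1} G(λ x)`. -/
def Gscale {n : ℕ} (G : V n → ℝ) (l : ℝ) : V n → ℝ := fun x => l ^ (n + 1) * G (l • x)

/-- The functional `F_{γ,G_λ}(E) = P(E) − γ Per_{G_λ}(E)`. -/
def Ffun {n : ℕ} (γ : ℝ) (G : V n → ℝ) (l : ℝ) (E : Set (V n)) : ℝ :=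
  P E - γ * PerG (Gscale G l) E

/-- `Φ` is the flow of the smooth compactly supported vector field `X`. -/
structure IsFlowOf {n : ℕ} (X : V n → V n) (Φ : ℝ → V n → V n) : Prop where
  smooth : ContDiff ℝ (⊤ : ℕ∞) X
  cptSupp : HasCompactSupport X
  init : ∀ x, Φ 0 x = x
  isFlow : ∀ t x, HasDerivAt (fun s => Φ s x) (X (Φ t x)) t

/-- The flow `Φ` induces a volume-preserving flow on `E`. -/
def PreservesVolume {n : ℕ} (Φ : ℝ → V n → V n) (E : Set (V n)) : Prop :=
  ∃ δ : ℝ, 0 < δ ∧ ∀ t : ℝ, |t| < δ → volume (Φ t '' E) = volume E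



def sph (n : ℕ) : Measure (V n) := (volume : Measure (V n)).toSphere.map Subtype.val
def rad (n : ℕ) : Measure ℝ := (Measure.volumeIoiPow (n-1)).map Subtype.val

instance (n : ℕ) : IsFiniteMeasure (sph n) := by unfold sph; infer_instance

lemma rad_eq (n : ℕ) : rad n = (volume.restrict (Set.Ioi (0:ℝ))).withDensity
    (fun r => ENNReal.ofReal (r^(n-1))) := by
  ext s hs
  rw [rad, Measure.map_apply measurable_subtype_coe hs, Measure.volumeIoiPow,
    withDensity_apply _ (measurable_subtype_coe hs), withDensity_apply _ hs,
    ← lintegral_indicator (measurable_subtype_coe hs), ← lintegral_indicator hs]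
  rw [← lintegral_subtype_comap measurableSet_Ioi]
  rfl

instance (n : ℕ) : SFinite (rad n) := by rw [rad_eq]; infer_instance

lemma sph_norm (n : ℕ) : ∀ᵐ x ∂(sph n), ‖x‖ = 1 := by
  rw [sph, ae_map_iff measurable_subtype_coe.aemeasurable (measurableSet_eq_fun (by fun_prop) (by fun_prop))]
  exact ae_of_all _ (fun x => by simpa using x.2)

lemma polar_mp {n : ℕ} (hn : 0 < n) :
    MeasurePreserving (fun p : V n × ℝ => p.2 • p.1) ((sph n).prod (rad n)) volume := by
  have : Nonempty (Fin n) := ⟨⟨0, hn⟩⟩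
  have : Nontrivial (V n) := inferInstance
  have h := (volume : Measure (V n)).measurePreserving_homeomorphUnitSphereProd
  have h2 : MeasurePreserving (homeomorphUnitSphereProd (V n)).symm
      ((volume : Measure (V n)).toSphere.prod (Measure.volumeIoiPow (Module.finrank ℝ (V n) - 1)))
      ((volume : Measure (V n)).comap (Subtype.val)) :=
    h.symm (homeomorphUnitSphereProd (V n)).toMeasurableEquiv
  refine ⟨by fun_prop, ?_⟩
  rw [sph, rad, Measure.map_prod_map _ _ measurable_subtype_coe measurable_subtype_coe,
    Measure.map_map (by fun_prop) (by fun_prop)]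
  have h3 : (fun p : V n × ℝ => p.2 • p.1) ∘ (Prod.map (Subtype.val : sphere (0:V n) 1 → V n) (Subtype.val : Set.Ioi (0:ℝ) → ℝ))
     = Subtype.val ∘ (homeomorphUnitSphereProd (V n)).symm := by
    ext p; simp
  rw [h3, ← Measure.map_map (by fun_prop) (by fun_prop)]
  have h4 := h2.map_eq
  rw [finrank_euclideanSpace_fin] at h4
  rw [h4, (MeasurableEmbedding.subtype_coe (measurableSet_singleton _).compl).map_comap, Subtype.range_coe]
  exact Measure.restrict_eq_self_of_ae_mem (compl_mem_ae_iff.2 (measure_singleton _))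

lemma lint_rad {n : ℕ} (f : ℝ → ℝ≥0∞) (hf : Measurable f) :
    ∫⁻ r, f r ∂(rad n) = ∫⁻ r in Set.Ioi (0:ℝ), ENNReal.ofReal (r^(n-1)) * f r := by
  rw [rad_eq, lintegral_withDensity_eq_lintegral_mul _ (by fun_prop) hf]
  rfl

lemma int_rad {n : ℕ} (f : ℝ → ℝ)  :
    ∫ r, f r ∂(rad n) = ∫ r in Set.Ioi (0:ℝ), r^(n-1) * f r := by
  rw [rad_eq, integral_withDensity_eq_integral_toReal_smul (by fun_prop) (by simp)]
  refine setIntegral_congr_fun measurableSet_Ioi (fun r hr => ?_)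
  have : (0:ℝ) ≤ r := le_of_lt hr
  simp only [smul_eq_mul]
  rw [ENNReal.toReal_ofReal (by positivity)]

lemma lint_polar {n : ℕ} (hn : 0 < n) (F : V n → ℝ≥0∞) (hF : Measurable F) :
    ∫⁻ w, F w = ∫⁻ x, ∫⁻ r, F (r • x) ∂(rad n) ∂(sph n) := by
  rw [← (polar_mp hn).lintegral_comp hF, lintegral_prod _ (by fun_prop)]

lemma int_polar {n : ℕ} (hn : 0 < n) (F : V n → ℝ) (hF : Integrable F) :
    ∫ w, F w = ∫ x, ∫ r, F (r • x) ∂(rad n) ∂(sph n) := by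
  have h := (polar_mp hn).integrable_comp_of_integrable hF
  have h2 := integral_prod _ h
  rw [← (polar_mp hn).map_eq, integral_map (by fun_prop)
    (by rw [(polar_mp hn).map_eq]; exact hF.1)]
  exact h2

lemma int_polar' {n : ℕ} (hn : 0 < n) (F : V n → ℝ) (hF : Integrable F) :
    ∫ w, F w = ∫ x, (∫ r in Set.Ioi (0:ℝ), r^(n-1) * F (r • x)) ∂(sph n) := by
  rw [int_polar hn F hF]
  simp_rw [int_rad]

open scoped Pointwise in
/-- rotation invariance -/
lemma sph_mp {n : ℕ} (g : V n ≃ₗᵢ[ℝ] V n) : MeasurePreserving g (sph n) (sph n) := by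
  refine ⟨g.continuous.measurable, ?_⟩
  ext s hs
  have key : ∀ s : Set (V n), MeasurableSet s → sph n s = n * volume (Set.Ioo (0:ℝ) 1 • (s ∩ sphere 0 1)) := by
    intro s hs
    rw [sph, Measure.map_apply measurable_subtype_coe hs,
      Measure.toSphere_apply' _ (measurable_subtype_coe hs), finrank_euclideanSpace_fin,
      Subtype.image_preimage_coe, Set.inter_comm]
  rw [Measure.map_apply g.continuous.measurable hs, key _ (g.continuous.measurable hs), key _ hs]
  congr 1
  have hmp : MeasurePreserving g.toMeasurableEquiv volume volume := g.measurePreserving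
  rw [← hmp.measure_preimage_equiv (Set.Ioo (0:ℝ) 1 • (s ∩ sphere 0 1))]
  congr 1
  ext w
  simp only [Set.mem_smul, Set.mem_inter_iff, Set.mem_preimage, mem_sphere_iff_norm, sub_zero]
  constructor
  · rintro ⟨r, hr, y, ⟨hy, hy1⟩, rfl⟩
    exact ⟨r, hr, g y, ⟨hy, by simpa using hy1⟩, by simp⟩
  · rintro ⟨r, hr, y, ⟨hy, hy1⟩, h⟩
    refine ⟨r, hr, g.symm y, ⟨by simpa using hy, by simpa using hy1⟩, ?_⟩
    apply g.injective
    simpa using h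

def NN (n : ℕ) : ℝ := (sph n).real Set.univ

lemma NN_pos {n : ℕ} (hn : 0 < n) : 0 < NN n := by
  have : Nonempty (Fin n) := ⟨⟨0, hn⟩⟩
  rw [NN, sph, measureReal_def, Measure.map_apply measurable_subtype_coe MeasurableSet.univ]
  simp only [Set.preimage_univ, Measure.toSphere_apply_univ]
  refine ENNReal.toReal_pos ?_ ?_
  · simp [hn.ne']
    exact (measure_ball_pos _ _ one_pos).ne'
  · exact ENNReal.mul_ne_top (by simp) measure_ball_lt_top.ne

lemma NN_eq (n : ℕ) : NN n = n * (volume : Measure (V n)).real (ball 0 1) := by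
  rw [NN, sph, measureReal_def, Measure.map_apply measurable_subtype_coe MeasurableSet.univ]
  simp [measureReal_def]


lemma vol_lip {n : ℕ} {f : V n → V n} {K : ℝ≥0} (hf : LipschitzWith K f) (s : Set (V n)) :
    volume (f '' s) ≤ (K : ℝ≥0∞)^n * volume s := by
  have h1 : (volume : Measure (V n)) = Measure.addHaarScalarFactor volume μH[Module.finrank ℝ (V n)]
     • (μH[Module.finrank ℝ (V n)] : Measure (V n)) :=
    Measure.isAddLeftInvariant_eq_smul _ _
  rw [h1]
  simp only [Measure.smul_apply]
  have := hf.hausdorffMeasure_image_le (d := Module.finrank ℝ (V n)) (by positivity) s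
  rw [ENNReal.smul_def, ENNReal.smul_def, smul_eq_mul, smul_eq_mul, mul_left_comm]
  gcongr
  simpa using this

lemma vdiv_cont {n : ℕ} {φ : V n → V n} (hφ : ContDiff ℝ 1 φ) : Continuous (vdiv φ) := by
  unfold vdiv
  have := hφ.continuous_fderiv (by simp)
  fun_prop

lemma vdiv_cpt {n : ℕ} {φ : V n → V n} (hc : HasCompactSupport φ) :
    HasCompactSupport (vdiv φ) := by
  refine HasCompactSupport.mono (hc.fderiv (𝕜 := ℝ)) ?_
  intro x hx
  contrapose! hx
  simp only [Function.mem_support, not_not] at hx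
  simp [vdiv, hx]

lemma vdiv_integrable {n : ℕ} {φ : V n → V n} (hφ : ContDiff ℝ 1 φ) (hc : HasCompactSupport φ) :
    Integrable (vdiv φ) := (vdiv_cont hφ).integrable_of_hasCompactSupport (vdiv_cpt hc)

lemma ibp {n : ℕ} {φ : V n → V n} (hφ : ContDiff ℝ 1 φ) (hc : HasCompactSupport φ)
    {η : V n → ℝ} {K : ℝ≥0} (hη : LipschitzWith K η) :
    ∫ x, η x * vdiv φ x = - ∫ x, fderiv ℝ η x (φ x) := by
  have hd : ∀ᵐ x, DifferentiableAt ℝ η x := hη.ae_differentiableAt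
  have hφd : Differentiable ℝ φ := hφ.differentiable (by simp)
  have hcomp : ∀ i, ContDiff ℝ 1 (fun x => φ x i) := fun i => by fun_prop
  have hccomp : ∀ i, HasCompactSupport (fun x => φ x i) := fun i =>
    HasCompactSupport.mono hc (fun x hx => by
      contrapose! hx
      simp only [Function.mem_support, not_not] at hx ⊢
      simp [hx])
  have hfd : ∀ i x v, fderiv ℝ (fun x => φ x i) x v = fderiv ℝ φ x v i := by
    intro i x v
    have h := (EuclideanSpace.proj (ι := Fin n) i : V n →L[ℝ] ℝ).hasFDerivAt.comp x (hφd x).hasFDerivAt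
    have h2 : HasFDerivAt (fun x => φ x i) _ x := h
    rw [h2.fderiv]; rfl
  have key : ∀ i : Fin n, ∫ x, η x * fderiv ℝ φ x (EuclideanSpace.single i 1) i =
      - ∫ x, lineDeriv ℝ η x (EuclideanSpace.single i 1) * φ x i := by
    intro i
    obtain ⟨D, hD⟩ := (hcomp i).lipschitzWith_of_hasCompactSupport (hccomp i) (by simp)
    rw [hη.integral_lineDeriv_mul_eq hD (hccomp i), ← integral_neg]
    congr 1; ext x
    rw [((hcomp i).differentiable (by simp) x).lineDeriv_eq_fderiv, map_neg, hfd]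
    ring
  have hi1 : ∀ i : Fin n, Integrable (fun x => η x * fderiv ℝ φ x (EuclideanSpace.single i 1) i) := by
    intro i
    refine Continuous.integrable_of_hasCompactSupport ?_ ?_
    · have := hφ.continuous_fderiv (by simp)
      have := hη.continuous
      fun_prop
    · refine HasCompactSupport.mono (hc.fderiv (𝕜 := ℝ)) ?_
      intro x hx
      contrapose! hx
      simp only [Function.mem_support, not_not] at hx
      simp [hx]
  have hi2 : ∀ i : Fin n, Integrable (fun x => lineDeriv ℝ η x (EuclideanSpace.single i 1) * φ x i) := by
    intro i
    have := (hη.locallyIntegrable_lineDeriv (μ := volume) (EuclideanSpace.single i 1)).integrable_smul_right_of_hasCompactSupport (hcomp i).continuous (hccomp i)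
    simpa using this
  simp only [vdiv, Finset.mul_sum]
  rw [integral_finsetSum _ (fun i _ => hi1 i)]
  simp_rw [key]
  rw [Finset.sum_neg_distrib, ← integral_finsetSum _ (fun i _ => hi2 i)]
  congr 1
  refine integral_congr_ae ?_
  filter_upwards [hd] with x hx
  have : φ x = ∑ i, φ x i • EuclideanSpace.single i (1:ℝ) := by
    ext j; simp [Finset.sum_apply, Pi.single_apply]
  conv_rhs => rw [this, map_sum]
  refine Finset.sum_congr rfl (fun i _ => ?_)
  rw [hx.lineDeriv_eq_fderiv, map_smul, smul_eq_mul, mul_comm]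

/-- piecewise linear cutoff -/
def clampη (δ s : ℝ) : ℝ := max 0 (min 1 ((1 - s)/δ))

lemma clampη_lip {δ : ℝ} (hδ : 0 < δ) : LipschitzWith (1/δ).toNNReal (clampη δ) := by
  apply LipschitzWith.of_dist_le_mul
  intro a b
  rw [Real.coe_toNNReal _ (by positivity), Real.dist_eq, Real.dist_eq]
  have h1 : |clampη δ a - clampη δ b| ≤ |(1-a)/δ - (1-b)/δ| := by
    unfold clampη
    refine (abs_max_sub_max_le_max _ _ _ _).trans ?_
    simp only [sub_self, abs_zero]
    refine max_le (abs_nonneg _) ((abs_min_sub_min_le_max _ _ _ _).trans ?_)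
    simp
  refine h1.trans (le_of_eq ?_)
  rw [← sub_div, abs_div, abs_of_pos hδ, abs_sub_comm]
  rw [show (1-b-(1-a)) = a - b by ring]; ring

lemma clampη_tendsto (s : ℝ) : Tendsto (fun k : ℕ => clampη (1/(k+2)) s) atTop
    (𝓝 (if s < 1 then 1 else 0)) := by
  split_ifs with h
  · apply tendsto_const_nhds.congr'
    have : Tendsto (fun k : ℕ => ((k:ℝ)+2)) atTop atTop :=
      tendsto_atTop_add_const_right _ _ tendsto_natCast_atTop_atTop
    filter_upwards [this.eventually_ge_atTop (1/(1-s))] with k hk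
    have hs : 0 < 1 - s := by linarith
    unfold clampη
    have : 1 ≤ (1-s)/(1/((k:ℝ)+2)) := by
      rw [div_div_eq_mul_div, div_one]
      rw [div_le_iff₀ hs] at hk
      linarith
    rw [min_eq_left this]; simp
  · apply tendsto_const_nhds.congr
    intro k
    unfold clampη
    have : (1-s)/(1/((k:ℝ)+2)) ≤ 0 := by
      apply div_nonpos_of_nonpos_of_nonneg (by linarith) (by positivity)
    rw [min_eq_right (by linarith), max_eq_left this]

lemma clampη_bd (δ s : ℝ) : |clampη δ s| ≤ 1 := by
  unfold clampη
  rw [abs_of_nonneg (le_max_left _ _)]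
  exact max_le zero_le_one (min_le_left _ _)

lemma clamp_lim {n : ℕ} {φ : V n → V n} (hφ : ContDiff ℝ 1 φ) (hc : HasCompactSupport φ)
    {ψ : V n → ℝ} (hψ : Continuous ψ) :
    Tendsto (fun k : ℕ => ∫ x, clampη (1/(k+2)) (ψ x) * vdiv φ x) atTop
      (𝓝 (∫ x in {x | ψ x < 1}, vdiv φ x)) := by
  have hm : MeasurableSet {x | ψ x < 1} := measurableSet_lt hψ.measurable measurable_const
  rw [← integral_indicator hm]
  refine tendsto_integral_of_dominated_convergence (fun x => ‖vdiv φ x‖) ?_ (vdiv_integrable hφ hc).norm ?_ ?_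
  · intro k
    have := (clampη_lip (δ := 1/((k:ℝ)+2)) (by positivity)).continuous
    have := vdiv_cont hφ
    exact (by fun_prop : Continuous _).aestronglyMeasurable
  · intro k
    filter_upwards with x
    rw [norm_mul]
    have := clampη_bd (1/((k:ℝ)+2)) (ψ x)
    rw [Real.norm_eq_abs]
    nlinarith [norm_nonneg (vdiv φ x)]
  · filter_upwards with x
    have := (clampη_tendsto (ψ x)).mul_const (vdiv φ x)
    convert this using 2
    by_cases h : ψ x < 1 <;> simp [Set.indicator, h]

lemma per_le {n : ℕ} {ψ : V n → ℝ} {K : ℝ≥0} (hψ : LipschitzWith K ψ) {D : ℝ} (hD : 0 ≤ D)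
    (hlayer : ∀ δ : ℝ, 0 < δ → δ < 1 → volume {x | 1 - δ ≤ ψ x ∧ ψ x ≤ 1} ≤ ENNReal.ofReal (D * δ)) :
    perimeter {x | ψ x < 1} ≤ ENNReal.ofReal (K * D) := by
  unfold perimeter
  refine iSup_le ?_
  rintro ⟨φ, hφ, hc, hb⟩
  refine ENNReal.ofReal_le_ofReal ?_
  refine le_of_tendsto (clamp_lim hφ hc hψ.continuous) (Eventually.of_forall (fun k => ?_))
  set δ : ℝ := 1/(k+2) with hδ
  have hδ0 : 0 < δ := by positivity
  have hδ1 : δ < 1 := by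
    rw [hδ, div_lt_one (by positivity)]; linarith [(Nat.cast_nonneg k : (0:ℝ) ≤ k)]
  have hl : LipschitzWith ((1/δ).toNNReal * K) (fun x => clampη δ (ψ x)) := (clampη_lip hδ0).comp hψ
  rw [ibp hφ hc hl]
  set S := {x | 1 - δ ≤ ψ x ∧ ψ x ≤ 1} with hS
  have hSm : MeasurableSet S := by
    have := hψ.continuous.measurable
    exact (measurableSet_le measurable_const this).inter (measurableSet_le this measurable_const)
  have hpt : ∀ x, ‖fderiv ℝ (fun x => clampη δ (ψ x)) x (φ x)‖ ≤ S.indicator (fun _ => (1/δ) * K) x := by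
    intro x
    by_cases hx : x ∈ S
    · rw [Set.indicator_of_mem hx]
      have h1 := norm_fderiv_le_of_lipschitz ℝ hl (x₀ := x)
      simp only [NNReal.coe_mul, Real.coe_toNNReal _ (by positivity : (0:ℝ) ≤ 1/δ)] at h1
      refine ((fderiv ℝ (fun x => clampη δ (ψ x)) x).le_opNorm _).trans ?_
      have := hb x
      have h0 : 0 ≤ 1/δ * (K:ℝ) := by positivity
      calc _ ≤ (1/δ * (K:ℝ)) * 1 := by gcongr
        _ = _ := by ring
    · rw [Set.indicator_of_notMem hx]
      have : fderiv ℝ (fun x => clampη δ (ψ x)) x = 0 := by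
        by_cases h1 : ψ x < 1 - δ
        · have : (fun x => clampη δ (ψ x)) =ᶠ[𝓝 x] fun _ => 1 := by
            filter_upwards [hψ.continuous.continuousAt.eventually_lt_const h1] with y hy
            unfold clampη
            have : 1 ≤ (1 - ψ y)/δ := by rw [le_div_iff₀ hδ0]; linarith
            rw [min_eq_left this]; simp
          rw [this.fderiv_eq]; simp
        · have h2 : 1 < ψ x := by
            by_contra h3
            exact hx ⟨not_lt.1 h1, not_lt.1 h3⟩
          have : (fun x => clampη δ (ψ x)) =ᶠ[𝓝 x] fun _ => 0 := by
            filter_upwards [hψ.continuous.continuousAt.eventually_const_lt h2] with y hy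
            unfold clampη
            have : (1 - ψ y)/δ ≤ 0 := div_nonpos_of_nonpos_of_nonneg (by linarith) hδ0.le
            rw [min_eq_right (by linarith), max_eq_left this]
          rw [this.fderiv_eq]; simp
      simp [this]
  have hfin : volume S < ⊤ := (hlayer δ hδ0 hδ1).trans_lt ENNReal.ofReal_lt_top
  have h2 : ‖∫ x, fderiv ℝ (fun x => clampη δ (ψ x)) x (φ x)‖ ≤ ∫ x, S.indicator (fun _ => (1/δ) * (K:ℝ)) x := by
    refine norm_integral_le_of_norm_le ?_ (Eventually.of_forall hpt)
    rw [integrable_indicator_iff hSm]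
    exact integrableOn_const hfin.ne
  rw [integral_indicator hSm, setIntegral_const, smul_eq_mul] at h2
  have h3 : volume.real S ≤ D * δ := by
    rw [measureReal_def]
    exact ENNReal.toReal_le_of_le_ofReal (by positivity) (hlayer δ hδ0 hδ1)
  calc _ ≤ ‖∫ x, fderiv ℝ (fun x => clampη δ (ψ x)) x (φ x)‖ := by
        rw [← norm_neg]; exact le_abs_self _
    _ ≤ (D * δ) * (1/δ * K) := h2.trans (by gcongr)
    _ = K * D := by field_simp


lemma sph_restrict (n : ℕ) : (sph n).restrict (sphere 0 1) = sph n := by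
  apply Measure.restrict_eq_self_of_ae_mem
  filter_upwards [sph_norm n] with x hx
  simpa using hx

lemma sph_integrable {n : ℕ} {F : V n → ℝ} (hF : ContinuousOn F (sphere 0 1)) : Integrable F (sph n) := by
  rw [← sph_restrict]
  exact hF.integrableOn_compact (isCompact_sphere _ _)

lemma sph_int_cont {n : ℕ} {Z : Type*} [TopologicalSpace Z] [FirstCountableTopology Z] [LocallyCompactSpace Z] {F : Z → V n → ℝ}
    (hF : Continuous (Function.uncurry F)) : Continuous (fun z => ∫ x, F z x ∂(sph n)) := by
  have := continuous_parametric_integral_of_continuous (μ := sph n) hF (isCompact_sphere (0 : V n) 1)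
  rw [sph_restrict] at this
  exact this

lemma sph_congr {n : ℕ} {F F' : V n → ℝ} (h : ∀ x, ‖x‖ = 1 → F x = F' x) :
    ∫ x, F x ∂(sph n) = ∫ x, F' x ∂(sph n) := by
  apply integral_congr_ae
  filter_upwards [sph_norm n] with x hx using h x hx

lemma sph_mono {n : ℕ} {F F' : V n → ℝ} (hF : Integrable F (sph n)) (hF' : Integrable F' (sph n)) (h : ∀ x, ‖x‖ = 1 → F x ≤ F' x) :
    ∫ x, F x ∂(sph n) ≤ ∫ x, F' x ∂(sph n) := by
  apply integral_mono_ae hF hF'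
  filter_upwards [sph_norm n] with x hx using h x hx

lemma sph_abs_le {n : ℕ} {F : V n → ℝ} {C : ℝ} (h : ∀ x, ‖x‖ = 1 → |F x| ≤ C) :
    |∫ x, F x ∂(sph n)| ≤ C * NN n := by
  rw [← Real.norm_eq_abs]
  refine norm_integral_le_of_norm_le_const ?_
  filter_upwards [sph_norm n] with x hx using h x hx

lemma int_polar_swap {n : ℕ} (hn : 0 < n) (F : V n → ℝ) (hF : Integrable F) :
    ∫ w, F w = ∫ r in Set.Ioi (0:ℝ), r^(n-1) * ∫ x, F (r • x) ∂(sph n) := by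
  rw [int_polar hn F hF, integral_integral_swap (f := fun x r => F (r • x)) ((polar_mp hn).integrable_comp_of_integrable hF), int_rad]

lemma hasFDerivAt_vnorm {n : ℕ} {x : V n} (hx0 : x ≠ 0) :
    HasFDerivAt (fun y : V n => ‖y‖) (‖x‖⁻¹ • innerSL ℝ x) x := by
  have h2 := (hasStrictFDerivAt_norm_sq x).hasFDerivAt.sqrt (by positivity)
  have h3 : (fun y : V n => √(‖y‖^2)) = fun y => ‖y‖ := by ext y; simp
  rw [h3] at h2
  have h4 : (1 / (2 * √(‖x‖ ^ 2))) • 2 • (innerSL ℝ) x = ‖x‖⁻¹ • innerSL ℝ x := by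
    rw [Real.sqrt_sq (norm_nonneg _)]
    have : ‖x‖ ≠ 0 := by simpa using hx0
    ext y
    simp
    field_simp
  rw [← h4]
  exact h2

/-- divergence theorem on the unit ball -/
lemma ball_divthm {n : ℕ} (hn : 0 < n) {φ : V n → V n} (hφ : ContDiff ℝ 1 φ) (hc : HasCompactSupport φ) :
    ∫ x in ball 0 1, vdiv φ x = ∫ x, inner ℝ x (φ x) ∂(sph n) := by
  have : Nonempty (Fin n) := ⟨⟨0, hn⟩⟩
  have h1 := clamp_lim hφ hc (ψ := fun x => ‖x‖) continuous_norm
  have hball : {x : V n | ‖x‖ < 1} = ball 0 1 := by ext; simp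
  rw [hball] at h1
  set b : ℝ → ℝ := fun r => r^(n-1) * ∫ x, inner ℝ x (φ (r • x)) ∂(sph n) with hb
  have hbc : Continuous b := by
    have hφc := hφ.continuous
    have : Continuous (fun r : ℝ => ∫ x, inner ℝ x (φ (r • x)) ∂(sph n)) := by
      apply sph_int_cont
      simp only [Function.uncurry_def]
      fun_prop
    rw [hb]; fun_prop
  have key : ∀ k : ℕ, ∫ x, clampη (1/(k+2)) ‖x‖ * vdiv φ x = ((k:ℝ)+2) * ∫ r in (1 - 1/((k:ℝ)+2))..1, b r := by
    intro k
    set δ : ℝ := 1/(k+2) with hδ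
    have hδ0 : 0 < δ := by positivity
    have hδ1 : δ < 1 := by
      rw [hδ, div_lt_one (by positivity)]; linarith [(Nat.cast_nonneg k : (0:ℝ) ≤ k)]
    have hl : LipschitzWith ((1/δ).toNNReal * 1) (fun x : V n => clampη δ ‖x‖) := (clampη_lip hδ0).comp lipschitzWith_one_norm
    rw [ibp hφ hc hl]
    set S : Set (V n) := {x | 1 - δ < ‖x‖ ∧ ‖x‖ < 1} with hS
    have hSm : MeasurableSet S := by
      have : Measurable (fun x : V n => ‖x‖) := by fun_prop
      exact (measurableSet_lt measurable_const this).inter (measurableSet_lt this measurable_const)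
    have hae : ∀ᵐ x : V n, fderiv ℝ (fun x => clampη δ ‖x‖) x (φ x) = S.indicator (fun x => - ((1/δ) * (‖x‖⁻¹ * inner ℝ x (φ x)))) x := by
      have e1 : ∀ᵐ x : V n, x ∉ sphere (0 : V n) 1 := compl_mem_ae_iff.2 (Measure.addHaar_sphere _ _ _)
      have e2 : ∀ᵐ x : V n, x ∉ sphere (0 : V n) (1 - δ) := compl_mem_ae_iff.2 (Measure.addHaar_sphere _ _ _)
      filter_upwards [e1, e2] with x hx1 hx2
      simp only [mem_sphere_iff_norm, sub_zero] at hx1 hx2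
      by_cases hx : x ∈ S
      · rw [Set.indicator_of_mem hx]
        have hx0 : x ≠ 0 := by
          rintro rfl
          have := hx.1
          simp at this; linarith
        have he : (fun x : V n => clampη δ ‖x‖) =ᶠ[𝓝 x] fun y => (1 - ‖y‖) * (1/δ) := by
          filter_upwards [continuous_norm.continuousAt.eventually_const_lt hx.1, continuous_norm.continuousAt.eventually_lt_const hx.2] with y hy1 hy2
          unfold clampη
          have h1 : (1 - ‖y‖)/δ ≤ 1 := by rw [div_le_one hδ0]; linarith
          have h2 : 0 ≤ (1 - ‖y‖)/δ := div_nonneg (by linarith) hδ0.le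
          rw [min_eq_right h1, max_eq_right h2]; ring
        rw [he.fderiv_eq]
        have hd := hasFDerivAt_vnorm hx0
        have hd2 := ((hasFDerivAt_const (1:ℝ) x).sub hd).mul_const (1/δ)
        have hd3 : HasFDerivAt (fun y : V n => (1 - ‖y‖) * (1/δ)) _ x := hd2
        rw [hd3.fderiv]
        simp
      · rw [Set.indicator_of_notMem hx]
        have : fderiv ℝ (fun x : V n => clampη δ ‖x‖) x = 0 := by
          by_cases h1 : ‖x‖ < 1 - δ
          · have : (fun x : V n => clampη δ ‖x‖) =ᶠ[𝓝 x] fun _ => 1 := by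
              filter_upwards [continuous_norm.continuousAt.eventually_lt_const h1] with y hy
              unfold clampη
              have : 1 ≤ (1 - ‖y‖)/δ := by rw [le_div_iff₀ hδ0]; linarith
              rw [min_eq_left this]; simp
            rw [this.fderiv_eq]; simp
          · have h2 : 1 < ‖x‖ := by
              by_contra h3
              exact hx ⟨lt_of_le_of_ne (not_lt.1 h1) (Ne.symm hx2), lt_of_le_of_ne (not_lt.1 h3) hx1⟩
            have : (fun x : V n => clampη δ ‖x‖) =ᶠ[𝓝 x] fun _ => 0 := by
              filter_upwards [continuous_norm.continuousAt.eventually_const_lt h2] with y hy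
              unfold clampη
              have : (1 - ‖y‖)/δ ≤ 0 := div_nonpos_of_nonpos_of_nonneg (by linarith) hδ0.le
              rw [min_eq_right (by linarith), max_eq_left this]
            rw [this.fderiv_eq]; simp
        simp [this]
    rw [integral_congr_ae hae]
    have hintg : Integrable (S.indicator (fun x => - ((1/δ) * (‖x‖⁻¹ * inner ℝ x (φ x))))) := by
      have h0 : Integrable (fun x => ‖φ x‖ * (1/δ)) :=
        ((hφ.continuous.integrable_of_hasCompactSupport hc).norm.mul_const _)
      refine h0.mono' ?_ ?_
      · refine AEStronglyMeasurable.indicator ?_ hSm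
        have := hφ.continuous.measurable
        exact (by fun_prop : Measurable _).aestronglyMeasurable
      · filter_upwards with x
        by_cases hx : x ∈ S
        · rw [Set.indicator_of_mem hx]
          rw [norm_neg, norm_mul, norm_mul, norm_inv, norm_norm, Real.norm_of_nonneg (by positivity : 0 ≤ 1/δ), mul_comm]
          gcongr
          have hx0 : 0 < ‖x‖ := by have := hx.1; linarith
          rw [inv_mul_le_iff₀ hx0]
          exact norm_inner_le_norm _ _
        · rw [Set.indicator_of_notMem hx]; simp; positivity
    rw [int_polar_swap hn _ hintg]
    have hSr : ∀ r ∈ Set.Ioi (0:ℝ), r^(n-1) * ∫ x, S.indicator (fun x => - ((1/δ) * (‖x‖⁻¹ * inner ℝ x (φ x)))) (r • x) ∂(sph n)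
        = (Set.Ioo (1-δ) 1).indicator (fun r => -(1/δ) * b r) r := by
      intro r hr
      have hr : 0 < r := hr
      by_cases h : r ∈ Set.Ioo (1-δ) 1
      · rw [Set.indicator_of_mem h, hb]
        simp only
        rw [mul_left_comm, ← integral_const_mul (-(1/δ))]
        congr 1
        apply sph_congr
        intro x hx
        have : r • x ∈ S := by
          rw [hS, Set.mem_setOf_eq, norm_smul, hx, mul_one, Real.norm_of_nonneg hr.le]; exact h
        rw [Set.indicator_of_mem this, norm_smul, hx, mul_one, Real.norm_of_nonneg hr.le, real_inner_smul_left]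
        field_simp
      · rw [Set.indicator_of_notMem h]
        rw [sph_congr (F' := fun _ => 0)]
        · simp
        intro x hx
        have : r • x ∉ S := by
          rw [hS, Set.mem_setOf_eq, norm_smul, hx, mul_one, Real.norm_of_nonneg hr.le]; exact h
        rw [Set.indicator_of_notMem this]
    have hsub : Set.Ioo (1-δ) 1 ⊆ Set.Ioi (0:ℝ) := fun r hr => lt_trans (by linarith) hr.1
    rw [setIntegral_congr_fun measurableSet_Ioi hSr, setIntegral_indicator measurableSet_Ioo,
      Set.inter_eq_right.2 hsub,
      integral_const_mul, intervalIntegral.integral_of_le (by linarith), integral_Ioc_eq_integral_Ioo]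
    rw [hδ]; field_simp
  simp_rw [key] at h1
  have h2 : Tendsto (fun k : ℕ => ((k:ℝ)+2) * ∫ r in (1 - 1/((k:ℝ)+2))..1, b r) atTop (𝓝 (b 1)) := by
    have hd : HasDerivAt (fun u => ∫ r in u..1, b r) (-b 1) 1 :=
      intervalIntegral.integral_hasDerivAt_left (hbc.intervalIntegrable _ _) (hbc.stronglyMeasurableAtFilter _ _) hbc.continuousAt
    have hs := hd.tendsto_slope
    have ht : Tendsto (fun k : ℕ => 1 - 1/((k:ℝ)+2)) atTop (𝓝[≠] 1) := by
      rw [tendsto_nhdsWithin_iff]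
      constructor
      · have h3 : Tendsto (fun k : ℕ => ((k:ℝ)+2)) atTop atTop :=
          tendsto_atTop_add_const_right _ _ tendsto_natCast_atTop_atTop
        have := (h3.const_div_atTop 1).const_sub 1
        simpa using this
      · filter_upwards with k
        have : 0 < 1/((k:ℝ)+2) := by positivity
        simp only [Set.mem_compl_iff, Set.mem_singleton_iff]; linarith
    have := (hs.comp ht).neg
    rw [neg_neg] at this
    refine this.congr (fun k => ?_)
    simp only [Function.comp_apply, slope_def_field, intervalIntegral.integral_same]
    field_simp
    ring
  have := tendsto_nhds_unique h1 h2
  rw [this, hb]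
  simp

lemma vdiv_scale {n : ℕ} {φ : V n → V n} (hφ : Differentiable ℝ φ) (r : ℝ) (w : V n) :
    vdiv (fun w => φ (r • w)) w = r * vdiv φ (r • w) := by
  unfold vdiv
  have h : HasFDerivAt (fun w => φ (r • w)) ((fderiv ℝ φ (r • w)).comp (r • ContinuousLinearMap.id ℝ (V n))) w := by
    refine HasFDerivAt.comp w (hφ (r • w)).hasFDerivAt ?_
    exact (hasFDerivAt_id w).const_smul r
  rw [h.fderiv, Finset.mul_sum]
  simp

lemma sph_div_tangential {n : ℕ} (hn : 0 < n) {φ : V n → V n} (hφ : ContDiff ℝ 1 φ)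
    (hc : HasCompactSupport φ) (ht : ∀ w, inner ℝ w (φ w) = (0:ℝ)) :
    ∫ x, vdiv φ x ∂(sph n) = 0 := by
  have hφd : Differentiable ℝ φ := hφ.differentiable (by simp)
  have hvc := vdiv_cont hφ
  set a : ℝ → ℝ := fun r => r^(n-1) * ∫ x, vdiv φ (r • x) ∂(sph n) with ha
  have hac : Continuous a := by
    have : Continuous (fun r : ℝ => ∫ x, vdiv φ (r • x) ∂(sph n)) := by
      apply sph_int_cont
      simp only [Function.uncurry_def]
      fun_prop
    rw [ha]; fun_prop
  have key : ∀ ρ : ℝ, 0 < ρ → ∫ r in (0:ℝ)..ρ, a r = 0 := by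
    intro ρ hρ
    have h1 : ContDiff ℝ 1 (fun w => φ (ρ • w)) := by fun_prop
    have h2 : HasCompactSupport (fun w => φ (ρ • w)) := by
      have := hc.comp_homeomorph (Homeomorph.smulOfNeZero ρ hρ.ne')
      exact this
    have h3 := ball_divthm hn h1 h2
    have h4 : ∫ x, inner ℝ x (φ (ρ • x)) ∂(sph n) = 0 := by
      rw [sph_congr (F' := fun _ => 0)]
      · simp
      · intro x _
        have := ht (ρ • x)
        rw [real_inner_smul_left] at this
        simpa [hρ.ne'] using this
    rw [h4] at h3
    simp_rw [vdiv_scale hφd] at h3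
    rw [integral_const_mul, ← integral_indicator measurableSet_ball] at h3
    have h5 : ∀ x, (ball (0:V n) 1).indicator (fun x => vdiv φ (ρ • x)) x = (ball (0:V n) ρ).indicator (vdiv φ) (ρ • x) := by
      intro x
      have : x ∈ ball (0:V n) 1 ↔ ρ • x ∈ ball (0:V n) ρ := by
        simp only [mem_ball_zero_iff, norm_smul, Real.norm_of_nonneg hρ.le]
        constructor
        · intro h; nlinarith
        · intro h; by_contra h'; nlinarith
      by_cases hx : x ∈ ball (0:V n) 1
      · rw [Set.indicator_of_mem hx, Set.indicator_of_mem (this.1 hx)]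
      · rw [Set.indicator_of_notMem hx, Set.indicator_of_notMem (fun h => hx (this.2 h))]
    simp_rw [h5] at h3
    rw [Measure.integral_comp_smul] at h3
    have h6 : ∫ x, (ball (0:V n) ρ).indicator (vdiv φ) x = 0 := by
      have hne : |(ρ ^ Module.finrank ℝ (V n))⁻¹| ≠ 0 := by positivity
      rcases mul_eq_zero.1 h3 with h | h
      · exact absurd h hρ.ne'
      · rw [smul_eq_mul] at h
        exact (mul_eq_zero.1 h).resolve_left hne
    rw [int_polar_swap hn _ ((vdiv_integrable hφ hc).indicator measurableSet_ball)] at h6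
    have h7 : ∀ r ∈ Set.Ioi (0:ℝ), r^(n-1) * ∫ x, (ball (0:V n) ρ).indicator (vdiv φ) (r • x) ∂(sph n)
        = (Set.Ioo 0 ρ).indicator a r := by
      intro r hr
      have hr : 0 < r := hr
      by_cases h : r < ρ
      · have hm : r ∈ Set.Ioo 0 ρ := ⟨hr, h⟩
        rw [Set.indicator_of_mem hm, ha]
        simp only
        congr 1
        apply sph_congr
        intro x hx
        rw [Set.indicator_of_mem]
        simp [norm_smul, hx, abs_of_pos hr, h]
      · rw [Set.indicator_of_notMem (fun h' => h h'.2), sph_congr (F' := fun _ => 0)]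
        · simp
        intro x hx
        rw [Set.indicator_of_notMem]
        simp only [mem_ball_zero_iff, norm_smul, hx, Real.norm_of_nonneg hr.le, mul_one]
        exact h
    have hsub : Set.Ioo 0 ρ ⊆ Set.Ioi (0:ℝ) := fun r hr => hr.1
    rw [setIntegral_congr_fun measurableSet_Ioi h7, setIntegral_indicator measurableSet_Ioo,
      Set.inter_eq_right.2 hsub] at h6
    rw [intervalIntegral.integral_of_le hρ.le, integral_Ioc_eq_integral_Ioo]
    exact h6
  have hd : HasDerivAt (fun u => ∫ r in (0:ℝ)..u, a r) (a 1) 1 :=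
      intervalIntegral.integral_hasDerivAt_right (hac.intervalIntegrable _ _) (hac.stronglyMeasurableAtFilter _ _) hac.continuousAt
  have he : (fun u => ∫ r in (0:ℝ)..u, a r) =ᶠ[𝓝 1] fun _ => 0 := by
    filter_upwards [lt_mem_nhds (zero_lt_one (α := ℝ))] with u hu using key u hu
  have := (hd.congr_of_eventuallyEq he.symm).unique (hasDerivAt_const 1 (0:ℝ))
  simpa [ha] using this

lemma vol_layer {n : ℕ} (hn : 0 < n) {δ : ℝ} (h0 : 0 < δ) (h1 : δ < 1) :
    volume {x : V n | 1 - δ ≤ ‖x‖ ∧ ‖x‖ ≤ 1} ≤ ENNReal.ofReal (NN n * δ) := by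
  have : Nonempty (Fin n) := ⟨⟨0, hn⟩⟩
  have hs : {x : V n | 1 - δ ≤ ‖x‖ ∧ ‖x‖ ≤ 1} = closedBall 0 1 \ ball 0 (1-δ) := by
    ext x; simp [and_comm]
  rw [hs, measure_sdiff (ball_subset_closedBall.trans (closedBall_subset_closedBall (by linarith))) measurableSet_ball.nullMeasurableSet measure_ball_lt_top.ne,
    Measure.addHaar_closedBall_eq_addHaar_ball, Measure.addHaar_ball _ _ (by linarith : 0 ≤ 1 - δ), NN_eq]
  rw [finrank_euclideanSpace_fin]
  have hfin : volume (ball (0:V n) 1) ≠ ⊤ := measure_ball_lt_top.ne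
  have hpos : 0 < 1 - δ := by linarith
  rw [← ENNReal.ofReal_toReal hfin, ← ENNReal.ofReal_mul (by positivity), ← ENNReal.ofReal_sub _ (by positivity)]
  apply ENNReal.ofReal_le_ofReal
  rw [measureReal_def]
  have hb := one_add_mul_le_pow (show -2 ≤ -δ by linarith) n
  have : 0 ≤ (volume (ball (0:V n) 1)).toReal := by positivity
  have e : (1 + -δ) = 1 - δ := by ring
  rw [e] at hb
  nlinarith

lemma per_image_le {n : ℕ} (hn : 0 < n) {T T' : V n → V n} {K : ℝ≥0} (hT : LipschitzWith K T) (hT' : LipschitzWith K T')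
    (h1 : ∀ x, T (T' x) = x) (h2 : ∀ x, T' (T x) = x) :
    perimeter (T '' ball 0 1) ≤ ENNReal.ofReal (K^(n+1) * NN n) := by
  have hE : T '' ball 0 1 = {w | ‖T' w‖ < 1} := by
    ext w; constructor
    · rintro ⟨x, hx, rfl⟩
      simpa [h2] using hx
    · intro hw
      exact ⟨T' w, by simpa using hw, h1 w⟩
  rw [hE]
  have hl : LipschitzWith (1 * K) (fun w => ‖T' w‖) := lipschitzWith_one_norm.comp hT'
  rw [one_mul] at hl
  have := per_le hl (D := K^n * NN n) (mul_nonneg (by positivity) (NN_pos hn).le) ?_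
  · convert this using 2; ring
  intro δ h0 hd1
  have hs : {x | 1 - δ ≤ ‖T' x‖ ∧ ‖T' x‖ ≤ 1} = T '' {x : V n | 1 - δ ≤ ‖x‖ ∧ ‖x‖ ≤ 1} := by
    ext w; constructor
    · intro hw
      exact ⟨T' w, hw, h1 w⟩
    · rintro ⟨x, hx, rfl⟩
      simpa [h2] using hx
  rw [hs]
  refine (vol_lip hT _).trans ?_
  refine (mul_le_mul_right (vol_layer hn h0 hd1) _).trans ?_
  have e : ENNReal.ofReal ((K:ℝ)^n * NN n * δ) = (K:ℝ≥0∞)^n * ENNReal.ofReal (NN n * δ) := by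
    rw [mul_assoc, ENNReal.ofReal_mul (by positivity), ENNReal.ofReal_pow (by positivity), ENNReal.ofReal_coe_nnreal]
  rw [e]

def vcons {d : ℕ} (p : ℝ × V d) : V (d+1) := WithLp.toLp 2 (Fin.cons p.1 (WithLp.ofLp p.2))

lemma vcons_mp (d : ℕ) : MeasurePreserving (vcons (d := d)) (volume.prod volume) volume := by
  have h1 := (PiLp.volume_preserving_toLp (Fin (d+1)))
  have h2 := (volume_preserving_piFinSuccAbove (fun _ : Fin (d+1) => ℝ) 0).symm
  have h3 : MeasurePreserving (fun p : ℝ × V d => (p.1, WithLp.ofLp p.2)) (volume.prod volume) (volume.prod volume) :=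
    (MeasurePreserving.id volume).prod (PiLp.volume_preserving_ofLp (Fin d))
  have h4 := (h1.comp h2).comp h3
  have e : vcons (d := d) = (WithLp.toLp 2 ∘ ⇑(MeasurableEquiv.piFinSuccAbove (fun _ : Fin (d+1) => ℝ) 0).symm) ∘ fun p : ℝ × V d => (p.1, WithLp.ofLp p.2) := by
    funext p
    simp [vcons, MeasurableEquiv.piFinSuccAbove]
    rfl
  rw [e]
  exact h4

lemma vcons_zero {d : ℕ} (p : ℝ × V d) : (vcons p) 0 = p.1 := by simp [vcons]

lemma vcons_norm {d : ℕ} (p : ℝ × V d) : ‖vcons p‖ = √(p.1^2 + ‖p.2‖^2) := by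
  rw [EuclideanSpace.norm_eq, EuclideanSpace.norm_eq, Real.sq_sqrt (by positivity), Fin.sum_univ_succ]
  simp [vcons]

/-- zonal formula -/
lemma zonal {d : ℕ} (hd : 0 < d) (F : ℝ → ℝ≥0∞) (hF : Measurable F) :
    ∫⁻ x, F (x 0) ∂(sph (d+1)) =
      ENNReal.ofReal (NN d) * ∫⁻ θ in Set.Ioo 0 Real.pi, ENNReal.ofReal (Real.sin θ ^ (d-1)) * F (Real.cos θ) := by
  set I : ℝ → ℝ≥0∞ := fun r => if r < 1 then 1 else 0 with hI
  have hIm : Measurable I := Measurable.ite measurableSet_Iio measurable_const measurable_const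
  set c : ℝ≥0∞ := ∫⁻ r in Set.Ioi (0:ℝ), ENNReal.ofReal (r^d) * I r with hc
  have hcm : Measurable (fun r : ℝ => ENNReal.ofReal (r^d) * I r) := by fun_prop
  have hc0 : c ≠ 0 := by
    intro h
    rw [hc, setLIntegral_eq_zero_iff measurableSet_Ioi hcm] at h
    have h2 : volume (Set.Ioo (0:ℝ) 1) = 0 := by
      refine measure_mono_null ?_ h
      intro r hr
      have h1 : 0 < r := hr.1
      have h2 : r < 1 := hr.2
      have h3 : 0 < r^d := by positivity
      simp only [Set.mem_compl_iff, Set.mem_setOf_eq, hI, h2, if_true, mul_one]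
      intro h; have := h h1
      simp at this; linarith
    simp at h2
  have hct : c ≠ ⊤ := by
    have : c ≤ ∫⁻ r in Set.Ioo (0:ℝ) 1, 1 := by
      rw [hc, ← lintegral_indicator measurableSet_Ioi, ← lintegral_indicator measurableSet_Ioo]
      apply lintegral_mono
      intro r
      simp only [Set.indicator, hI, Set.mem_Ioi, Set.mem_Ioo]
      by_cases h1 : 0 < r <;> by_cases h2 : r < 1 <;> simp [h1, h2]
      exact pow_le_one₀ h1.le h2.le
    refine (this.trans_lt ?_).ne
    simp
  set Q : V (d+1) → ℝ≥0∞ := fun w => F (w 0 / ‖w‖) * I ‖w‖ with hQ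
  have hQm : Measurable Q := by fun_prop
  have e1 : ∫⁻ w, Q w = c * ∫⁻ x, F (x 0) ∂(sph (d+1)) := by
    rw [lint_polar (by omega) Q hQm, ← lintegral_const_mul _ (by fun_prop)]
    apply lintegral_congr_ae
    filter_upwards [sph_norm (d+1)] with x hx
    rw [lint_rad _ (by fun_prop), hc, ← lintegral_mul_const _ (by fun_prop)]
    apply setLIntegral_congr_fun measurableSet_Ioi
    intro r hr
    have hr : 0 < r := hr
    simp only [hQ, norm_smul, hx, Real.norm_of_nonneg hr.le, mul_one, Nat.add_sub_cancel, PiLp.smul_apply, smul_eq_mul]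
    rw [mul_div_cancel_left₀ _ hr.ne']
    ring
  have e2 : ∫⁻ w, Q w = ENNReal.ofReal (NN d) * ∫⁻ p : ℝ × ℝ, (if 0 < p.2 then ENNReal.ofReal (p.2^(d-1)) * (F (p.1 / √(p.1^2+p.2^2)) * I (√(p.1^2+p.2^2))) else 0) := by
    rw [← (vcons_mp d).lintegral_comp hQm]
    have hvm : Measurable (vcons (d := d)) := (vcons_mp d).measurable
    have hm2 : Measurable (fun p : ℝ × ℝ => (if 0 < p.2 then ENNReal.ofReal (p.2^(d-1)) * (F (p.1 / √(p.1^2+p.2^2)) * I (√(p.1^2+p.2^2))) else 0)) :=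
      Measurable.ite (measurableSet_lt measurable_const measurable_snd) (by fun_prop) measurable_const
    rw [lintegral_prod _ (by fun_prop), Measure.volume_eq_prod, lintegral_prod _ hm2.aemeasurable, ← lintegral_const_mul _ (Measurable.lintegral_prod_right' hm2)]
    apply lintegral_congr
    intro s
    simp only [hQ, vcons_zero, vcons_norm]
    have hm3 : Measurable (fun v : V d => F (s / √(s^2+‖v‖^2)) * I (√(s^2+‖v‖^2))) := by fun_prop
    rw [lint_polar hd _ hm3]
    have : ∀ x : V d, ‖x‖ = 1 → ∫⁻ r, F (s / √(s^2+‖r•x‖^2)) * I (√(s^2+‖r•x‖^2)) ∂(rad d) = ∫⁻ r : ℝ, (if 0 < r then ENNReal.ofReal (r^(d-1)) * (F (s / √(s^2+r^2)) * I (√(s^2+r^2))) else 0) := by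
      intro x hx
      rw [lint_rad _ (by fun_prop), ← lintegral_indicator measurableSet_Ioi]
      apply lintegral_congr
      intro r
      simp only [Set.indicator, Set.mem_Ioi, norm_smul, hx, mul_one, Real.norm_eq_abs, sq_abs]
    rw [lintegral_congr_ae (g := fun _ => _) ((sph_norm d).mono this), lintegral_const, mul_comm]
    congr 1
    rw [NN, measureReal_def, ENNReal.ofReal_toReal (measure_ne_top _ _)]
  have e3 : ∫⁻ p : ℝ × ℝ, (if 0 < p.2 then ENNReal.ofReal (p.2^(d-1)) * (F (p.1 / √(p.1^2+p.2^2)) * I (√(p.1^2+p.2^2))) else 0)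
     = c * ∫⁻ θ in Set.Ioo 0 Real.pi, ENNReal.ofReal (Real.sin θ ^ (d-1)) * F (Real.cos θ) := by
    rw [← lintegral_comp_polarCoord_symm, polarCoord_target, Measure.volume_eq_prod,
      ← Measure.prod_restrict]
    have : ∀ p ∈ Set.Ioi (0:ℝ) ×ˢ Set.Ioo (-Real.pi) Real.pi, (ENNReal.ofReal p.1 • (if 0 < (polarCoord.symm p).2 then ENNReal.ofReal ((polarCoord.symm p).2^(d-1)) * (F ((polarCoord.symm p).1 / √((polarCoord.symm p).1^2+(polarCoord.symm p).2^2)) * I (√((polarCoord.symm p).1^2+(polarCoord.symm p).2^2))) else 0)) = (ENNReal.ofReal (p.1^d) * I p.1) * (Set.Ioo 0 Real.pi).indicator (fun θ => ENNReal.ofReal (Real.sin θ ^ (d-1)) * F (Real.cos θ)) p.2 := by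
      rintro ⟨ρ, θ⟩ ⟨h1, h2⟩
      have h1 : 0 < ρ := h1
      have h2a : -Real.pi < θ := h2.1
      have h2b : θ < Real.pi := h2.2
      simp only [polarCoord_symm_apply]
      have e : (ρ * Real.cos θ)^2 + (ρ * Real.sin θ)^2 = ρ^2 := by
        have := Real.sin_sq_add_cos_sq θ
        nlinarith
      rw [e, Real.sqrt_sq h1.le, mul_div_cancel_left₀ _ h1.ne']
      by_cases h : 0 < θ
      · have hs : 0 < Real.sin θ := Real.sin_pos_of_pos_of_lt_pi h h2b
        have hm : θ ∈ Set.Ioo 0 Real.pi := ⟨h, h2b⟩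
        rw [if_pos (by positivity), Set.indicator_of_mem hm, mul_pow, ENNReal.ofReal_mul (by positivity), smul_eq_mul]
        have : ρ^d = ρ * ρ^(d-1) := by rw [← pow_succ', Nat.sub_add_cancel hd]
        rw [this, ENNReal.ofReal_mul h1.le]
        ring
      · have hs : Real.sin θ ≤ 0 := Real.sin_nonpos_of_nonpos_of_neg_pi_le (by linarith) h2a.le
        have hm : θ ∉ Set.Ioo 0 Real.pi := fun h' => h h'.1
        rw [if_neg (by nlinarith), Set.indicator_of_notMem hm]
        simp
    have hmi : Measurable ((Set.Ioo 0 Real.pi).indicator (fun θ => ENNReal.ofReal (Real.sin θ ^ (d-1)) * F (Real.cos θ))) :=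
      Measurable.indicator (by fun_prop) measurableSet_Ioo
    rw [Measure.prod_restrict, setLIntegral_congr_fun (measurableSet_Ioi.prod measurableSet_Ioo) this,
      ← Measure.prod_restrict, lintegral_prod_mul hcm.aemeasurable hmi.aemeasurable, lintegral_indicator measurableSet_Ioo,
      Measure.restrict_restrict measurableSet_Ioo]
    have hsub : Set.Ioo 0 Real.pi ⊆ Set.Ioo (-Real.pi) Real.pi := Set.Ioo_subset_Ioo_left (by linarith [Real.pi_pos])
    rw [Set.inter_eq_left.2 hsub]
  rw [e2, e3] at e1
  have : c * ∫⁻ x, F (x 0) ∂(sph (d+1)) = c * (ENNReal.ofReal (NN d) * ∫⁻ θ in Set.Ioo 0 Real.pi, ENNReal.ofReal (Real.sin θ ^ (d-1)) * F (Real.cos θ)) := by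
    rw [← e1]; ring
  exact (ENNReal.mul_right_inj hc0 hct).1 this

lemma exists_rot {n : ℕ} {x y : V n} (h : ‖x‖ = ‖y‖) : ∃ g : V n ≃ₗᵢ[ℝ] V n, g x = y :=
  ⟨(ℝ ∙ (x - y))ᗮ.reflection, Submodule.reflection_sub h⟩

lemma kle_of_sq {a b : ℝ} (h : a^2 ≤ b^2) (hb : 0 ≤ b) : a ≤ b := abs_le_of_sq_le_sq' h hb |>.2

set_option maxHeartbeats 1000000 in
lemma cap_diam {a δ θ1 θ2 : ℝ} (ha : 0 ≤ a) (ha1 : a ≠ 1) (hδ : 0 < δ) (hδ1 : δ ≤ 1/8)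
    (h1 : θ1 ∈ Set.Ioo 0 Real.pi) (h2 : θ2 ∈ Set.Ioo 0 Real.pi) (c1 : |Real.cos θ1 - a| ≤ 2*δ) (c2 : |Real.cos θ2 - a| ≤ 2*δ) :
    |θ1 - θ2| ≤ 20 * δ * (√|1-a|)⁻¹ := by
  have hpi := Real.pi_pos
  have hpi4 := Real.pi_lt_d2
  have hb : 0 < |1 - a| := abs_pos.2 (sub_ne_zero.2 ha1.symm)
  have hsb : 0 < √|1-a| := Real.sqrt_pos.2 hb
  set b := |1-a| with hbdef
  have k1 : Real.cos θ1 = 1 - 2 * Real.sin (θ1/2)^2 := by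
    have := Real.cos_two_mul (θ1/2); rw [show 2*(θ1/2) = θ1 by ring] at this
    have := Real.sin_sq_add_cos_sq (θ1/2); nlinarith
  have k2 : Real.cos θ2 = 1 - 2 * Real.sin (θ2/2)^2 := by
    have := Real.cos_two_mul (θ2/2); rw [show 2*(θ2/2) = θ2 by ring] at this
    have := Real.sin_sq_add_cos_sq (θ2/2); nlinarith
  have p1 : 0 < Real.sin (θ1/2) := Real.sin_pos_of_pos_of_lt_pi (by linarith [h1.1]) (by linarith [h1.2])
  have p2 : 0 < Real.sin (θ2/2) := Real.sin_pos_of_pos_of_lt_pi (by linarith [h2.1]) (by linarith [h2.2])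
  have q1 : 2/Real.pi*(θ1/2) ≤ Real.sin (θ1/2) := Real.mul_le_sin (by linarith [h1.1]) (by linarith [h1.2])
  have q2 : 2/Real.pi*(θ2/2) ≤ Real.sin (θ2/2) := Real.mul_le_sin (by linarith [h2.1]) (by linarith [h2.2])
  rw [abs_le] at c1 c2
  rw [← div_eq_mul_inv, le_div_iff₀ hsb]
  have hbs : √b * √b = b := Real.mul_self_sqrt hb.le
  by_cases hc : b ≤ 4*δ
  · -- both small
    have hab : a ≥ 1 - b := by rw [hbdef]; linarith [le_abs_self (1-a)]
    have key : ∀ θ ∈ Set.Ioo 0 Real.pi, 2/Real.pi*(θ/2) ≤ Real.sin (θ/2) → 0 < Real.sin (θ/2) → 2 * Real.sin (θ/2)^2 ≤ 6*δ → θ * √b ≤ 20 * δ := by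
      intro θ hθ hq hp hs
      have h0 : 0 < θ := hθ.1
      have e : θ = Real.pi * (2/Real.pi*(θ/2)) := by field_simp
      have h3 : θ ≤ 3.15 * Real.sin (θ/2) := by
        rw [e]; 
        have : 0 ≤ 2/Real.pi*(θ/2) := by positivity
        rw [← e]; nlinarith
      have h5 : (θ * √b)^2 ≤ (20*δ)^2 := by
        rw [mul_pow, Real.sq_sqrt hb.le]
        have t1 : θ^2 ≤ (3.15 * Real.sin (θ/2))^2 := pow_le_pow_left₀ h0.le h3 2
        have t2 : θ^2 ≤ 30 * δ := by rw [mul_pow] at t1; linarith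
        have t3 : θ^2 * b ≤ (30*δ)*(4*δ) := mul_le_mul t2 hc hb.le (by positivity)
        have t4 : 0 < δ*δ := by positivity
        linarith
      exact kle_of_sq h5 (by positivity) 
    have r1 := key θ1 h1 q1 p1 (by linarith)
    have r2 := key θ2 h2 q2 p2 (by linarith)
    have : |θ1 - θ2| ≤ max θ1 θ2 := by
      rcases le_total θ1 θ2 with h | h
      · rw [max_eq_right h, abs_of_nonpos (by linarith)]; linarith [h1.1]
      · rw [max_eq_left h, abs_of_nonneg (by linarith)]; linarith [h2.1]
    rcases max_choice θ1 θ2 with h | h <;> rw [h] at this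
    · exact (mul_le_mul_of_nonneg_right this hsb.le).trans r1
    · exact (mul_le_mul_of_nonneg_right this hsb.le).trans r2
  · push Not at hc
    have hb1 : b = 1 - a := by
      rw [hbdef]; apply abs_of_nonneg
      by_contra h
      have : b = a - 1 := by rw [hbdef, abs_of_neg (by linarith)]; ring
      nlinarith
    set s1 := Real.sin (θ1/2)
    set s2 := Real.sin (θ2/2)
    have l1 : √b / 2 ≤ s1 := by
      refine kle_of_sq ?_ p1.le
      rw [div_pow, Real.sq_sqrt hb.le]; linarith
    have l2 : √b / 2 ≤ s2 := by
      refine kle_of_sq ?_ p2.le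
      rw [div_pow, Real.sq_sqrt hb.le]; linarith
    have hdiff : |s1 - s2| * √b ≤ 2 * δ := by
      have e : |s1 - s2| * (s1 + s2) = |s1^2 - s2^2| := by
        rw [show s1^2 - s2^2 = (s1-s2)*(s1+s2) by ring, abs_mul, abs_of_pos (by linarith : 0 < s1+s2)]
      have : |s1^2 - s2^2| ≤ 2 * δ := by rw [abs_le]; constructor <;> linarith
      nlinarith [abs_nonneg (s1 - s2)]
    -- |θ1-θ2| ≤ 10 |s1 - s2|
    have hcos : ∀ θ ∈ Set.Ioo 0 Real.pi, Real.sin (θ/2)^2 ≤ 5/8 → 1/2 ≤ Real.cos (θ/2) := by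
      intro θ hθ hs
      have hc : 0 < Real.cos (θ/2) := Real.cos_pos_of_mem_Ioo ⟨by linarith [hθ.1], by linarith [hθ.2]⟩
      have h5 := Real.sin_sq_add_cos_sq (θ/2)
      exact kle_of_sq (by linarith) hc.le
    have m1 := hcos θ1 h1 (by show s1^2 ≤ 5/8; linarith)
    have m2 := hcos θ2 h2 (by show s2^2 ≤ 5/8; linarith)
    have hmain : |θ1 - θ2| ≤ 10 * |s1 - s2| := by
      have hss := Real.sin_sub_sin (θ1/2) (θ2/2)
      have hcm : 1/2 ≤ Real.cos ((θ1/2 + θ2/2)/2) := by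
        rcases le_total θ1 θ2 with h | h
        · exact m2.trans (Real.cos_le_cos_of_nonneg_of_le_pi (by linarith [h1.1, h2.1]) (by linarith [h2.2]) (by linarith))
        · exact m1.trans (Real.cos_le_cos_of_nonneg_of_le_pi (by linarith [h1.1, h2.1]) (by linarith [h1.2]) (by linarith))
      have hsn : 2/Real.pi * |(θ1/2 - θ2/2)/2| ≤ |Real.sin ((θ1/2-θ2/2)/2)| := 
        Real.mul_abs_le_abs_sin (by rw [abs_le]; constructor <;> linarith [h1.1, h1.2, h2.1, h2.2])
      have e1 : |s1 - s2| = 2 * |Real.sin ((θ1/2-θ2/2)/2)| * Real.cos ((θ1/2 + θ2/2)/2) := by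
        show |Real.sin (θ1/2) - Real.sin (θ2/2)| = _
        rw [hss, abs_mul, abs_mul, abs_of_pos (by norm_num : (0:ℝ)<2), abs_of_pos (by linarith : 0 < Real.cos ((θ1/2 + θ2/2)/2))]
      have e2 : |(θ1/2 - θ2/2)/2| = |θ1 - θ2|/4 := by
        rw [show (θ1/2 - θ2/2)/2 = (θ1 - θ2)/4 by ring, abs_div]; norm_num
      rw [e2] at hsn
      have h3 : 1/2 ≤ 2/Real.pi := by rw [div_le_div_iff₀ (by norm_num) hpi]; linarith
      have h4 : |θ1-θ2|/8 ≤ |Real.sin ((θ1/2-θ2/2)/2)| := by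
        have := mul_le_mul_of_nonneg_right h3 (by positivity : 0 ≤ |θ1-θ2|/4)
        linarith
      rw [e1]
      have t := mul_le_mul_of_nonneg_left hcm (by positivity : 0 ≤ 2 * |Real.sin ((θ1/2-θ2/2)/2)|)
      linarith [abs_nonneg (θ1 - θ2)]
    have t := mul_le_mul_of_nonneg_right hmain hsb.le
    linarith

lemma cap_sph {d : ℕ} (hd : 0 < d) {e : V (d+1)} (he : ‖e‖ = 1) {a δ : ℝ} (ha : 0 ≤ a) (ha1 : a ≠ 1) (hδ : 0 < δ) (hδ1 : δ ≤ 1/8) :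
    sph (d+1) {x | |inner ℝ x e - a| ≤ 2*δ} ≤ ENNReal.ofReal (NN d * (20 * δ * (√|1-a|)⁻¹)) := by
  obtain ⟨g, hg⟩ := exists_rot (x := e) (y := EuclideanSpace.single 0 (1:ℝ)) (by simp [he])
  have hm : MeasurableSet {s : ℝ | |s - a| ≤ 2*δ} := measurableSet_le (by fun_prop) (by fun_prop)
  have h1 : {x : V (d+1) | |inner ℝ x e - a| ≤ 2*δ} = g ⁻¹' {x | |x 0 - a| ≤ 2*δ} := by
    ext x
    have : inner ℝ x e = (g x) 0 := by
      rw [← g.inner_map_map, hg, EuclideanSpace.inner_single_right]; simp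
    simp [this]
  have hm2 : MeasurableSet {x : V (d+1) | |x 0 - a| ≤ 2*δ} := measurableSet_le (by fun_prop) (by fun_prop)
  rw [h1, (sph_mp g).measure_preimage hm2.nullMeasurableSet, ← lintegral_indicator_one hm2]
  have h2 : ∀ x : V (d+1), {x : V (d+1) | |x 0 - a| ≤ 2*δ}.indicator (1 : V (d+1) → ℝ≥0∞) x = {s : ℝ | |s - a| ≤ 2*δ}.indicator 1 (x 0) := by
    intro x; simp [Set.indicator]
  simp_rw [h2]
  rw [zonal hd _ (measurable_one.indicator hm), ENNReal.ofReal_mul (NN_pos hd).le]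
  gcongr
  have h3 : ∫⁻ θ in Set.Ioo 0 Real.pi, ENNReal.ofReal (Real.sin θ ^ (d-1)) * {s : ℝ | |s - a| ≤ 2*δ}.indicator 1 (Real.cos θ)
     ≤ ∫⁻ θ in Set.Ioo 0 Real.pi, {θ : ℝ | |Real.cos θ - a| ≤ 2*δ}.indicator 1 θ := by
    apply setLIntegral_mono' measurableSet_Ioo
    intro θ hθ
    have hs := Real.sin_nonneg_of_nonneg_of_le_pi hθ.1.le hθ.2.le
    have : ENNReal.ofReal (Real.sin θ ^ (d-1)) ≤ 1 := by
      rw [ENNReal.ofReal_le_one]; exact pow_le_one₀ hs (Real.sin_le_one _)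
    refine (mul_le_mul_left this _).trans ?_
    rw [one_mul]; simp [Set.indicator]
  refine h3.trans ?_
  have hm4 : MeasurableSet {θ : ℝ | |Real.cos θ - a| ≤ 2*δ} := measurableSet_le (by fun_prop) (by fun_prop)
  rw [lintegral_indicator_one hm4, Measure.restrict_apply hm4]
  refine (Real.volume_le_diam _).trans ?_
  apply ediam_le
  rintro θ1 ⟨c1, h1⟩ θ2 ⟨c2, h2⟩
  rw [edist_dist, Real.dist_eq]
  exact ENNReal.ofReal_le_ofReal (cap_diam ha ha1 hδ hδ1 h1 h2 c1 c2)

lemma S_lemma {d : ℕ} (hd : 0 < d) : ∃ C : ℝ, 0 < C ∧ ∀ (e : V (d+1)), ‖e‖ = 1 → ∀ a δ : ℝ, 0 ≤ a → a ≠ 1 → 0 < δ → δ ≤ 1/8 →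
    volume {w : V (d+1) | |‖w‖ - 1| ≤ δ ∧ |inner ℝ w e - a| ≤ δ} ≤ ENNReal.ofReal (C * δ^2 * (√|1-a|)⁻¹) := by
  refine ⟨NN d * 40 * 2^d, by have := NN_pos hd; positivity, ?_⟩
  intro e he a δ ha ha1 hδ hδ1
  have hm : MeasurableSet {w : V (d+1) | |‖w‖ - 1| ≤ δ ∧ |inner ℝ w e - a| ≤ δ} :=
    (measurableSet_le (f := fun w : V (d+1) => |‖w‖ - 1|) (g := fun _ => δ) (by fun_prop) (by fun_prop)).inter
      (measurableSet_le (f := fun w : V (d+1) => |inner ℝ w e - a|) (g := fun _ => δ) (by fun_prop) (by fun_prop))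
  have hm2 : MeasurableSet {x : V (d+1) | |inner ℝ x e - a| ≤ 2*δ} := measurableSet_le (by fun_prop) (by fun_prop)
  rw [← lintegral_indicator_one hm, lint_polar (by omega) _ (measurable_one.indicator hm)]
  have key : ∀ x : V (d+1), ‖x‖ = 1 → ∫⁻ r, {w : V (d+1) | |‖w‖ - 1| ≤ δ ∧ |inner ℝ w e - a| ≤ δ}.indicator 1 (r • x) ∂(rad (d+1))
      ≤ {x : V (d+1) | |inner ℝ x e - a| ≤ 2*δ}.indicator (fun _ => ENNReal.ofReal (2^d * (2*δ))) x := by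
    intro x hx
    have hmr : Measurable (fun r : ℝ => {w : V (d+1) | |‖w‖ - 1| ≤ δ ∧ |inner ℝ w e - a| ≤ δ}.indicator (1 : V (d+1) → ℝ≥0∞) (r • x)) :=
      (measurable_one.indicator hm).comp (by fun_prop)
    rw [lint_rad _ hmr]
    have hxe : |inner ℝ x e| ≤ 1 := by
      have := abs_real_inner_le_norm x e; rwa [hx, he, one_mul] at this
    by_cases h : x ∈ {x : V (d+1) | |inner ℝ x e - a| ≤ 2*δ}
    · rw [Set.indicator_of_mem h]
      have : ∫⁻ r in Set.Ioi (0:ℝ), ENNReal.ofReal (r^(d+1-1)) * {w : V (d+1) | |‖w‖ - 1| ≤ δ ∧ |inner ℝ w e - a| ≤ δ}.indicator 1 (r • x)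
         ≤ ∫⁻ r : ℝ, (Set.Icc (1-δ) (1+δ)).indicator (fun _ => ENNReal.ofReal (2^d)) r := by
        rw [← lintegral_indicator measurableSet_Ioi]
        apply lintegral_mono
        intro r
        by_cases hr : 0 < r
        · have hri : r ∈ Set.Ioi (0:ℝ) := hr
          rw [Set.indicator_of_mem hri]
          by_cases hr2 : r ∈ Set.Icc (1-δ) (1+δ)
          · rw [Set.indicator_of_mem hr2]
            have : {w : V (d+1) | |‖w‖ - 1| ≤ δ ∧ |inner ℝ w e - a| ≤ δ}.indicator (1 : V (d+1) → ℝ≥0∞) (r • x) ≤ 1 :=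
              Set.indicator_le_self' (fun _ _ => zero_le) _ 
            refine (mul_le_mul_right this _).trans ?_
            rw [mul_one]
            apply ENNReal.ofReal_le_ofReal
            rw [Nat.add_sub_cancel]
            exact pow_le_pow_left₀ hr.le (by linarith [hr2.2]) _
          · rw [Set.indicator_of_notMem (a := r • x)]
            · simp
            · rintro ⟨h1, h2⟩
              apply hr2
              rw [norm_smul, hx, mul_one, Real.norm_of_nonneg hr.le, abs_le] at h1
              exact ⟨by linarith, by linarith⟩
        · rw [Set.indicator_of_notMem (by simpa using hr)]; exact zero_le
      refine this.trans ?_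
      rw [lintegral_indicator measurableSet_Icc, setLIntegral_const, Real.volume_Icc, ← ENNReal.ofReal_mul (by positivity)]
      apply ENNReal.ofReal_le_ofReal
      apply le_of_eq; ring
    · rw [Set.indicator_of_notMem h]
      apply le_of_eq
      refine (setLIntegral_eq_zero_iff measurableSet_Ioi (Measurable.mul (f := fun r : ℝ => ENNReal.ofReal (r^(d+1-1))) (by fun_prop) hmr)).2 ?_
      refine ae_of_all _ (fun r hr => ?_)
      have hr : 0 < r := hr
      show ENNReal.ofReal (r^(d+1-1)) * {w : V (d+1) | |‖w‖ - 1| ≤ δ ∧ |inner ℝ w e - a| ≤ δ}.indicator (1 : V (d+1) → ℝ≥0∞) (r • x) = 0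
      rw [Set.indicator_of_notMem]
      · simp
      rintro ⟨h1, h2⟩
      apply h
      rw [norm_smul, hx, mul_one, Real.norm_of_nonneg hr.le] at h1
      rw [real_inner_smul_left] at h2
      have e1 : inner ℝ x e - a = (r * inner ℝ x e - a) - (r - 1) * inner ℝ x e := by ring
      have h3 : |inner ℝ x e - a| ≤ 2 * δ := by
        rw [e1]
        refine (abs_sub _ _).trans ?_
        rw [abs_mul]
        have : |r - 1| * |inner ℝ x e| ≤ δ * 1 := mul_le_mul h1 hxe (abs_nonneg _) hδ.le
        linarith
      exact h3
  refine (lintegral_mono_ae ((sph_norm _).mono key)).trans ?_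
  rw [lintegral_indicator hm2, setLIntegral_const]
  refine (mul_le_mul_right (cap_sph hd he ha ha1 hδ hδ1) _).trans ?_
  rw [← ENNReal.ofReal_mul (by positivity)]
  apply ENNReal.ofReal_le_ofReal
  apply le_of_eq; ring

lemma sph_abs_x0 {d : ℕ} (hd : 0 < d) : ∫⁻ x, ENNReal.ofReal |x 0| ∂(sph (d+1)) = ENNReal.ofReal (NN d * (2/d)) := by
  have hd' : (0:ℝ) < d := by exact_mod_cast hd
  have hpi := Real.pi_pos
  rw [zonal hd (fun s => ENNReal.ofReal |s|) (by fun_prop), ENNReal.ofReal_mul (NN_pos hd).le]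
  congr 1
  have hD : ∀ θ, HasDerivAt (fun θ => Real.sin θ ^ d / d) (Real.sin θ ^ (d-1) * Real.cos θ) θ := by
    intro θ
    have := ((Real.hasDerivAt_sin θ).pow d).div_const (d:ℝ)
    refine HasDerivAt.congr_deriv this ?_
    field_simp
  have hcont : Continuous (fun θ => Real.sin θ ^ (d-1) * |Real.cos θ|) := by fun_prop
  have hcont2 : Continuous (fun θ => Real.sin θ ^ (d-1) * Real.cos θ) := by fun_prop
  have e1 : ∀ θ ∈ Set.Ioo 0 Real.pi, ENNReal.ofReal (Real.sin θ ^ (d-1)) * ENNReal.ofReal |Real.cos θ| = ENNReal.ofReal (Real.sin θ ^ (d-1) * |Real.cos θ|) := by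
    intro θ hθ
    have hs := Real.sin_nonneg_of_nonneg_of_le_pi hθ.1.le hθ.2.le
    rw [ENNReal.ofReal_mul (by positivity)]
  rw [setLIntegral_congr_fun measurableSet_Ioo e1, ← ofReal_integral_eq_lintegral_ofReal]
  · congr 1
    rw [← integral_Ioc_eq_integral_Ioo, ← intervalIntegral.integral_of_le hpi.le,
      ← intervalIntegral.integral_add_adjacent_intervals (b := Real.pi/2) (hcont.intervalIntegrable _ _) (hcont.intervalIntegrable _ _)]
    have a1 : ∫ θ in (0:ℝ)..(Real.pi/2), Real.sin θ ^ (d-1) * |Real.cos θ| = ∫ θ in (0:ℝ)..(Real.pi/2), Real.sin θ ^ (d-1) * Real.cos θ := by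
      apply intervalIntegral.integral_congr
      intro θ hθ
      rw [Set.uIcc_of_le (by linarith)] at hθ
      simp only
      rw [abs_of_nonneg (Real.cos_nonneg_of_mem_Icc ⟨by linarith [hθ.1], hθ.2⟩)]
    have a2 : ∫ θ in (Real.pi/2)..Real.pi, Real.sin θ ^ (d-1) * |Real.cos θ| = ∫ θ in (Real.pi/2)..Real.pi, -(Real.sin θ ^ (d-1) * Real.cos θ) := by
      apply intervalIntegral.integral_congr
      intro θ hθ
      rw [Set.uIcc_of_le (by linarith)] at hθ
      simp only
      rw [abs_of_nonpos (Real.cos_nonpos_of_pi_div_two_le_of_le hθ.1 (by linarith [hθ.2]))]; ring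
    rw [a1, a2, intervalIntegral.integral_neg, intervalIntegral.integral_eq_sub_of_hasDerivAt (fun θ _ => hD θ) (hcont2.intervalIntegrable _ _),
      intervalIntegral.integral_eq_sub_of_hasDerivAt (fun θ _ => hD θ) (hcont2.intervalIntegrable _ _)]
    simp [hd.ne']
    ring
  · exact (hcont.integrableOn_Icc (a := 0) (b := Real.pi)).mono_set Set.Ioo_subset_Icc_self
  · filter_upwards [self_mem_ae_restrict measurableSet_Ioo] with θ hθ
    have hs := Real.sin_nonneg_of_nonneg_of_le_pi hθ.1.le hθ.2.le
    positivity

/-- the weight in the c² identity -/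
def Wt (d : ℕ) (r : ℝ) : ℝ := if r < 2 then (1 - r^2/4)^(((d:ℝ)-2)/2) else 0

lemma Wt_meas (d : ℕ) : Measurable (Wt d) := 
  Measurable.ite measurableSet_Iio (by fun_prop) measurable_const

lemma Wt_nonneg (d : ℕ) {r : ℝ} (hr : 0 ≤ r) : 0 ≤ Wt d r := by
  unfold Wt; split_ifs with h
  · exact Real.rpow_nonneg (by nlinarith) _
  · exact le_rfl

lemma chord_subst {d : ℕ} (hd : 0 < d) (K : ℝ → ℝ≥0∞) :
    ∫⁻ θ in Set.Ioo 0 Real.pi, ENNReal.ofReal (Real.sin θ ^ (d-1)) * (K (√(2 - 2*Real.cos θ)) * ENNReal.ofReal (2 - 2 * Real.cos θ))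
     = ∫⁻ r in Set.Ioi (0:ℝ), ENNReal.ofReal (r^d) * (ENNReal.ofReal (r) * (K r * ENNReal.ofReal (Wt d r))) := by
  have hpi := Real.pi_pos
  have himg : (fun θ => 2 * Real.sin (θ/2)) '' Set.Ioo 0 Real.pi = Set.Ioo 0 2 := by
    ext r; constructor
    · rintro ⟨θ, hθ, rfl⟩
      have h1 : 0 < Real.sin (θ/2) := Real.sin_pos_of_pos_of_lt_pi (by linarith [hθ.1]) (by linarith [hθ.2])
      have hc : 0 < Real.cos (θ/2) := Real.cos_pos_of_mem_Ioo ⟨by linarith [hθ.1], by linarith [hθ.2]⟩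
      have := Real.sin_sq_add_cos_sq (θ/2)
      refine ⟨by simpa using h1, ?_⟩
      simp only
      have : Real.sin (θ/2) < 1 := by nlinarith
      linarith
    · intro hr
      have hr1 : 0 < r := hr.1
      have hr2 : r < 2 := hr.2
      refine ⟨2 * Real.arcsin (r/2), ⟨?_, ?_⟩, ?_⟩
      · have := Real.arcsin_pos.2 (by linarith : 0 < r/2); linarith
      · have := Real.arcsin_lt_pi_div_two.2 (by linarith : r/2 < 1); linarith
      · simp only
        rw [mul_div_cancel_left₀ _ (two_ne_zero), Real.sin_arcsin (by linarith) (by linarith)]; ring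
  have hinj : Set.InjOn (fun θ => 2 * Real.sin (θ/2)) (Set.Ioo 0 Real.pi) := by
    intro a ha b hb hab
    simp only at hab
    have := Real.injOn_sin (x₁ := a/2) (x₂ := b/2) ⟨by linarith [ha.1], by linarith [ha.2]⟩ ⟨by linarith [hb.1], by linarith [hb.2]⟩ (by linarith)
    linarith
  have hder : ∀ θ ∈ Set.Ioo 0 Real.pi, HasDerivWithinAt (fun θ => 2 * Real.sin (θ/2)) (Real.cos (θ/2)) (Set.Ioo 0 Real.pi) θ := by
    intro θ _
    apply HasDerivAt.hasDerivWithinAt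
    have := ((hasDerivAt_id θ).div_const 2).sin.const_mul 2
    refine HasDerivAt.congr_deriv this ?_
    simp only [id]; ring
  have hcv := lintegral_image_eq_lintegral_abs_deriv_mul measurableSet_Ioo hder hinj
    (fun r => ENNReal.ofReal (r^d) * (ENNReal.ofReal (r) * (K r * ENNReal.ofReal (Wt d r))))
  rw [himg] at hcv
  have e1 : ∫⁻ r in Set.Ioi (0:ℝ), ENNReal.ofReal (r^d) * (ENNReal.ofReal (r) * (K r * ENNReal.ofReal (Wt d r)))
     = ∫⁻ r in Set.Ioo (0:ℝ) 2, ENNReal.ofReal (r^d) * (ENNReal.ofReal (r) * (K r * ENNReal.ofReal (Wt d r))) := by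
    rw [← lintegral_indicator measurableSet_Ioi, ← lintegral_indicator measurableSet_Ioo]
    apply lintegral_congr
    intro r
    simp only [Set.indicator, Set.mem_Ioi, Set.mem_Ioo, Wt]
    by_cases h1 : 0 < r <;> by_cases h2 : r < 2 <;> simp [h1, h2]
  rw [e1, hcv]
  apply setLIntegral_congr_fun measurableSet_Ioo
  intro θ hθ
  have hs : 0 < Real.sin (θ/2) := Real.sin_pos_of_pos_of_lt_pi (by linarith [hθ.1]) (by linarith [hθ.2])
  have hc : 0 < Real.cos (θ/2) := Real.cos_pos_of_mem_Ioo ⟨by linarith [hθ.1], by linarith [hθ.2]⟩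
  have hsc := Real.sin_sq_add_cos_sq (θ/2)
  have hs2 : Real.sin (θ/2) < 1 := by nlinarith
  have k0 : Real.sin θ = 2 * Real.sin (θ/2) * Real.cos (θ/2) := by
    rw [← Real.sin_two_mul]; congr 1; ring
  have k1 : Real.cos θ = 1 - 2 * Real.sin (θ/2)^2 := by
    have := Real.cos_two_mul (θ/2); rw [show 2*(θ/2) = θ by ring] at this
    nlinarith
  have k2 : 2 - 2 * Real.cos θ = (2 * Real.sin (θ/2))^2 := by rw [k1]; ring
  simp only
  rw [k2, Real.sqrt_sq (by positivity), k0]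
  set s := Real.sin (θ/2)
  set c := Real.cos (θ/2)
  have hW : Wt d (2*s) = c^((d:ℝ)-2) := by
    unfold Wt
    rw [if_pos (by linarith), show 1 - (2*s)^2/4 = c^2 by nlinarith, ← Real.rpow_natCast, ← Real.rpow_mul hc.le]
    congr 1; push_cast; ring
  have hcW : c * Wt d (2*s) = c^(d-1) := by
    rw [hW]
    nth_rewrite 1 [← Real.rpow_one c]
    rw [← Real.rpow_add hc, ← Real.rpow_natCast, Nat.cast_sub hd]
    congr 1; push_cast; ring
  have hWn : 0 ≤ Wt d (2*s) := Wt_nonneg d (by positivity)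
  rw [abs_of_pos hc]
  have : ENNReal.ofReal c * (ENNReal.ofReal ((2*s)^d) * (ENNReal.ofReal (2*s) * (K (2*s) * ENNReal.ofReal (Wt d (2*s)))))
    = K (2*s) * ENNReal.ofReal (c * Wt d (2*s) * ((2*s)^d * (2*s))) := by
    rw [ENNReal.ofReal_mul (q := (2*s)^d * (2*s)) (by positivity), ENNReal.ofReal_mul hc.le, ENNReal.ofReal_mul (p := (2*s)^d) (by positivity)]
    ring
  rw [this, hcW]
  have : ENNReal.ofReal ((2*s*c)^(d-1)) * (K (2*s) * ENNReal.ofReal ((2*s)^2)) = K (2*s) * ENNReal.ofReal ((2*s*c)^(d-1) * (2*s)^2) := by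
    rw [ENNReal.ofReal_mul (by positivity)]; ring
  rw [this]
  congr 2
  obtain ⟨m, rfl⟩ : ∃ m, d = m+1 := ⟨d-1, by omega⟩
  simp only [Nat.add_sub_cancel]
  ring

lemma c2_identity {d : ℕ} (hd : 0 < d) (K : ℝ → ℝ≥0∞) (hK : Measurable K) {e : V (d+1)} (he : ‖e‖ = 1) :
    ∫⁻ y, K ‖e - y‖ * ENNReal.ofReal (‖e - y‖^2) ∂(sph (d+1)) =
      ENNReal.ofReal (d/2) * ∫⁻ z : V (d+1), ENNReal.ofReal |z 0| * (K ‖z‖ * ENNReal.ofReal (Wt d ‖z‖)) := by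
  have hd' : (0:ℝ) < d := by exact_mod_cast hd
  obtain ⟨g, hg⟩ := exists_rot (x := e) (y := EuclideanSpace.single 0 (1:ℝ)) (by simp [he])
  set F : ℝ → ℝ≥0∞ := fun s => K (√(2 - 2*s)) * ENNReal.ofReal (2 - 2*s) with hF
  have hFm : Measurable F := by fun_prop
  have h1 : ∀ y : V (d+1), ‖y‖ = 1 → K ‖e - y‖ * ENNReal.ofReal (‖e - y‖^2) = F ((g y) 0) := by
    intro y hy
    have h2 : ‖e - y‖^2 = 2 - 2 * (g y) 0 := by
      rw [norm_sub_sq_real, he, hy]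
      have : inner ℝ e y = (g y) 0 := by
        rw [← g.inner_map_map, hg, EuclideanSpace.inner_single_left]; simp
      rw [this]; ring
    simp only [hF]
    rw [← h2, Real.sqrt_sq (norm_nonneg _)]
  rw [lintegral_congr_ae ((sph_norm _).mono h1)]
  have h2 : ∫⁻ y, F ((g y) 0) ∂(sph (d+1)) = ∫⁻ y, F (y 0) ∂(sph (d+1)) :=
    (sph_mp g).lintegral_comp (f := fun y : V (d+1) => F (y 0)) (by fun_prop)
  have hWm := Wt_meas d
  rw [h2, zonal hd F hFm, hF]
  simp only
  rw [chord_subst hd K, lint_polar (by omega) _ (by fun_prop)]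
  set A := ∫⁻ r in Set.Ioi (0:ℝ), ENNReal.ofReal (r^d) * (ENNReal.ofReal (r) * (K r * ENNReal.ofReal (Wt d r))) with hA
  have h3 : ∀ x : V (d+1), ‖x‖ = 1 → ∫⁻ r, ENNReal.ofReal |(r • x) 0| * (K ‖r • x‖ * ENNReal.ofReal (Wt d ‖r • x‖)) ∂(rad (d+1)) = ENNReal.ofReal |x 0| * A := by
    intro x hx
    rw [lint_rad _ (by fun_prop), hA, ← lintegral_const_mul _ (by fun_prop)]
    apply setLIntegral_congr_fun measurableSet_Ioi
    intro r hr
    have hr : 0 < r := hr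
    simp only [norm_smul, hx, mul_one, Real.norm_of_nonneg hr.le, Nat.add_sub_cancel, PiLp.smul_apply, smul_eq_mul, abs_mul, abs_of_pos hr]
    rw [ENNReal.ofReal_mul hr.le]; ring
  rw [lintegral_congr_ae ((sph_norm _).mono h3), lintegral_mul_const _ (by fun_prop), sph_abs_x0 hd, ← mul_assoc, ← ENNReal.ofReal_mul (by positivity)]
  congr 2
  field_simp

structure NB {n : ℕ} (C t : ℝ) (u : V n → ℝ) (E : Set (V n)) (R : V n → ℝ) : Prop where
  meas : MeasurableSet E
  cont : Continuous R
  ray : ∀ x, ‖x‖ = 1 → ∀ ρ : ℝ, 0 < ρ → (ρ • x ∈ E ↔ ρ < R x)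
  near : ∀ x, ‖x‖ = 1 → |R x - 1| ≤ C * |t|
  lip : ∀ x y, ‖x‖ = 1 → ‖y‖ = 1 → |R x - R y| ≤ C * |t| * ‖x - y‖
  exp : ∀ x, ‖x‖ = 1 → |R x - 1 - t * u x| ≤ C * t^2

set_option maxHeartbeats 1000000 in
lemma nb_of_map {n : ℕ} {M t : ℝ} (hM : 0 ≤ M) (hMt : M * |t| ≤ 1/100) {D X : V n → V n}
    (hD : ∀ w, ‖D w‖ ≤ M * |t|) (hDL : ∀ w w', ‖D w - D w'‖ ≤ M * |t| * ‖w - w'‖)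
    (hDX : ∀ w, ‖D w + t • X w‖ ≤ M * t^2) :
    ∃ R, NB (40 * M + 7 * M^2 + M) t (fun x => inner ℝ (X x) x) {w | ‖w + D w‖ < 1} R := by
  set m := M * |t| with hm
  have hm0 : 0 ≤ m := by positivity
  have hDc : Continuous D := by
    have : LipschitzWith (Real.toNNReal m) D := by
      apply LipschitzWith.of_dist_le_mul
      intro w w'
      rw [dist_eq_norm, dist_eq_norm, Real.coe_toNNReal _ hm0]; exact hDL w w'
    exact this.continuous
  -- monotonicity
  have mono : ∀ x : V n, ‖x‖ = 1 → ∀ ρ σ : ℝ, σ ≤ ρ → 1/2 ≤ ρ + σ → 0 ≤ σ →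
      (ρ - σ)/4 ≤ ‖ρ • x + D (ρ • x)‖^2 - ‖σ • x + D (σ • x)‖^2 := by
    intro x hx ρ σ h1 h2 h3
    have e : ‖ρ • x + D (ρ • x)‖^2 - ‖σ • x + D (σ • x)‖^2 =
      (ρ-σ)*(ρ+σ) + (ρ-σ) * inner ℝ x (D (ρ • x) + D (σ • x)) + (ρ + σ) * inner ℝ (D (ρ • x) - D (σ • x)) x
        + inner ℝ (D (ρ • x) - D (σ • x)) (D (ρ • x) + D (σ • x)) := by
      rw [norm_add_sq_real, norm_add_sq_real, norm_smul, norm_smul, hx, mul_one, mul_one, Real.norm_eq_abs, Real.norm_eq_abs, sq_abs, sq_abs]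
      simp only [inner_add_right, inner_sub_left, real_inner_smul_left, real_inner_self_eq_norm_sq]
      rw [real_inner_comm (D (ρ • x)) x, real_inner_comm (D (σ • x)) x, real_inner_comm (D (σ • x)) (D (ρ • x))]
      ring
    have b1 : ‖D (ρ • x) - D (σ • x)‖ ≤ m * (ρ - σ) := by
      refine (hDL _ _).trans ?_
      rw [← sub_smul, norm_smul, hx, mul_one, Real.norm_of_nonneg (by linarith)]
    have b2 : ‖D (ρ • x) + D (σ • x)‖ ≤ 2 * m := (norm_add_le _ _).trans (by linarith [hD (ρ • x), hD (σ • x)])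
    have c1 : |inner ℝ x (D (ρ • x) + D (σ • x))| ≤ 2 * m := by
      refine (abs_real_inner_le_norm _ _).trans ?_; rw [hx, one_mul]; exact b2
    have c2 : |inner ℝ (D (ρ • x) - D (σ • x)) x| ≤ m * (ρ - σ) := by
      refine (abs_real_inner_le_norm _ _).trans ?_; rw [hx, mul_one]; exact b1
    have c3 : |inner ℝ (D (ρ • x) - D (σ • x)) (D (ρ • x) + D (σ • x))| ≤ m * (ρ - σ) * (2 * m) :=
      (abs_real_inner_le_norm _ _).trans (mul_le_mul b1 b2 (norm_nonneg _) (mul_nonneg hm0 (by linarith)))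
    rw [e]
    have hρσ : 0 ≤ ρ - σ := by linarith
    have d1 := mul_le_mul_of_nonneg_left (abs_le.1 c1).1 hρσ
    have d2 := mul_le_mul_of_nonneg_left (abs_le.1 c2).1 (by linarith : 0 ≤ ρ + σ)
    have d3 := (abs_le.1 c3).1
    have f1 : m * m ≤ 1/100 * (1/100) := mul_le_mul hMt hMt hm0 (by norm_num)
    have f2 : 0 ≤ (ρ - σ) * ((ρ + σ) * (1 - m) - 2*m - 2*(m*m) - 1/4) := by
      apply mul_nonneg hρσ
      nlinarith
    nlinarith
  -- existence of the root
  have root : ∀ x : V n, ‖x‖ = 1 → ∃ r : ℝ, |r - 1| ≤ 2 * m ∧ ‖r • x + D (r • x)‖ = 1 := by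
    intro x hx
    have hc : Continuous (fun r : ℝ => ‖r • x + D (r • x)‖) := by fun_prop
    have := intermediate_value_Icc (a := 1 - 2*m) (b := 1 + 2*m) (by linarith) hc.continuousOn
    have hmem : (1:ℝ) ∈ Set.Icc (‖(1 - 2*m) • x + D ((1 - 2*m) • x)‖) (‖(1 + 2*m) • x + D ((1+2*m) • x)‖) := by
      constructor
      · refine (norm_add_le _ _).trans ?_
        rw [norm_smul, hx, mul_one, Real.norm_of_nonneg (by linarith)]
        linarith [hD ((1 - 2*m) • x)]
      · have h1 := norm_sub_le_norm_add ((1+2*m) • x) (D ((1 + 2*m) • x))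
        rw [norm_smul, hx, mul_one, Real.norm_of_nonneg (by linarith)] at h1
        linarith [hD ((1 + 2*m) • x)]
    obtain ⟨r, hr, hr2⟩ := this hmem
    exact ⟨r, by rw [abs_le]; constructor <;> linarith [hr.1, hr.2], hr2⟩
  choose! R0 hR1 hR2 using root
  have hRb : ∀ x : V n, ‖x‖ = 1 → 49/50 ≤ R0 x ∧ R0 x ≤ 51/50 := by
    intro x hx
    have := abs_le.1 (hR1 x hx)
    constructor <;> linarith
  have hlip : ∀ x y : V n, ‖x‖ = 1 → ‖y‖ = 1 → |R0 x - R0 y| ≤ 40 * m * ‖x - y‖ := by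
    -- one-sided
    have one : ∀ x y : V n, ‖x‖ = 1 → ‖y‖ = 1 → R0 y ≤ R0 x → R0 x - R0 y ≤ 40 * m * ‖x - y‖ := by
      intro x y hx hy h
      obtain ⟨bx1, bx2⟩ := hRb x hx
      obtain ⟨by1, by2⟩ := hRb y hy
      have h1 := mono x hx (R0 x) (R0 y) h (by linarith) (by linarith)
      rw [hR2 x hx] at h1
      have h2 := hR2 y hy
      set σ := R0 y
      have e : ‖σ • y + D (σ • y)‖^2 - ‖σ • x + D (σ • x)‖^2 =
         2 * σ * inner ℝ (y - x) (D (σ • y)) + 2 * σ * inner ℝ x (D (σ • y) - D (σ • x)) + inner ℝ (D (σ • y) - D (σ • x)) (D (σ • y) + D (σ • x)) := by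
        rw [norm_add_sq_real, norm_add_sq_real, norm_smul, norm_smul, hx, hy]
        simp only [inner_add_right, inner_sub_left, inner_sub_right, real_inner_smul_left, real_inner_self_eq_norm_sq]
        rw [real_inner_comm (D (σ • y)) (D (σ • x))]
        ring
      rw [h2] at e
      have b1 : ‖D (σ • y) - D (σ • x)‖ ≤ m * (2 * ‖x - y‖) := by
        refine (hDL _ _).trans ?_
        rw [← smul_sub, norm_smul, Real.norm_of_nonneg (by linarith), norm_sub_rev y x]
        gcongr; linarith
      have b2 : ‖D (σ • y) + D (σ • x)‖ ≤ 2 * m := (norm_add_le _ _).trans (by linarith [hD (σ • y), hD (σ • x)])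
      have c1 : |inner ℝ (y - x) (D (σ • y))| ≤ ‖x - y‖ * m := by
        refine (abs_real_inner_le_norm _ _).trans ?_; rw [norm_sub_rev]; gcongr; exact hD _
      have c2 : |inner ℝ x (D (σ • y) - D (σ • x))| ≤ m * (2 * ‖x - y‖) := by
        refine (abs_real_inner_le_norm _ _).trans ?_; rw [hx, one_mul]; exact b1
      have c3 : |inner ℝ (D (σ • y) - D (σ • x)) (D (σ • y) + D (σ • x))| ≤ m * (2 * ‖x - y‖) * (2 * m) :=
        (abs_real_inner_le_norm _ _).trans (mul_le_mul b1 b2 (norm_nonneg _) (by positivity))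
      have d1 := mul_le_mul_of_nonneg_left (abs_le.1 c1).2 (by linarith : 0 ≤ 2*σ)
      have d2 := mul_le_mul_of_nonneg_left (abs_le.1 c2).2 (by linarith : 0 ≤ 2*σ)
      have d3 := (abs_le.1 c3).2
      have hp : 0 ≤ m * ‖x - y‖ := by positivity
      have g1 : 2 * σ * (‖x - y‖ * m) ≤ 3 * (m * ‖x-y‖) := by nlinarith
      have g2 : 2 * σ * (m * (2 * ‖x - y‖)) ≤ 6 * (m * ‖x-y‖) := by nlinarith
      have g3 : m * (2 * ‖x - y‖) * (2 * m) ≤ 1 * (m * ‖x-y‖) := by nlinarith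
      linarith
    intro x y hx hy
    rcases le_total (R0 y) (R0 x) with h | h
    · rw [abs_of_nonneg (by linarith)]; exact one x y hx hy h
    · rw [abs_of_nonpos (by linarith), norm_sub_rev]; linarith [one y x hy hx h]
  have hL : LipschitzOnWith (Real.toNNReal (40*m)) R0 (sphere 0 1) := by
    apply LipschitzOnWith.of_dist_le_mul
    intro x hx y hy
    rw [Real.dist_eq, dist_eq_norm, Real.coe_toNNReal _ (by positivity)]
    exact hlip x y (by simpa using hx) (by simpa using hy)
  obtain ⟨R, hRL, hReq⟩ := hL.extend_real
  have hRR : ∀ x : V n, ‖x‖ = 1 → R x = R0 x := fun x hx => (hReq (by simpa using hx)).symm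
  refine ⟨R, ?_, hRL.continuous, ?_, ?_, ?_, ?_⟩
  · exact measurableSet_lt (by fun_prop) measurable_const
  · intro x hx ρ hρ
    rw [hRR x hx, Set.mem_setOf_eq]
    obtain ⟨bx1, bx2⟩ := hRb x hx
    have hr := hR2 x hx
    by_cases h : ρ < 1/2
    · constructor
      · intro _; linarith
      · intro _
        refine (norm_add_le _ _).trans_lt ?_
        rw [norm_smul, hx, mul_one, Real.norm_of_nonneg hρ.le]
        linarith [hD (ρ • x)]
    · push Not at h
      constructor
      · intro hl
        by_contra h'
        push Not at h'
        have := mono x hx ρ (R0 x) h' (by linarith) (by linarith)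
        rw [hr] at this
        nlinarith [norm_nonneg (ρ • x + D (ρ • x))]
      · intro hl
        have := mono x hx (R0 x) ρ hl.le (by linarith) (by linarith)
        rw [hr] at this
        by_contra h'
        push Not at h'
        nlinarith [norm_nonneg (ρ • x + D (ρ • x))]
  · intro x hx
    rw [hRR x hx]
    refine (hR1 x hx).trans ?_
    rw [hm]
    nlinarith [abs_nonneg t, sq_nonneg M, mul_nonneg (sq_nonneg M) (abs_nonneg t)]
  · intro x y hx hy
    rw [hRR x hx, hRR y hy]
    refine (hlip x y hx hy).trans ?_
    have : 40 * m ≤ (40 * M + 7 * M^2 + M) * |t| := by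
      rw [hm]; nlinarith [abs_nonneg t, sq_nonneg M, mul_nonneg (sq_nonneg M) (abs_nonneg t), mul_nonneg hM (abs_nonneg t)]
    gcongr
  · intro x hx
    rw [hRR x hx]
    have hr := hR2 x hx
    have hr1 := hR1 x hx
    set r := R0 x
    obtain ⟨bx1, bx2⟩ := hRb x hx
    have e0 : ‖r • x + D (r • x)‖^2 = 1 := by rw [hr]; norm_num
    rw [norm_add_sq_real, norm_smul, hx, mul_one, Real.norm_eq_abs, sq_abs, real_inner_smul_left] at e0
    have e1 : 2 * (r - 1 - t * inner ℝ (X x) x) = -(r-1)^2 - 2 * (r-1) * inner ℝ x (D (r • x)) - 2 * inner ℝ x (D (r • x) - D x)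
        - 2 * inner ℝ x (D x + t • X x) - ‖D (r • x)‖^2 := by
      rw [inner_sub_right, inner_add_right, real_inner_smul_right, real_inner_comm (X x) x]
      linear_combination e0
    have a1 : |inner ℝ x (D (r • x))| ≤ m := by
      refine (abs_real_inner_le_norm _ _).trans ?_; rw [hx, one_mul]; exact hD _
    have a2 : |inner ℝ x (D (r • x) - D x)| ≤ m * (2*m) := by
      refine (abs_real_inner_le_norm _ _).trans ?_; rw [hx, one_mul]
      refine (hDL _ _).trans ?_
      have : r • x - x = (r - 1) • x := by rw [sub_smul, one_smul]
      rw [this, norm_smul, hx, mul_one, Real.norm_eq_abs]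
      gcongr
    have a3 : |inner ℝ x (D x + t • X x)| ≤ M * t^2 := by
      refine (abs_real_inner_le_norm _ _).trans ?_; rw [hx, one_mul]; exact hDX _
    have a4 : ‖D (r • x)‖^2 ≤ m^2 := pow_le_pow_left₀ (norm_nonneg _) (hD _) 2
    have a5 : (r-1)^2 ≤ (2*m)^2 := by rw [← sq_abs]; exact pow_le_pow_left₀ (abs_nonneg _) hr1 2
    have a6 : |(r-1) * inner ℝ x (D (r • x))| ≤ 2 * m * m := by
      rw [abs_mul]; exact mul_le_mul hr1 a1 (abs_nonneg _) (by positivity)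
    have hm2 : m^2 = M^2 * t^2 := by rw [hm, mul_pow, sq_abs]
    rw [abs_le] at a2 a3 a6 ⊢
    have hp : 0 ≤ M * t^2 := by positivity
    have hC : (40 * M + 7 * M^2 + M) * t^2 = 41 * (M * t^2) + 7 * m^2 := by rw [hm2]; ring
    rw [hC]
    have s1 := sq_nonneg (r-1)
    have s2 := sq_nonneg ‖D (r • x)‖
    constructor <;> linarith

lemma flow_gron_pos {n : ℕ} {X : V n → V n} {Φ : ℝ → V n → V n} {K : ℝ≥0} (hX : LipschitzWith K X)
    (h0 : ∀ x, Φ 0 x = x) (hf : ∀ t x, HasDerivAt (fun s => Φ s x) (X (Φ t x)) t) {t : ℝ} (ht : 0 ≤ t) (x y : V n) :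
    ‖Φ t x - Φ t y‖ ≤ ‖x - y‖ * Real.exp (K * t) := by
  have hc : ∀ x, Continuous (fun s => Φ s x) := fun x => continuous_iff_continuousAt.2 fun s => (hf s x).continuousAt
  have := dist_le_of_trajectories_ODE (v := fun _ => X) (fun _ => hX) (a := 0) (b := t) (f := fun s => Φ s x) (g := fun s => Φ s y)
    (δ := ‖x - y‖) (hc x).continuousOn (fun s _ => (hf s x).hasDerivWithinAt) (hc y).continuousOn (fun s _ => (hf s y).hasDerivWithinAt)
    (by simp [h0, dist_eq_norm]) t ⟨ht, le_rfl⟩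
  rwa [dist_eq_norm, sub_zero] at this

lemma flow_gron {n : ℕ} {X : V n → V n} {Φ : ℝ → V n → V n} {K : ℝ≥0} (hX : LipschitzWith K X)
    (h0 : ∀ x, Φ 0 x = x) (hf : ∀ t x, HasDerivAt (fun s => Φ s x) (X (Φ t x)) t) (t : ℝ) (x y : V n) :
    ‖Φ t x - Φ t y‖ ≤ ‖x - y‖ * Real.exp (K * |t|) := by
  rcases le_total 0 t with h | h
  · rw [abs_of_nonneg h]; exact flow_gron_pos hX h0 hf h x y
  · rw [abs_of_nonpos h]
    have := flow_gron_pos (X := fun x => - X x) (Φ := fun s => Φ (-s)) (K := K) hX.neg (by simpa using h0)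
      (fun s x => by
        have := (hf (-s) x).scomp s (hasDerivAt_neg s)
        simpa [Function.comp_def] using this) (t := -t) (by linarith) x y
    simpa using this

lemma flow_inv {n : ℕ} {X : V n → V n} {Φ : ℝ → V n → V n} {K : ℝ≥0} (hX : LipschitzWith K X)
    (h0 : ∀ x, Φ 0 x = x) (hf : ∀ t x, HasDerivAt (fun s => Φ s x) (X (Φ t x)) t) (t : ℝ) (x : V n) :
    Φ (-t) (Φ t x) = x := by
  have h1 : ∀ s, HasDerivAt (fun s => Φ (s + t) x) (X (Φ (s + t) x)) s := fun s => by
    have := (hf (s+t) x).scomp s ((hasDerivAt_id s).add_const t)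
    simpa [Function.comp_def] using this
  have := ODE_solution_unique_univ (v := fun _ => X) (s := fun _ => Set.univ) (K := K) (t₀ := 0)
    (f := fun s => Φ s (Φ t x)) (g := fun s => Φ (s + t) x) (fun _ => hX.lipschitzOnWith)
    (fun s => ⟨hf s _, trivial⟩) (fun s => ⟨h1 s, trivial⟩) (by simp [h0])
  have := congrFun this (-t)
  simpa [h0] using this

lemma flow_data {n : ℕ} {X : V n → V n} {Φ : ℝ → V n → V n} (h : IsFlowOf X Φ) :
    ∃ M : ℝ, 0 < M ∧ ∀ t : ℝ, |t| ≤ 1 →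
      (∀ w, ‖Φ t w - w‖ ≤ M * |t|) ∧ (∀ w w', ‖(Φ t w - w) - (Φ t w' - w')‖ ≤ M * |t| * ‖w - w'‖) ∧
      (∀ w, ‖Φ t w - w - t • X w‖ ≤ M * t^2) ∧ (∀ w, Φ (-t) (Φ t w) = w) := by
  obtain ⟨K, hK⟩ := ContDiff.lipschitzWith_of_hasCompactSupport h.cptSupp h.smooth (by simp)
  obtain ⟨M0, hM0⟩ := h.cptSupp.exists_bound_of_continuous h.smooth.continuous
  have hM0' : 0 ≤ M0 := (norm_nonneg _).trans (hM0 0)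
  have hKL : ∀ x y, ‖X x - X y‖ ≤ K * ‖x - y‖ := fun x y => by
    have := hK.dist_le_mul x y; rwa [dist_eq_norm, dist_eq_norm] at this
  have hf := h.isFlow
  have h0 := h.init
  have key1 : ∀ t w, ‖Φ t w - w‖ ≤ M0 * |t| := by
    intro t w
    have := Convex.norm_image_sub_le_of_norm_hasDerivWithin_le (f := fun s => Φ s w) (s := Set.univ) (x := 0) (y := t) (C := M0)
      (fun s _ => (hf s w).hasDerivWithinAt) (fun s _ => hM0 _) convex_univ trivial trivial
    simpa [h0] using this
  refine ⟨M0 + K * Real.exp K + K * M0 + 1, by positivity, ?_⟩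
  intro t ht
  have hpt : 0 ≤ |t| := abs_nonneg t
  refine ⟨?_, ?_, ?_, fun w => flow_inv hK h0 hf t w⟩
  · intro w
    refine (key1 t w).trans ?_
    gcongr
    have : 0 ≤ K * Real.exp K + K * M0 := by positivity
    linarith
  · intro w w'
    have hseg : ∀ s ∈ Set.uIcc 0 t, |s| ≤ |t| := by
      intro s hs
      have := Set.abs_sub_left_of_mem_uIcc hs
      simpa using this
    have := Convex.norm_image_sub_le_of_norm_hasDerivWithin_le (f := fun s => Φ s w - Φ s w') (s := Set.uIcc 0 t) (x := 0) (y := t) (C := K * (‖w - w'‖ * Real.exp K))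
      (fun s _ => ((hf s w).sub (hf s w')).hasDerivWithinAt) (fun s hs => ?_) (convex_uIcc _ _) Set.left_mem_uIcc Set.right_mem_uIcc
    · simp only [h0, sub_zero, Real.norm_eq_abs] at this
      rw [show (Φ t w - w) - (Φ t w' - w') = Φ t w - Φ t w' - (w - w') by abel]
      refine this.trans ?_
      have h3 : (K:ℝ) * Real.exp K ≤ M0 + K * Real.exp K + K * M0 + 1 := by
        have : 0 ≤ M0 + K * M0 := by positivity
        linarith
      calc K * (‖w - w'‖ * Real.exp K) * |t| = (K * Real.exp K) * |t| * ‖w - w'‖ := by ring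
        _ ≤ _ := by gcongr
    · refine (hKL _ _).trans ?_
      gcongr
      refine (flow_gron hK h0 hf s w w').trans ?_
      gcongr
      have : |s| ≤ 1 := (hseg s hs).trans ht
      nlinarith [K.2]
  · intro w
    have hseg : ∀ s ∈ Set.uIcc 0 t, |s| ≤ |t| := by
      intro s hs
      have := Set.abs_sub_left_of_mem_uIcc hs
      simpa using this
    have := Convex.norm_image_sub_le_of_norm_hasDerivWithin_le (f := fun s => Φ s w - s • X w) (s := Set.uIcc 0 t) (x := 0) (y := t) (C := K * (M0 * |t|))
      (fun s _ => ((hf s w).sub ((hasDerivAt_id s).smul_const (X w))).hasDerivWithinAt) (fun s hs => ?_) (convex_uIcc _ _) Set.left_mem_uIcc Set.right_mem_uIcc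
    · simp only [h0, sub_zero, Real.norm_eq_abs, zero_smul] at this
      rw [show Φ t w - w - t • X w = Φ t w - t • X w - w by abel]
      refine this.trans ?_
      have h3 : (K:ℝ) * M0 ≤ M0 + K * Real.exp K + K * M0 + 1 := by
        have : 0 ≤ M0 + K * Real.exp K := by positivity
        linarith
      calc K * (M0 * |t|) * |t| = (K * M0) * t^2 := by rw [← sq_abs t]; ring
        _ ≤ _ := by gcongr
    · rw [one_smul]
      refine (hKL _ _).trans ?_
      gcongr
      refine (key1 s w).trans ?_
      exact mul_le_mul_of_nonneg_left (hseg s hs) hM0'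

lemma flow_nb {n : ℕ} {X : V n → V n} {Φ : ℝ → V n → V n} (h : IsFlowOf X Φ) :
    ∃ M : ℝ, 0 < M ∧ ∀ t : ℝ, |t| ≤ 1 → 
      (M * |t| ≤ 1/100 → ∃ R, NB (40 * M + 7 * M^2 + M) t (fun x => inner ℝ (X x) x) (Φ t '' ball 0 1) R) ∧
      LipschitzWith (Real.toNNReal (1 + M * |t|)) (Φ t) ∧ LipschitzWith (Real.toNNReal (1 + M * |t|)) (Φ (-t)) ∧
      (∀ w, Φ (-t) (Φ t w) = w) ∧ (∀ w, Φ t (Φ (-t) w) = w) := by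
  obtain ⟨M, hM, hh⟩ := flow_data h
  have hlip : ∀ t, |t| ≤ 1 → LipschitzWith (Real.toNNReal (1 + M * |t|)) (Φ t) := by
    intro t ht
    apply LipschitzWith.of_dist_le_mul
    intro w w'
    rw [Real.coe_toNNReal _ (by positivity), dist_eq_norm, dist_eq_norm]
    have h2 := (hh t ht).2.1 w w'
    calc ‖Φ t w - Φ t w'‖ = ‖((Φ t w - w) - (Φ t w' - w')) + (w - w')‖ := by congr 1; abel
      _ ≤ M * |t| * ‖w - w'‖ + ‖w - w'‖ := (norm_add_le _ _).trans (by linarith)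
      _ = _ := by ring
  refine ⟨M, hM, fun t ht => ?_⟩
  have ht' : |-t| ≤ 1 := by rwa [abs_neg]
  have i1 : ∀ w, Φ (-t) (Φ t w) = w := (hh t ht).2.2.2
  have i2 : ∀ w, Φ t (Φ (-t) w) = w := by simpa using (hh (-t) ht').2.2.2
  refine ⟨fun hMt => ?_, hlip t ht, by simpa using hlip (-t) ht', i1, i2⟩
  have hE : Φ t '' ball 0 1 = {w | ‖w + (Φ (-t) w - w)‖ < 1} := by
    ext w; constructor
    · rintro ⟨x, hx, rfl⟩
      simpa [i1] using hx
    · intro hw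
      exact ⟨Φ (-t) w, by simpa using hw, i2 w⟩
  rw [hE]
  obtain ⟨a1, a2, a3, _⟩ := hh (-t) ht'
  rw [abs_neg] at a1 a2
  exact nb_of_map (X := X) hM.le hMt a1 a2 (by simpa using a3)

/-- translations -/
lemma trans_nb {n : ℕ} (e : V n) (he : ‖e‖ ≤ 1) (t : ℝ) (ht : |t| ≤ 1/100) :
    ∃ R, NB 48 t (fun x => inner ℝ e x) {w | ‖w - t • e‖ < 1} R := by
  have := nb_of_map (n := n) (M := 1) (t := t) (D := fun _ => - (t • e)) (X := fun _ => e) (by norm_num) (by simpa using ht)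
    (fun w => by rw [norm_neg, norm_smul, Real.norm_eq_abs, mul_comm]; gcongr) (fun w w' => by simp; positivity) (fun w => by simp; positivity)
  simp only [← sub_eq_add_neg] at this
  norm_num at this
  exact this

def LL {n : ℕ} (E : Set (V n)) (F : V n → ℝ) : ℝ := (∫ w in E, F w) - ∫ w in ball 0 1, F w

lemma vnorm_decomp {n : ℕ} {w : V n} (hw : w ≠ 0) : ∃ x : V n, ‖x‖ = 1 ∧ w = ‖w‖ • x := by
  have h : ‖w‖ ≠ 0 := norm_ne_zero_iff.2 hw
  refine ⟨‖w‖⁻¹ • w, ?_, ?_⟩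
  · rw [norm_smul, norm_inv, norm_norm, inv_mul_cancel₀ h]
  · rw [smul_smul, mul_inv_cancel₀ h, one_smul]

lemma nb_mem {n : ℕ} {C t : ℝ} {u : V n → ℝ} {E R} (h : NB C t u E R) {w : V n} (hw : w ≠ 0) :
    w ∈ E ↔ ‖w‖ < R (‖w‖⁻¹ • w) := by
  have h0 : ‖w‖ ≠ 0 := norm_ne_zero_iff.2 hw
  have h1 : ‖‖w‖⁻¹ • w‖ = 1 := by rw [norm_smul, norm_inv, norm_norm, inv_mul_cancel₀ h0]
  have := h.ray _ h1 ‖w‖ (norm_pos_iff.2 hw)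
  rwa [smul_smul, mul_inv_cancel₀ h0, one_smul] at this

lemma nb_sub {n : ℕ} {C t : ℝ} {u : V n → ℝ} {E R} (h : NB C t u E R) {w : V n} (hw : w ∈ E) :
    ‖w‖ ≤ 1 + C * |t| ∨ w = 0 := by
  by_cases h0 : w = 0
  · exact Or.inr h0
  left
  have h1 := (nb_mem h h0).1 hw
  have h2 : ‖‖w‖⁻¹ • w‖ = 1 := by rw [norm_smul, norm_inv, norm_norm, inv_mul_cancel₀ (norm_ne_zero_iff.2 h0)]
  have := (abs_le.1 (h.near _ h2)).2
  linarith

lemma nb_sub' {n : ℕ} {C t : ℝ} {u : V n → ℝ} {E R} (h : NB C t u E R) (hC : C * |t| ≤ 1/8) :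
    E ⊆ closedBall 0 (9/8) := by
  intro w hw
  rw [mem_closedBall_zero_iff]
  rcases nb_sub h hw with h1 | h1
  · linarith
  · rw [h1, norm_zero]; norm_num

lemma nb_ball (n : ℕ) : NB 0 0 (fun _ => 0) (ball (0 : V n) 1) (fun _ => 1) where
  meas := measurableSet_ball
  cont := continuous_const
  ray := by
    intro x hx ρ hρ
    rw [mem_ball_zero_iff, norm_smul, hx, mul_one, Real.norm_of_nonneg hρ.le]
  near := by intro x hx; simp
  lip := by intro x y hx hy; simp
  exp := by intro x hx; simp

lemma nb_int {n : ℕ} (hn : 0 < n) {C t : ℝ} {u : V n → ℝ} {E R} (h : NB C t u E R) (hC : C * |t| ≤ 1/8)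
    {F : V n → ℝ} (hF : Continuous F) :
    ∫ w in E, F w = ∫ x, (∫ ρ in (0:ℝ)..R x, ρ^(n-1) * F (ρ • x)) ∂(sph n) := by
  have hi : Integrable (E.indicator F) := by
    rw [integrable_indicator_iff h.meas]
    exact (hF.continuousOn.integrableOn_compact (isCompact_closedBall 0 (9/8))).mono_set (nb_sub' h hC)
  rw [← integral_indicator h.meas, int_polar' hn _ hi]
  apply sph_congr
  intro x hx
  have hR := (abs_le.1 (h.near x hx)).1
  have hR0 : 0 ≤ R x := by linarith
  rw [intervalIntegral.integral_of_le hR0, ← integral_indicator measurableSet_Ioi, ← integral_indicator measurableSet_Ioc]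
  apply integral_congr_ae
  have : ∀ᵐ ρ : ℝ, ρ ≠ R x := by simp [ae_iff, measure_singleton]
  filter_upwards [this] with ρ hρ
  by_cases h1 : 0 < ρ
  · by_cases h2 : ρ < R x
    · have : ρ • x ∈ E := (h.ray x hx ρ h1).2 h2
      have h3 : ρ ∈ Set.Ioc 0 (R x) := ⟨h1, h2.le⟩
      rw [Set.indicator_of_mem (by exact h1), Set.indicator_of_mem h3, Set.indicator_of_mem this]
    · have : ρ • x ∉ E := fun hh => h2 ((h.ray x hx ρ h1).1 hh)
      have h3 : ρ ∉ Set.Ioc 0 (R x) := fun hh => h2 (lt_of_le_of_ne hh.2 hρ)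
      rw [Set.indicator_of_mem (by exact h1), Set.indicator_of_notMem h3, Set.indicator_of_notMem this, mul_zero]
  · rw [Set.indicator_of_notMem (by exact h1), Set.indicator_of_notMem (fun hh => h1 hh.1)]

lemma nb_L_cont {n : ℕ} {R : V n → ℝ} (hR : Continuous R) {F : V n → ℝ} (hF : Continuous F) (a : ℝ) :
    Continuous (fun x : V n => ∫ ρ in a..R x, ρ^(n-1) * F (ρ • x)) := by
  apply intervalIntegral.continuous_parametric_intervalIntegral_of_continuous (f := fun (x : V n) (ρ:ℝ) => ρ^(n-1) * F (ρ • x)) _ hR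
  unfold Function.uncurry
  fun_prop

lemma nb_L {n : ℕ} (hn : 0 < n) {C t : ℝ} {u : V n → ℝ} {E R} (h : NB C t u E R) (hC : C * |t| ≤ 1/8)
    {F : V n → ℝ} (hF : Continuous F) :
    LL E F = ∫ x, (∫ ρ in (1:ℝ)..R x, ρ^(n-1) * F (ρ • x)) ∂(sph n) := by
  rw [LL, nb_int hn h hC hF, nb_int hn (nb_ball n) (by norm_num) hF, ← integral_sub]
  · apply sph_congr
    intro x hx
    rw [intervalIntegral.integral_interval_sub_left]
    · exact Continuous.intervalIntegrable (by fun_prop) _ _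
    · exact Continuous.intervalIntegrable (by fun_prop) _ _
  · exact sph_integrable (nb_L_cont h.cont hF 0).continuousOn
  · exact sph_integrable (nb_L_cont continuous_const hF 0).continuousOn

lemma pow_near (m : ℕ) : ∃ c : ℝ, 1 ≤ c ∧ ∀ ρ : ℝ, |ρ - 1| ≤ 1/8 → |ρ^m - 1| ≤ c * |ρ - 1| ∧ |ρ^m| ≤ c := by
  induction m with
  | zero => exact ⟨1, le_rfl, fun ρ h => by simp⟩
  | succ m ih =>
    obtain ⟨c, hc, h⟩ := ih
    refine ⟨2 * c + 1, by linarith, fun ρ hρ => ?_⟩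
    obtain ⟨h1, h2⟩ := h ρ hρ
    have h3 : |ρ| ≤ 2 := by
      have := abs_le.1 hρ
      rw [abs_le]; constructor <;> linarith
    constructor
    · have : ρ^(m+1) - 1 = ρ * (ρ^m - 1) + (ρ - 1) := by ring
      rw [this]
      refine (abs_add_le _ _).trans ?_
      rw [abs_mul]
      have := mul_le_mul h3 h1 (abs_nonneg _) (by norm_num)
      linarith
    · rw [pow_succ, abs_mul]
      have := mul_le_mul h2 h3 (abs_nonneg _) (by linarith)
      linarith

/-- first-order expansion -/
lemma L1 {n : ℕ} (hn : 0 < n) (C : ℝ) (hC0 : 0 ≤ C) : ∃ C' : ℝ, 0 < C' ∧ ∀ (t : ℝ) (u : V n → ℝ) (E : Set (V n)) (R : V n → ℝ),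
    NB C t u E R → C * |t| ≤ 1/8 → ContinuousOn u (sphere 0 1) → ∀ (K : ℝ) (F : V n → ℝ), Continuous F → 0 ≤ K →
    (∀ x, ‖x‖ = 1 → |F x| ≤ K) →
    (∀ x, ‖x‖ = 1 → ∀ ρ : ℝ, |ρ - 1| ≤ 1/8 → |F (ρ • x) - F x| ≤ K * |ρ - 1|) →
    |LL E F - t * ∫ x, F x * u x ∂(sph n)| ≤ C' * K * t^2 := by
  obtain ⟨c, hc, hp⟩ := pow_near (n-1)
  have hN := NN_pos hn
  refine ⟨(2 * c * C^2 + C + 1) * NN n, by positivity, ?_⟩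
  intro t u E R h hCt hu K F hF hK hK1 hK2
  rw [nb_L hn h hCt hF, ← integral_const_mul, ← integral_sub (sph_integrable (nb_L_cont h.cont hF 1).continuousOn)
    ((sph_integrable (F := fun x => F x * u x) (hF.continuousOn.mul hu)).const_mul _)]
  have : (2 * c * C^2 + C + 1) * NN n * K * t^2 = ((2 * c * C^2 + C + 1) * K * t^2) * NN n := by ring
  rw [this]
  apply sph_abs_le
  intro x hx
  have hR := h.near x hx
  have e1 : (∫ ρ in (1:ℝ)..R x, ρ^(n-1) * F (ρ • x)) - t * (F x * u x) =
     (∫ ρ in (1:ℝ)..R x, (ρ^(n-1) * F (ρ • x) - F x)) + (R x - 1 - t * u x) * F x := by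
    rw [intervalIntegral.integral_sub]
    · rw [intervalIntegral.integral_const, smul_eq_mul]; ring
    · exact Continuous.intervalIntegrable (by fun_prop) _ _
    · exact Continuous.intervalIntegrable (by fun_prop) _ _
  have e2 : |∫ ρ in (1:ℝ)..R x, (ρ^(n-1) * F (ρ • x) - F x)| ≤ (2 * c * K * (C * |t|)) * |R x - 1| := by
    rw [← Real.norm_eq_abs]
    apply intervalIntegral.norm_integral_le_of_norm_le_const
    intro ρ hρ
    have h1 : |ρ - 1| ≤ C * |t| := by
      refine le_trans ?_ hR
      have := Set.abs_sub_left_of_mem_uIcc (Set.uIoc_subset_uIcc hρ)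
      exact this
    obtain ⟨p1, p2⟩ := hp ρ (h1.trans hCt)
    have q1 := hK2 x hx ρ (h1.trans hCt)
    have q2 := hK1 x hx
    rw [Real.norm_eq_abs, show ρ^(n-1) * F (ρ • x) - F x = ρ^(n-1) * (F (ρ • x) - F x) + (ρ^(n-1) - 1) * F x by ring]
    refine (abs_add_le _ _).trans ?_
    rw [abs_mul, abs_mul]
    have r1 := mul_le_mul p2 q1 (abs_nonneg _) (by linarith)
    have r2 := mul_le_mul p1 q2 (abs_nonneg _) (by positivity)
    have r3 := mul_le_mul_of_nonneg_left h1 (by positivity : 0 ≤ 2 * c * K)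
    linarith
  rw [e1]
  refine (abs_add_le _ _).trans ?_
  rw [abs_mul (R x - 1 - t * u x)]
  have e3 := mul_le_mul (h.exp x hx) (hK1 x hx) (abs_nonneg _) (by positivity)
  have e4 := mul_le_mul_of_nonneg_left hR (by positivity : 0 ≤ 2 * c * K * (C * |t|))
  have e5 : 2 * c * K * (C * |t|) * (C * |t|) = 2 * c * C^2 * K * t^2 := by rw [← sq_abs t]; ring
  have : 0 ≤ K * t^2 := by positivity
  linarith

/-- second-order expansion for functions that are constant on the sphere -/
lemma L2 {n : ℕ} (hn : 0 < n) (C : ℝ) (hC0 : 0 ≤ C) : ∃ C' : ℝ, 0 < C' ∧ ∀ (t : ℝ) (u : V n → ℝ) (E : Set (V n)) (R : V n → ℝ),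
    NB C t u E R → C * |t| ≤ 1/8 → |t| ≤ 1 → ContinuousOn u (sphere 0 1) → volume E = volume (ball (0 : V n) 1) →
    ∀ (K κ c : ℝ) (F : V n → ℝ), Continuous F → 0 ≤ K → |κ| ≤ K →
    (∀ x, ‖x‖ = 1 → ∀ ρ : ℝ, |ρ - 1| ≤ 1/8 → |F (ρ • x) - c - κ * (ρ - 1)| ≤ K * (ρ - 1)^2) →
    |LL E F - t^2 * (κ / 2) * ∫ x, u x^2 ∂(sph n)| ≤ C' * K * |t|^3 := by
  obtain ⟨c1, hc1, hp⟩ := pow_near (n-1)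
  have hN := NN_pos hn
  refine ⟨(2 * c1 * C^3 + 3 * C^2 + 1) * NN n, by positivity, ?_⟩
  intro t u E R h hCt ht hu hvol K κ c F hF hK hκ hexp
  have hLc : LL E F = LL E (fun w => F w - c) := by
    unfold LL
    have hb : volume E < ⊤ := by rw [hvol]; exact measure_ball_lt_top
    rw [integral_sub, integral_sub]
    · simp only [integral_const, MeasurableSet.univ, measureReal_restrict_apply, Set.univ_inter]
      simp only [measureReal_def, hvol]
      ring
    · exact (hF.continuousOn.integrableOn_compact (isCompact_closedBall 0 1)).mono_set ball_subset_closedBall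
    · simp [integrable_const_iff, isFiniteMeasure_restrict, measure_ball_lt_top.ne]
    · exact (hF.continuousOn.integrableOn_compact (isCompact_closedBall 0 (9/8))).mono_set (nb_sub' h hCt)
    · simp [integrable_const_iff, isFiniteMeasure_restrict, hb.ne]
  have hF' : Continuous (fun w => F w - c) := by fun_prop
  rw [hLc, nb_L hn h hCt hF', ← integral_const_mul, ← integral_sub (sph_integrable (nb_L_cont h.cont hF' 1).continuousOn)
    ((sph_integrable (F := fun x => u x^2) (hu.pow 2)).const_mul _)]
  have : (2 * c1 * C^3 + 3 * C^2 + 1) * NN n * K * |t|^3 = ((2 * c1 * C^3 + 3 * C^2 + 1) * K * |t|^3) * NN n := by ring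
  rw [this]
  apply sph_abs_le
  intro x hx
  have hR := h.near x hx
  have hi : ∫ ρ in (1:ℝ)..R x, κ * (ρ - 1) = κ / 2 * (R x - 1)^2 := by
    rw [intervalIntegral.integral_const_mul, intervalIntegral.integral_sub (by simp) (by simp), integral_id, intervalIntegral.integral_const, smul_eq_mul]
    ring
  have e1 : (∫ ρ in (1:ℝ)..R x, ρ^(n-1) * (F (ρ • x) - c)) - t^2 * (κ/2) * u x ^2 =
     (∫ ρ in (1:ℝ)..R x, (ρ^(n-1) * (F (ρ • x) - c) - κ * (ρ - 1))) + κ / 2 * ((R x - 1 - t * u x) * (R x - 1 + t * u x)) := by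
    rw [intervalIntegral.integral_sub, hi]
    · ring
    · exact Continuous.intervalIntegrable (by fun_prop) _ _
    · exact Continuous.intervalIntegrable (by fun_prop) _ _
  have e2 : |∫ ρ in (1:ℝ)..R x, (ρ^(n-1) * (F (ρ • x) - c) - κ * (ρ - 1))| ≤ (2 * c1 * K * (C * |t|)^2) * |R x - 1| := by
    rw [← Real.norm_eq_abs]
    apply intervalIntegral.norm_integral_le_of_norm_le_const
    intro ρ hρ
    have h1 : |ρ - 1| ≤ C * |t| := by
      refine le_trans ?_ hR
      have := Set.abs_sub_left_of_mem_uIcc (Set.uIoc_subset_uIcc hρ)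
      exact this
    obtain ⟨p1, p2⟩ := hp ρ (h1.trans hCt)
    have q1 := hexp x hx ρ (h1.trans hCt)
    rw [Real.norm_eq_abs, show ρ^(n-1) * (F (ρ • x) - c) - κ * (ρ - 1) = ρ^(n-1) * (F (ρ • x) - c - κ * (ρ - 1)) + (ρ^(n-1) - 1) * (κ * (ρ - 1)) by ring]
    refine (abs_add_le _ _).trans ?_
    rw [abs_mul, abs_mul, abs_mul κ]
    have r1 := mul_le_mul p2 q1 (abs_nonneg _) (by linarith)
    have r2 := mul_le_mul p1 (mul_le_mul_of_nonneg_right hκ (abs_nonneg (ρ - 1))) (by positivity) (by positivity)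
    have r4 : |ρ - 1|^2 ≤ (C * |t|)^2 := pow_le_pow_left₀ (abs_nonneg _) h1 2
    have r3 := mul_le_mul_of_nonneg_left r4 (by positivity : 0 ≤ 2 * c1 * K)
    have r5 : (ρ - 1)^2 = |ρ - 1|^2 := (sq_abs _).symm
    rw [r5] at r1
    linarith
  rw [e1]
  refine (abs_add_le _ _).trans ?_
  rw [abs_mul (κ/2), abs_mul (R x - 1 - t * u x)]
  have e3 := h.exp x hx
  have htt : t^2 ≤ |t| := by rw [← sq_abs]; nlinarith [abs_nonneg t]
  have e3' : |R x - 1 + t * u x| ≤ 3 * C * |t| := by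
    have a1 : R x - 1 + t * u x = 2 * (R x - 1) - (R x - 1 - t * u x) := by ring
    rw [a1]
    refine (abs_sub _ _).trans ?_
    rw [abs_mul, abs_two]
    have := mul_le_mul_of_nonneg_left htt hC0
    linarith
  have e6 := mul_le_mul e3 e3' (abs_nonneg _) (by positivity)
  have hκ2 : |κ/2| ≤ K := by rw [abs_div, abs_two]; linarith [abs_nonneg κ]
  have e7 := mul_le_mul hκ2 e6 (by positivity) hK
  have e4 := mul_le_mul_of_nonneg_left hR (by positivity : 0 ≤ 2 * c1 * K * (C * |t|)^2)
  have e5 : 2 * c1 * K * (C * |t|)^2 * (C * |t|) = 2 * c1 * C^3 * K * |t|^3 := by ring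
  have e8 : K * (C * t^2 * (3 * C * |t|)) = 3 * C^2 * K * |t|^3 := by rw [← sq_abs t]; ring
  have : 0 ≤ K * |t|^3 := by positivity
  linarith


lemma vdiv_smul {n : ℕ} {f : V n → ℝ} {φ : V n → V n} {w : V n} (hf : DifferentiableAt ℝ f w) (hφ : DifferentiableAt ℝ φ w) :
    vdiv (fun w => f w • φ w) w = fderiv ℝ f w (φ w) + f w * vdiv φ w := by
  unfold vdiv
  rw [fderiv_fun_smul hf hφ]
  simp only [_root_.add_apply, _root_.smul_apply, ContinuousLinearMap.smulRight_apply, PiLp.add_apply, PiLp.smul_apply, smul_eq_mul]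
  rw [Finset.sum_add_distrib, ← Finset.mul_sum, add_comm]
  congr 1
  have : φ w = ∑ i, φ w i • EuclideanSpace.single i (1:ℝ) := by
    ext j
    simp [Finset.sum_apply, Pi.single_apply]
  conv_rhs => rw [this, map_sum]
  refine Finset.sum_congr rfl fun i _ => ?_
  rw [map_smul, smul_eq_mul, mul_comm]

lemma vdiv_id {n : ℕ} (w : V n) : vdiv (fun w : V n => w) w = n := by
  unfold vdiv
  simp [fderiv_fun_id]

lemma vdiv_add {n : ℕ} {φ ψ : V n → V n} {w : V n} (hφ : DifferentiableAt ℝ φ w) (hψ : DifferentiableAt ℝ ψ w) :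
    vdiv (fun w => φ w + ψ w) w = vdiv φ w + vdiv ψ w := by
  unfold vdiv
  rw [fderiv_fun_add hφ hψ, ← Finset.sum_add_distrib]
  simp

lemma vdiv_const_smul {n : ℕ} {φ : V n → V n} {w : V n} (c : ℝ) (hφ : DifferentiableAt ℝ φ w) :
    vdiv (fun w => c • φ w) w = c * vdiv φ w := by
  unfold vdiv
  rw [fderiv_fun_const_smul hφ, Finset.mul_sum]
  simp

lemma vdiv_congr {n : ℕ} {φ ψ : V n → V n} {w : V n} (h : φ =ᶠ[𝓝 w] ψ) : vdiv φ w = vdiv ψ w := by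
  unfold vdiv
  rw [h.fderiv_eq]

lemma vdiv_nu {n : ℕ} {w : V n} (hw : w ≠ 0) : vdiv (fun w : V n => ‖w‖⁻¹ • w) w = (n - 1) * ‖w‖⁻¹ := by
  have h0 : ‖w‖ ≠ 0 := norm_ne_zero_iff.2 hw
  have h1' : HasFDerivAt (fun w : V n => ‖w‖⁻¹) (-(‖w‖^2)⁻¹ • (‖w‖⁻¹ • innerSL ℝ w)) w :=
    (hasDerivAt_inv h0).comp_hasFDerivAt w (hasFDerivAt_vnorm hw)
  rw [vdiv_smul h1'.differentiableAt differentiableAt_fun_id, vdiv_id, h1'.fderiv]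
  simp only [_root_.smul_apply, innerSL_apply_apply, real_inner_self_eq_norm_sq, smul_eq_mul]
  field_simp
  ring

/-- cut-offs -/
lemma cutoffs (n : ℕ) : ∃ χ : V n → ℝ, ∃ ν : V n → V n, ContDiff ℝ (⊤:ℕ∞) χ ∧ HasCompactSupport χ ∧ ContDiff ℝ (⊤:ℕ∞) ν ∧
    (∀ w, 0 ≤ χ w) ∧ (∀ w, χ w ≤ 1) ∧ (∀ w, ‖ν w‖ ≤ 1) ∧ (∀ w : V n, 1/2 ≤ ‖w‖ → ‖w‖ ≤ 3/2 → χ w = 1) ∧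
    (∀ w : V n, 1/2 ≤ ‖w‖ → ν w = ‖w‖⁻¹ • w) ∧ (∀ w, ∃ c : ℝ, ν w = c • w) := by
  let f1 : ContDiffBump (0 : V n) := ⟨3/2, 2, by norm_num, by norm_num⟩
  let f2 : ContDiffBump (0 : V n) := ⟨1/4, 1/2, by norm_num, by norm_num⟩
  have pos : ∀ w : V n, 0 < ‖w‖^2 + f2 w := by
    intro w
    by_cases h : w = 0
    · have : f2 w = 1 := f2.one_of_mem_closedBall (by rw [h]; simp; norm_num [f2])
      rw [this]; positivity
    · have := f2.nonneg (x := w)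
      have h2 : 0 < ‖w‖ := norm_pos_iff.2 h
      positivity
  refine ⟨f1, fun w => (√(‖w‖^2 + f2 w))⁻¹ • w, f1.contDiff, f1.hasCompactSupport, ?_, fun w => f1.nonneg, fun w => f1.le_one, ?_, ?_, ?_, ?_⟩
  · have h : ContDiff ℝ (⊤:ℕ∞) (fun w : V n => ‖w‖^2 + f2 w) := (contDiff_norm_sq ℝ).add f2.contDiff
    have h2 : ContDiff ℝ (⊤:ℕ∞) (fun w : V n => √(‖w‖^2 + f2 w)) := h.sqrt fun w => (pos w).ne'
    have h3 : ContDiff ℝ (⊤:ℕ∞) (fun w : V n => (√(‖w‖^2 + f2 w))⁻¹) := h2.inv (fun w => (Real.sqrt_pos.2 (pos w)).ne')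
    exact h3.smul contDiff_id
  · intro w
    rw [norm_smul, norm_inv, Real.norm_of_nonneg (Real.sqrt_nonneg _), inv_mul_le_one₀ (Real.sqrt_pos.2 (pos w))]
    apply Real.le_sqrt_of_sq_le
    linarith [f2.nonneg (x := w)]
  · intro w h1 h2
    exact f1.one_of_mem_closedBall (by rw [mem_closedBall_zero_iff]; exact h2)
  · intro w h1
    have : f2 w = 0 := f2.zero_of_le_dist (by rw [dist_zero_right]; exact h1)
    simp only [this, add_zero, Real.sqrt_sq (norm_nonneg _)]
  · intro w; exact ⟨_, rfl⟩

lemma lip_ray {n : ℕ} {F : V n → ℝ} (hF : ContDiff ℝ 1 F) (hc : HasCompactSupport F) :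
    ∃ K : ℝ, 0 ≤ K ∧ (∀ w, |F w| ≤ K) ∧ ∀ x : V n, ‖x‖ = 1 → ∀ ρ : ℝ, |F (ρ • x) - F x| ≤ K * |ρ - 1| := by
  obtain ⟨K, hK⟩ := hF.lipschitzWith_of_hasCompactSupport hc (by simp)
  obtain ⟨B, hB⟩ := hc.exists_bound_of_continuous hF.continuous
  refine ⟨max K B, le_max_of_le_left K.2, fun w => (hB w).trans (le_max_right _ _), ?_⟩
  intro x hx ρ
  have := hK.dist_le_mul (ρ • x) x
  rw [Real.dist_eq, dist_eq_norm, show ρ • x - x = (ρ - 1) • x by rw [sub_smul, one_smul], norm_smul, hx, mul_one, Real.norm_eq_abs] at this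
  exact this.trans (mul_le_mul_of_nonneg_right (le_max_left _ _) (abs_nonneg _))

def gr {n : ℕ} (U : V n → ℝ) (w : V n) : V n := (InnerProductSpace.toDual ℝ (V n)).symm (fderiv ℝ U w)

lemma gr_inner {n : ℕ} (U : V n → ℝ) (w v : V n) : inner ℝ (gr U w) v = fderiv ℝ U w v := by
  unfold gr; rw [InnerProductSpace.toDual_symm_apply]

lemma gr_smooth {n : ℕ} {U : V n → ℝ} (hU : ContDiff ℝ (⊤:ℕ∞) U) : ContDiff ℝ (⊤:ℕ∞) (gr U) := by
  unfold gr
  exact (InnerProductSpace.toDual ℝ (V n)).symm.contDiff.comp (hU.fderiv_right (by exact le_rfl))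

def tg {n : ℕ} (U : V n → ℝ) (w : V n) : V n := ‖w‖^2 • gr U w - (inner ℝ w (gr U w) : ℝ) • w

lemma tg_smooth {n : ℕ} {U : V n → ℝ} (hU : ContDiff ℝ (⊤:ℕ∞) U) : ContDiff ℝ (⊤:ℕ∞) (tg U) := by
  unfold tg
  have := gr_smooth hU
  exact ((contDiff_norm_sq ℝ).smul this).sub ((contDiff_id.inner ℝ this).smul contDiff_id)

lemma tg_perp {n : ℕ} (U : V n → ℝ) (w : V n) : inner ℝ w (tg U w) = (0:ℝ) := by
  unfold tg
  rw [inner_sub_right, real_inner_smul_right, real_inner_smul_right, real_inner_self_eq_norm_sq]; ring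

lemma tg_grad {n : ℕ} (U : V n → ℝ) {w : V n} (hw : ‖w‖ = 1) : fderiv ℝ U w (tg U w) = ‖tg U w‖^2 := by
  rw [← gr_inner, ← real_inner_self_eq_norm_sq]
  have : inner ℝ (tg U w) (tg U w) = inner ℝ (gr U w) (tg U w) - inner ℝ w (gr U w) * inner ℝ w (tg U w) := by
    conv_lhs => enter [2]; rw [tg]
    rw [hw, inner_sub_left, real_inner_smul_left, one_pow, one_mul, real_inner_smul_left]
  rw [this, tg_perp]; ring

lemma vdiv_C1 {n : ℕ} {φ : V n → V n} (h : ContDiff ℝ (⊤:ℕ∞) φ) : ContDiff ℝ 1 (vdiv φ) := by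
  unfold vdiv
  have h2 : ContDiff ℝ 1 (fderiv ℝ φ) := h.fderiv_right (by norm_cast)
  refine ContDiff.sum fun i _ => ?_
  have := h2.clm_apply (contDiff_const (c := EuclideanSpace.single i (1:ℝ)))
  fun_prop


lemma per_ge {n : ℕ} {E : Set (V n)} (hE : perimeter E ≠ ⊤) {φ : V n → V n} (h1 : ContDiff ℝ 1 φ) (h2 : HasCompactSupport φ)
    (h3 : ∀ x, ‖φ x‖ ≤ 1) : ∫ x in E, vdiv φ x ≤ P E := by
  have h : ENNReal.ofReal (∫ x in E, vdiv φ x) ≤ perimeter E := by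
    unfold perimeter
    exact le_iSup (fun φ : {φ : V n → V n // ContDiff ℝ 1 φ ∧ HasCompactSupport φ ∧ ∀ x, ‖φ x‖ ≤ 1} =>
      ENNReal.ofReal (∫ x in E, vdiv φ.1 x)) ⟨φ, h1, h2, h3⟩
  have := ENNReal.toReal_mono hE h
  rw [ENNReal.toReal_ofReal'] at this
  exact (le_max_left _ _).trans this

lemma cs_smul {n : ℕ} (f : V n → ℝ) (φ : V n → V n) (h : HasCompactSupport φ) : HasCompactSupport (fun w => f w • φ w) := by
  refine h.mono ?_
  intro w hw hw2
  apply hw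
  have : φ w = 0 := hw2
  simp only [this, smul_zero]

lemma cs_comb {n : ℕ} (a b c : ℝ) (f g h : V n → V n) (hf : HasCompactSupport f) (hg : HasCompactSupport g) (hh : HasCompactSupport h) :
    HasCompactSupport (fun w => a • f w + (b • g w + c • h w)) :=
  (cs_smul (fun _ => a) f hf).add ((cs_smul (fun _ => b) g hg).add (cs_smul (fun _ => c) h hh))

lemma cd_comb {n : ℕ} (a b c : ℝ) (f g h : V n → V n) (hf : ContDiff ℝ 1 f) (hg : ContDiff ℝ 1 g) (hh : ContDiff ℝ 1 h) :
    ContDiff ℝ 1 (fun w => a • f w + (b • g w + c • h w)) :=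
  (hf.const_smul a).add ((hg.const_smul b).add (hh.const_smul c))

lemma vdiv_comb {n : ℕ} (a b c : ℝ) (f g h : V n → V n) (hf : Differentiable ℝ f) (hg : Differentiable ℝ g) (hh : Differentiable ℝ h) (w : V n) :
    vdiv (fun w => a • f w + (b • g w + c • h w)) w = a * vdiv f w + (b * vdiv g w + c * vdiv h w) := by
  have h1 : DifferentiableAt ℝ (fun w => a • f w) w := (hf w).const_smul a
  have h2 : DifferentiableAt ℝ (fun w => b • g w) w := (hg w).const_smul b
  have h3 : DifferentiableAt ℝ (fun w => c • h w) w := (hh w).const_smul c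
  have h4 : DifferentiableAt ℝ (fun w => b • g w + c • h w) w := h2.add h3
  rw [vdiv_add h1 h4, vdiv_add h2 h3, vdiv_const_smul _ (hf w), vdiv_const_smul _ (hg w), vdiv_const_smul _ (hh w)]

lemma int_comb {n : ℕ} {μ : Measure (V n)} (a b c : ℝ) (f g h : V n → ℝ) (hf : Integrable f μ) (hg : Integrable g μ) (hh : Integrable h μ) :
    ∫ w, (a * f w + (b * g w + c * h w)) ∂μ = a * ∫ w, f w ∂μ + (b * ∫ w, g w ∂μ + c * ∫ w, h w ∂μ) := by
  have h1 : Integrable (fun w => a * f w) μ := hf.const_mul a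
  have h2 : Integrable (fun w => b * g w) μ := hg.const_mul b
  have h3 : Integrable (fun w => c * h w) μ := hh.const_mul c
  have h4 : Integrable (fun w => b * g w + c * h w) μ := h2.add h3
  rw [integral_add h1 h4, integral_add h2 h3, integral_const_mul, integral_const_mul, integral_const_mul]

lemma phi_norm {n : ℕ} {χ a t s m : ℝ} {w ν Y : V n} (hχ0 : 0 ≤ χ) (hχ1 : χ ≤ 1) (hν : ‖ν‖ ≤ 1) (hc : ∃ c : ℝ, ν = c • w)
    (hp : inner ℝ w Y = (0:ℝ)) (hs : s = t^2 * ‖Y‖^2) (ha : a = 1 - m - s / 2) (hm : s^2 ≤ m) (hsm : s + m ≤ 1) :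
    ‖(1 - m) • (χ • ν) + ((-t) • (χ • Y) + (-t^2) • ((χ * (‖Y‖^2/2)) • ν))‖ ≤ 1 := by
  have e : (1 - m) • (χ • ν) + ((-t) • (χ • Y) + (-t^2) • ((χ * (‖Y‖^2/2)) • ν)) = χ • (a • ν + (-t) • Y) := by
    rw [ha, hs]; module
  rw [e, norm_smul, Real.norm_of_nonneg hχ0]
  have h2 : ‖a • ν + (-t) • Y‖ ≤ 1 := by
    obtain ⟨c, hc⟩ := hc
    have h4 : inner ℝ (a • ν) ((-t) • Y) = (0:ℝ) := by
      rw [hc, real_inner_smul_left, real_inner_smul_right, real_inner_smul_left, hp]; ring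
    have h5 : ‖a • ν + (-t) • Y‖^2 ≤ 1 := by
      rw [norm_add_sq_real, h4, norm_smul, norm_smul, mul_pow, mul_pow, Real.norm_eq_abs, Real.norm_eq_abs, sq_abs, sq_abs]
      have h6 : ‖ν‖^2 ≤ 1 := by
        have := pow_le_pow_left₀ (norm_nonneg ν) hν 2
        simpa using this
      have h7 := mul_le_mul_of_nonneg_left h6 (sq_nonneg a)
      have h8 : (-t)^2 * ‖Y‖^2 = s := by rw [hs]; ring
      rw [h8]
      have h9 : a^2 + s ≤ 1 := by
        have hs0 : 0 ≤ s := by rw [hs]; positivity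
        have hm0 : 0 ≤ m := (sq_nonneg s).trans hm
        rw [ha]
        have := mul_nonneg hm0 (by linarith : 0 ≤ 1 - (s + m))
        nlinarith
      linarith
    exact (abs_le_of_sq_le_sq' (by simpa using h5) zero_le_one).2
  calc χ * _ ≤ 1 * 1 := mul_le_mul hχ1 h2 (norm_nonneg _) zero_le_one
    _ = 1 := one_mul 1

set_option maxHeartbeats 1000000 in
lemma per_lower {n : ℕ} (hn : 0 < n) {U : V n → ℝ} (hU : ContDiff ℝ (⊤:ℕ∞) U) (C : ℝ) (hC0 : 0 ≤ C) :
    ∃ C' : ℝ, 0 < C' ∧ ∃ δ : ℝ, 0 < δ ∧ ∀ (t : ℝ) (E : Set (V n)) (R : V n → ℝ), |t| ≤ δ → NB C t U E R →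
      C * |t| ≤ 1/8 → volume E = volume (ball (0 : V n) 1) → perimeter E ≠ ⊤ →
      NN n + t^2/2 * ((∫ x, ‖tg U x‖^2 ∂(sph n)) - (n - 1) * ∫ x, U x^2 ∂(sph n)) - C' * |t|^3 ≤ P E := by
  obtain ⟨χ, ν, hχ, hχc, hν, hχ0, hχ1, hν1, hχe, hνe, hνp⟩ := cutoffs n
  have hY := tg_smooth hU
  set A := ∫ x, ‖tg U x‖^2 ∂(sph n) with hA
  set S := ∫ x, U x^2 ∂(sph n) with hS
  obtain ⟨M0, hM0⟩ := (hχc.isCompact).exists_bound_of_continuousOn hY.continuous.continuousOn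
  set M := max M0 1
  have hM1 : 1 ≤ M := le_max_right _ _
  have hM : ∀ w, χ w ≠ 0 → ‖tg U w‖ ≤ M := fun w hw => (hM0 w (subset_tsupport _ hw)).trans (le_max_left _ _)
  -- the three fields
  set Z : V n → V n := fun w => χ w • ν w with hZ
  set W1 : V n → V n := fun w => χ w • tg U w with hW1
  set W2 : V n → V n := fun w => (χ w * (‖tg U w‖^2/2)) • ν w with hW2
  have sZ : ContDiff ℝ (⊤:ℕ∞) Z := hχ.smul hν
  have sW1 : ContDiff ℝ (⊤:ℕ∞) W1 := hχ.smul hY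
  have sW2 : ContDiff ℝ (⊤:ℕ∞) W2 := (hχ.mul ((hY.norm_sq ℝ).div_const 2)).smul hν
  have cZ : HasCompactSupport Z := hχc.smul_right
  have cW1 : HasCompactSupport W1 := hχc.smul_right
  have cW2 : HasCompactSupport W2 := by
    have : HasCompactSupport (fun w => χ w * (‖tg U w‖^2/2)) := hχc.mul_right
    exact this.smul_right
  have one_le : (1 : WithTop ℕ∞) ≤ ((⊤:ℕ∞):WithTop ℕ∞) := by norm_cast
  have sZ1 := sZ.of_le one_le
  have sW11 := sW1.of_le one_le
  have sW21 := sW2.of_le one_le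
  have dZ := sZ1.differentiable (by simp)
  have dW1 := sW11.differentiable (by simp)
  have dW2 := sW21.differentiable (by simp)
  have dU : Differentiable ℝ U := (hU.of_le one_le).differentiable (by simp)
  -- L-lemmas
  obtain ⟨C1, hC1, hL1⟩ := L1 hn C hC0
  obtain ⟨C2, hC2, hL2⟩ := L2 hn C hC0
  obtain ⟨K1, hK1, hb1, hl1⟩ := lip_ray (vdiv_C1 sW1) (vdiv_cpt cW1)
  obtain ⟨K2, hK2, hb2, hl2⟩ := lip_ray (vdiv_C1 sW2) (vdiv_cpt cW2)
  have bZ : ∫ w in ball 0 1, vdiv Z w = NN n := by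
    rw [ball_divthm hn sZ1 cZ]
    have : ∫ x, inner ℝ x (Z x) ∂(sph n) = ∫ x, (1:ℝ) ∂(sph n) := by
      apply sph_congr; intro x hx
      simp only [hZ]
      rw [hχe x (by rw [hx]; norm_num) (by rw [hx]; norm_num), hνe x (by rw [hx]; norm_num), hx]
      simp [hx]
    rw [this, integral_const, smul_eq_mul, mul_one, NN]
  have bW1 : ∫ w in ball 0 1, vdiv W1 w = 0 := by
    rw [ball_divthm hn sW11 cW1]
    simp only [hW1, real_inner_smul_right, tg_perp, mul_zero, integral_zero]
  have bW2 : ∫ w in ball 0 1, vdiv W2 w = A / 2 := by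
    rw [ball_divthm hn sW21 cW2, hA, ← integral_div]
    apply sph_congr; intro x hx
    simp only [hW2]
    rw [hχe x (by rw [hx]; norm_num) (by rw [hx]; norm_num), hνe x (by rw [hx]; norm_num), hx]
    simp [hx, real_inner_smul_right]
  have vZ : ∀ w : V n, 1/2 < ‖w‖ → ‖w‖ < 3/2 → vdiv Z w = (n - 1) * ‖w‖⁻¹ := by
    intro w h1 h2
    rw [← vdiv_nu (by intro h; rw [h, norm_zero] at h1; norm_num at h1)]
    apply vdiv_congr
    filter_upwards [(isOpen_lt continuous_const continuous_norm).mem_nhds h1, (isOpen_lt continuous_norm continuous_const).mem_nhds h2] with v hv1 hv2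
    have hv1' : 1/2 < ‖v‖ := hv1
    have hv2' : ‖v‖ < 3/2 := hv2
    simp only [hZ]
    rw [hχe v hv1'.le hv2'.le, one_smul, hνe v hv1'.le]
  have tW1 : ∫ x, vdiv W1 x * U x ∂(sph n) = - A := by
    have h1 := sph_div_tangential hn (φ := fun w => U w • W1 w) ((hU.of_le one_le).smul sW11) (cs_smul U W1 cW1)
      (fun w => by simp only [hW1, real_inner_smul_right, tg_perp, mul_zero])
    have h2 : ∀ x, vdiv (fun w => U w • W1 w) x = fderiv ℝ U x (W1 x) + U x * vdiv W1 x := fun x => vdiv_smul (dU x) (dW1 x)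
    simp only [h2] at h1
    rw [integral_add, ] at h1
    · have h3 : ∫ x, fderiv ℝ U x (W1 x) ∂(sph n) = A := by
        rw [hA]
        apply sph_congr; intro x hx
        simp only [hW1]
        rw [hχe x (by rw [hx]; norm_num) (by rw [hx]; norm_num), one_smul, tg_grad U hx]
      rw [h3] at h1
      simp only [mul_comm (vdiv W1 _)]
      linarith
    · apply sph_integrable
      have := (hU.of_le one_le).continuous_fderiv (by simp)
      have h5 := sW11.continuous
      exact (this.clm_apply h5).continuousOn
    · apply sph_integrable
      exact (hU.continuous.mul (vdiv_cont sW11)).continuousOn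
  have hS0 : 0 ≤ S := integral_nonneg fun x => sq_nonneg _
  have hn1 : (0:ℝ) ≤ n - 1 := by
    have : (1:ℝ) ≤ n := by exact_mod_cast hn
    linarith
  set Ca := C2 * (2 * n) with hCa
  set Cb := C1 * K1 with hCb
  set J2 := |∫ x, vdiv W2 x * U x ∂(sph n)| with hJ2
  set Cc := C1 * K2 + J2 with hCc
  have hN := NN_pos hn
  have hCa0 : 0 ≤ Ca := by positivity
  have hCb0 : 0 ≤ Cb := by positivity
  have hCc0 : 0 ≤ Cc := by positivity
  refine ⟨M^4 * (NN n + Ca + (n-1) * S / 2) + Ca + Cb + Cc + 1, by positivity, 1 / (2 * M), by positivity, ?_⟩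
  intro t E R ht hnb hCt hvol hper
  have htM : |t| * M ≤ 1/2 := by
    rw [le_div_iff₀ (by positivity)] at ht; linarith
  have ht1 : |t| ≤ 1 := by nlinarith [abs_nonneg t]
  have hEsub := nb_sub' hnb hCt
  have hInt : ∀ {φ : V n → V n}, ContDiff ℝ 1 φ → HasCompactSupport φ → Integrable (vdiv φ) (volume.restrict E) := 
    fun h h' => (vdiv_integrable h h').restrict
  have a1 : |LL E (vdiv Z) + t^2 * ((n-1) / 2) * S| ≤ Ca * |t|^3 := by
    have := hL2 t U E R hnb hCt ht1 hU.continuous.continuousOn hvol (2 * n) (-(n - 1)) (n-1) (vdiv Z) (vdiv_cont sZ1)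
      (by positivity) (by rw [abs_neg, abs_of_nonneg hn1]; linarith) (by
        intro x hx ρ hρ
        have hρ' := abs_le.1 hρ
        have hρ0 : 0 < ρ := by linarith
        have hnr : ‖ρ • x‖ = ρ := by rw [norm_smul, hx, mul_one, Real.norm_of_nonneg hρ0.le]
        rw [vZ _ (by rw [hnr]; linarith) (by rw [hnr]; linarith), hnr]
        have e : (n - 1) * ρ⁻¹ - (n - 1) - -(n - 1) * (ρ - 1) = (n-1) * ρ⁻¹ * (ρ - 1)^2 := by
          field_simp; ring
        rw [e, abs_of_nonneg (by positivity)]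
        have h5 : ρ⁻¹ ≤ 2 := by rw [inv_le_comm₀ hρ0 (by norm_num)]; linarith
        apply mul_le_mul_of_nonneg_right _ (sq_nonneg _)
        have := mul_le_mul_of_nonneg_left h5 hn1
        linarith)
    rw [show t ^ 2 * (-(n - 1) / 2) * ∫ x, U x ^ 2 ∂(sph n) = - (t^2 * ((n-1) / 2) * S) by rw [hS]; ring, sub_neg_eq_add] at this
    exact this
  have b1 : |LL E (vdiv W1) + t * A| ≤ Cb * t^2 := by
    have := hL1 t U E R hnb hCt hU.continuous.continuousOn K1 (vdiv W1) (vdiv_cont sW11) hK1 (fun x _ => hb1 x) (fun x hx ρ _ => hl1 x hx ρ)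
    rw [tW1] at this
    rw [show LL E (vdiv W1) + t * A = LL E (vdiv W1) - t * -A by ring]
    exact this
  have c1 : |LL E (vdiv W2)| ≤ Cc * |t| := by
    have := hL1 t U E R hnb hCt hU.continuous.continuousOn K2 (vdiv W2) (vdiv_cont sW21) hK2 (fun x _ => hb2 x) (fun x hx ρ _ => hl2 x hx ρ)
    have h3 : |t * ∫ x, vdiv W2 x * U x ∂(sph n)| = |t| * J2 := by rw [abs_mul]
    have h4 := abs_add_le (LL E (vdiv W2) - t * ∫ x, vdiv W2 x * U x ∂(sph n)) (t * ∫ x, vdiv W2 x * U x ∂(sph n))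
    rw [sub_add_cancel, h3] at h4
    have h5 : t^2 ≤ |t| := by rw [← sq_abs]; nlinarith [abs_nonneg t]
    have h6 := mul_le_mul_of_nonneg_left h5 (by positivity : 0 ≤ C1 * K2)
    rw [hCc]; linarith
  -- the test field
  set m := M^4 * t^4 with hm
  have key := per_ge hper (φ := fun w => (1 - m) • Z w + ((-t) • W1 w + (-t^2) • W2 w))
    (cd_comb _ _ _ _ _ _ sZ1 sW11 sW21) (cs_comb _ _ _ _ _ _ cZ cW1 cW2) (by
      intro w
      by_cases hw : χ w = 0
      · simp [hZ, hW1, hW2, hw]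
      have hYM := hM w hw
      have q1 : t^2 * ‖tg U w‖^2 ≤ (|t| * M)^2 := by
        rw [mul_pow, sq_abs]; gcongr
      have q2 : (|t| * M)^2 ≤ (1/2)^2 := pow_le_pow_left₀ (by positivity) htM 2
      have q3 : m = ((|t| * M)^2)^2 := by rw [mul_pow, sq_abs, hm]; ring
      refine phi_norm (hχ0 w) (hχ1 w) (hν1 w) (hνp w) (tg_perp U w) rfl rfl ?_ ?_
      · rw [q3]; exact pow_le_pow_left₀ (by positivity) q1 2
      · rw [q3]
        have : ((|t| * M)^2)^2 ≤ ((1/2)^2)^2 := pow_le_pow_left₀ (by positivity) q2 2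
        norm_num at this q2 ⊢
        linarith)
  have hv : ∀ w, vdiv (fun w => (1 - m) • Z w + ((-t) • W1 w + (-t^2) • W2 w)) w = (1 - m) * vdiv Z w + (-t * vdiv W1 w + -t^2 * vdiv W2 w) := by
    exact vdiv_comb _ _ _ _ _ _ dZ dW1 dW2
  simp only [hv] at key
  rw [int_comb _ _ _ _ _ _ (hInt sZ1 cZ) (hInt sW11 cW1) (hInt sW21 cW2)] at key
  have eZ : ∫ w in E, vdiv Z w = NN n + LL E (vdiv Z) := by rw [LL, bZ]; ring
  have eW1 : ∫ w in E, vdiv W1 w = LL E (vdiv W1) := by rw [LL, bW1]; ring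
  have eW2 : ∫ w in E, vdiv W2 w = A/2 + LL E (vdiv W2) := by rw [LL, bW2]; ring
  rw [eZ, eW1, eW2] at key
  refine le_trans ?_ key
  generalize LL E (vdiv Z) = a at *
  generalize LL E (vdiv W1) = b at *
  generalize LL E (vdiv W2) = c at *
  have tb : t * (b + t * A) ≤ Cb * |t|^3 := by
    refine (le_abs_self _).trans ?_
    rw [abs_mul]
    have := mul_le_mul_of_nonneg_left b1 (abs_nonneg t)
    rw [← sq_abs t] at this
    linarith
  have tc : t^2 * c ≤ Cc * |t|^3 := by
    have := mul_le_mul_of_nonneg_left ((le_abs_self _).trans c1) (sq_nonneg t)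
    rw [← sq_abs t] at this ⊢
    linarith
  have t3 : |t|^3 ≤ 1 := pow_le_one₀ (abs_nonneg _) ht1
  have t2 : t^2 ≤ 1 := by rw [← sq_abs]; exact pow_le_one₀ (abs_nonneg _) ht1
  have t4 : m ≤ M^4 * |t|^3 := by
    rw [hm]; apply mul_le_mul_of_nonneg_left _ (by positivity)
    rw [show t^4 = |t|^3 * |t| by rw [← pow_succ]; exact (Even.pow_abs (by decide) t).symm]
    exact mul_le_of_le_one_right (by positivity) ht1
  have hm0 : 0 ≤ m := by positivity
  have ha : a ≤ Ca := by
    have h1 := (abs_le.1 a1).2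
    have h2 := mul_le_mul_of_nonneg_left t3 hCa0
    have h3 : 0 ≤ t^2 * ((n-1) / 2) * S := by positivity
    linarith
  have ma : m * (NN n + a) ≤ M^4 * |t|^3 * (NN n + Ca) := by
    have h1 : m * (NN n + a) ≤ m * (NN n + Ca) := mul_le_mul_of_nonneg_left (by linarith) hm0
    have h2 := mul_le_mul_of_nonneg_right t4 (by linarith : 0 ≤ NN n + Ca)
    linarith
  have a2 := (abs_le.1 a1).1
  have x1 : 0 ≤ M^4 * ((n-1) * S / 2) * |t|^3 := by positivity
  have x2 : 0 ≤ |t|^3 := by positivity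
  have e : (1 - m) * (NN n + a) + (-t * b + -t^2 * (A / 2 + c)) = NN n + a - m * (NN n + a) - t * (b + t * A) + t^2 * A / 2 - t^2 * c := by ring
  rw [e]
  linarith


lemma zpow_sub_one_le (z : ℂ) (hz : ‖z‖ = 1) (n : ℤ) : ‖z^n - 1‖ ≤ |(n:ℝ)| * ‖z - 1‖ := by
  have hnat : ∀ k : ℕ, ‖z^k - 1‖ ≤ k * ‖z - 1‖ := by
    intro k
    induction k with
    | zero => simp
    | succ k ih =>
      have : z^(k+1) - 1 = z * (z^k - 1) + (z - 1) := by ring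
      rw [this]
      refine (norm_add_le _ _).trans ?_
      rw [norm_mul, hz]; push_cast; linarith
  have hz0 : z ≠ 0 := by intro h; rw [h, norm_zero] at hz; norm_num at hz
  obtain ⟨k, rfl | rfl⟩ := n.eq_nat_or_neg
  · simpa using hnat k
  · have : z^(-(k:ℤ)) - 1 = - (z^(-(k:ℤ)) * (z^k - 1)) := by
      rw [zpow_neg, zpow_natCast]; field_simp; ring
    rw [this, norm_neg, norm_mul, norm_zpow, hz, one_zpow, one_mul]
    simpa using hnat k

lemma fourier_two_pi (n : ℤ) (x : ℝ) : fourier n (x : AddCircle (2 * Real.pi - 0)) = Complex.exp (n * x * Complex.I) := by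
  rw [fourier_coe_apply]
  congr 1
  have : (Real.pi : ℂ) ≠ 0 := by exact_mod_cast Real.pi_ne_zero
  push_cast
  rw [sub_zero]
  field_simp

lemma circle_ineq {φ φ' : ℝ → ℝ} (hφ : ∀ s, HasDerivAt φ (φ' s) s) (hφ' : Continuous φ')
    (hp : Function.Periodic φ (2 * Real.pi)) (θ : ℝ) :
    ∫ s in (0:ℝ)..(2 * Real.pi), (φ (s + θ) - φ s)^2 ≤ (2 - 2 * Real.cos θ) * ∫ s in (0:ℝ)..(2 * Real.pi), φ' s^2 := by
  have hab : (0:ℝ) < 2 * Real.pi := by positivity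
  have hc : Continuous φ := continuous_iff_continuousAt.2 fun s => (hφ s).continuousAt
  set g : ℝ → ℂ := fun s => ((φ (s + θ) : ℝ) : ℂ) - (φ s : ℂ) with hg
  set f : ℝ → ℂ := fun s => (φ s : ℂ) with hf
  set f' : ℝ → ℂ := fun s => (φ' s : ℂ) with hf'
  have hfc : Continuous f := by fun_prop
  have hfc' : Continuous f' := by fun_prop
  have hgc : Continuous g := by fun_prop
  have mem : ∀ {h : ℝ → ℂ}, Continuous h → MemLp h 2 (volume.restrict (Set.Ioc 0 (2 * Real.pi))) := by
    intro h hh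
    obtain ⟨B, hB⟩ := (isCompact_Icc (a := (0:ℝ)) (b := 2 * Real.pi)).exists_bound_of_continuousOn hh.continuousOn
    refine MemLp.of_bound hh.aestronglyMeasurable B ?_
    filter_upwards [ae_restrict_mem measurableSet_Ioc] with s hs using hB s (Set.Ioc_subset_Icc_self hs)
  have s1 := hasSum_sq_fourierCoeffOn hab (mem hgc)
  have s2 := hasSum_sq_fourierCoeffOn hab (mem hfc')
  set z : ℂ := Complex.exp (θ * Complex.I) with hz
  have hz1 : ‖z‖ = 1 := Complex.norm_exp_ofReal_mul_I θ
  have hz2 : ‖z - 1‖^2 = 2 - 2 * Real.cos θ := by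
    rw [hz, Complex.exp_mul_I, ← Complex.normSq_eq_norm_sq, Complex.normSq_apply]
    simp [Complex.cos_ofReal_re, Complex.sin_ofReal_re, Complex.cos_ofReal_im, Complex.sin_ofReal_im]
    nlinarith [Real.sin_sq_add_cos_sq θ]
  have hgf : ∀ k : ℤ, fourierCoeffOn hab g k = (z^k - 1) * fourierCoeffOn hab f k := by
    intro k
    simp only [fourierCoeffOn_eq_integral, fourier_two_pi]
    have e1 : ∀ s : ℝ, Complex.exp (((-k : ℤ):ℂ) * s * Complex.I) • g s =
      z^k * (Complex.exp (((-k : ℤ):ℂ) * ((s + θ : ℝ):ℂ) * Complex.I) * f (s + θ)) - Complex.exp (((-k : ℤ):ℂ) * s * Complex.I) * f s := by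
      intro s
      rw [hz, ← Complex.exp_int_mul, ← mul_assoc, ← Complex.exp_add]
      simp only [hg, hf, smul_eq_mul]
      rw [mul_sub]
      congr 3
      push_cast; ring
    simp only [e1]
    rw [intervalIntegral.integral_sub, intervalIntegral.integral_const_mul]
    · have e2 : ∫ s in (0:ℝ)..(2 * Real.pi), (Complex.exp (((-k : ℤ):ℂ) * ((s + θ : ℝ):ℂ) * Complex.I) * f (s + θ)) =
        ∫ s in (0:ℝ)..(2 * Real.pi), (Complex.exp (((-k : ℤ):ℂ) * (s:ℂ) * Complex.I) * f s) := by
        rw [intervalIntegral.integral_comp_add_right (fun s : ℝ => Complex.exp (((-k : ℤ):ℂ) * (s:ℂ) * Complex.I) * f s)]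
        have hper : Function.Periodic (fun s : ℝ => Complex.exp (((-k : ℤ):ℂ) * (s:ℂ) * Complex.I) * f s) (2 * Real.pi) := by
          intro s
          simp only [hf, hp s]
          congr 1
          rw [show (((-k : ℤ):ℂ) * ((s + 2 * Real.pi : ℝ):ℂ) * Complex.I) = ((-k : ℤ):ℂ) * (s:ℂ) * Complex.I + ((-k : ℤ):ℂ) * (2 * Real.pi * Complex.I) by push_cast; ring,
            Complex.exp_add, Complex.exp_int_mul_two_pi_mul_I, mul_one]
        have := hper.intervalIntegral_add_eq θ 0
        rw [zero_add] at this
        rw [zero_add, add_comm (2 * Real.pi) θ]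
        exact this
      rw [e2]
      simp only [smul_eq_mul, Complex.real_smul]
      ring
    · exact Continuous.intervalIntegrable (by fun_prop) _ _
    · exact Continuous.intervalIntegrable (by fun_prop) _ _
  have hff : ∀ k : ℤ, k ≠ 0 → ‖fourierCoeffOn hab f' k‖ = |(k:ℝ)| * ‖fourierCoeffOn hab f k‖ := by
    intro k hk
    have := fourierCoeffOn_of_hasDerivAt hab hk (f := f) (f' := f') (fun s _ => (hφ s).ofReal_comp) (hfc'.intervalIntegrable _ _)
    have h0 : f (2 * Real.pi) - f 0 = 0 := by
      have := hp 0
      rw [zero_add] at this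
      simp only [hf, this, sub_self]
    rw [h0, mul_zero, zero_sub] at this
    have hpi : (Real.pi : ℂ) ≠ 0 := by exact_mod_cast Real.pi_ne_zero
    have hk' : (k : ℂ) ≠ 0 := by exact_mod_cast hk
    have e : fourierCoeffOn hab f' k = (Complex.I * k) * fourierCoeffOn hab f k := by
      rw [this]
      push_cast
      field_simp
      ring_nf
    rw [e, norm_mul, norm_mul, Complex.norm_I, one_mul, Complex.norm_intCast]
  have hle : ∀ k : ℤ, ‖fourierCoeffOn hab g k‖^2 ≤ (2 - 2 * Real.cos θ) * ‖fourierCoeffOn hab f' k‖^2 := by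
    intro k
    rw [← hz2, ← mul_pow]
    apply pow_le_pow_left₀ (norm_nonneg _)
    rw [hgf, norm_mul]
    by_cases hk : k = 0
    · rw [hk]; simp; positivity
    · rw [hff k hk]
      have := mul_le_mul_of_nonneg_right (zpow_sub_one_le z hz1 k) (norm_nonneg (fourierCoeffOn hab f k))
      linarith
  have fin := hasSum_le hle s1 (s2.mul_left _)
  have n1 : ∀ s, ‖g s‖^2 = (φ (s + θ) - φ s)^2 := by
    intro s
    simp only [hg]
    rw [← Complex.ofReal_sub, Complex.norm_real, Real.norm_eq_abs, sq_abs]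
  have n2 : ∀ s, ‖f' s‖^2 = φ' s^2 := by
    intro s
    simp only [hf']
    rw [Complex.norm_real, Real.norm_eq_abs, sq_abs]
  simp only [n1, n2, smul_eq_mul] at fin
  have hpos : 0 < (2 * Real.pi - 0)⁻¹ := by rw [sub_zero]; positivity
  rw [mul_left_comm] at fin
  exact le_of_mul_le_mul_left fin hpos


abbrev OG (n : ℕ) : Type := ↥(unitary (V n →L[ℝ] V n))

instance (n : ℕ) : ContinuousStar (V n →L[ℝ] V n) := ⟨(ContinuousLinearMap.adjoint (𝕜 := ℝ) (E := V n) (F := V n)).continuous⟩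
instance (n : ℕ) : CompactSpace (OG n) := by
  have : ProperSpace (V n →L[ℝ] V n) := FiniteDimensional.proper ℝ _
  refine (isCompact_iff_compactSpace (s := (unitary (V n →L[ℝ] V n) : Set (V n →L[ℝ] V n)))).1 ?_
  apply Metric.isCompact_of_isClosed_isBounded
  · exact isClosed_unitary
  · rw [Metric.isBounded_iff_subset_closedBall 0]
    refine ⟨1, fun u hu => ?_⟩
    rw [mem_closedBall_zero_iff]
    refine ContinuousLinearMap.opNorm_le_bound _ zero_le_one fun x => ?_
    rw [one_mul]
    exact (Unitary.norm_map ⟨u, hu⟩ x).le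

instance (n : ℕ) : IsTopologicalGroup (OG n) := inferInstanceAs (IsTopologicalGroup ↥(unitary (V n →L[ℝ] V n)))
instance (n : ℕ) : MeasurableSpace (OG n) := borel _
instance (n : ℕ) : BorelSpace (OG n) := ⟨rfl⟩
instance (n : ℕ) : SecondCountableTopology (OG n) := inferInstance

def og (n : ℕ) : Measure (OG n) := Measure.haarMeasure ⊤

instance (n : ℕ) : Measure.IsMulLeftInvariant (og n) := by unfold og; infer_instance
instance (n : ℕ) : IsProbabilityMeasure (og n) := ⟨by
  have := Measure.haarMeasure_self (G := OG n) (K₀ := ⊤)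
  simpa [og] using this⟩

/-- the action we average over: g⁻¹ -/
def act {n : ℕ} (g : OG n) (x : V n) : V n := (((g⁻¹ : OG n)) : V n →L[ℝ] V n) x

lemma act_cont (n : ℕ) : Continuous (fun p : OG n × V n => act p.1 p.2) := by
  unfold act
  have h : Continuous (fun p : OG n × V n => (((p.1⁻¹ : OG n)) : V n →L[ℝ] V n)) := continuous_subtype_val.comp (continuous_fst.inv)
  exact h.clm_apply continuous_snd

lemma act_norm {n : ℕ} (g : OG n) (x : V n) : ‖act g x‖ = ‖x‖ := Unitary.norm_map _ x

lemma act_iso {n : ℕ} (g : OG n) : ∃ h : V n ≃ₗᵢ[ℝ] V n, ∀ x, h x = act g x :=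
  ⟨Unitary.linearIsometryEquiv g⁻¹, fun x => rfl⟩

lemma og_inv {n : ℕ} (h : V n ≃ₗᵢ[ℝ] V n) (F : (V n → V n) → ℝ) :
    ∫ g, F (fun x => act g (h x)) ∂(og n) = ∫ g, F (act g) ∂(og n) := by
  let k : OG n := Unitary.linearIsometryEquiv.symm h
  have h1 := integral_mul_left_eq_self (μ := og n) (fun g => F (act g)) k⁻¹
  rw [← h1]
  apply integral_congr_ae
  refine ae_of_all _ fun g => ?_
  simp only
  congr 1
  ext1 x
  unfold act
  rw [mul_inv_rev, inv_inv]
  rfl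


lemma integrable_of_cpt {X : Type*} [TopologicalSpace X] [MeasurableSpace X] [OpensMeasurableSpace X] [SecondCountableTopology X]
    {μ : Measure X} [IsFiniteMeasure μ] {K : Set X} (hK : IsCompact K) (h : ∀ᵐ x ∂μ, x ∈ K) {F : X → ℝ} (hF : Continuous F) :
    Integrable F μ := by
  obtain ⟨C, hC⟩ := hK.exists_bound_of_continuousOn hF.continuousOn
  refine Integrable.of_bound hF.aestronglyMeasurable C ?_
  filter_upwards [h] with x hx using hC x hx

lemma s2_ae (n : ℕ) : ∀ᵐ z ∂((sph n).prod (sph n)), z ∈ closedBall (0 : V n) 1 ×ˢ closedBall (0 : V n) 1 := by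
  have h1 := (Measure.quasiMeasurePreserving_fst (μ := sph n) (ν := sph n)).ae (sph_norm (n := n))
  have h2 := (Measure.quasiMeasurePreserving_snd (μ := sph n) (ν := sph n)).ae (sph_norm (n := n))
  filter_upwards [h1, h2] with z hz1 hz2
  exact ⟨by simp [hz1], by simp [hz2]⟩

lemma s2_ae' (n : ℕ) : ∀ᵐ z ∂((sph n).prod (sph n)), ‖z.1‖ = 1 ∧ ‖z.2‖ = 1 := by
  have h1 := (Measure.quasiMeasurePreserving_fst (μ := sph n) (ν := sph n)).ae (sph_norm (n := n))
  have h2 := (Measure.quasiMeasurePreserving_snd (μ := sph n) (ν := sph n)).ae (sph_norm (n := n))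
  filter_upwards [h1, h2] with z hz1 hz2
  exact ⟨hz1, hz2⟩

lemma s2_integrable {n : ℕ} {F : V n × V n → ℝ} (hF : Continuous F) : Integrable F ((sph n).prod (sph n)) :=
  integrable_of_cpt ((isCompact_closedBall _ _).prod (isCompact_closedBall _ _)) (s2_ae n) hF

lemma og_sph_int {n : ℕ} {F : OG n × V n → ℝ} (hF : Continuous F) : Integrable F ((og n).prod (sph n)) := by
  refine integrable_of_cpt (K := Set.univ ×ˢ closedBall 0 1) (isCompact_univ.prod (isCompact_closedBall _ _)) ?_ hF
  have h2 := (Measure.quasiMeasurePreserving_snd (μ := og n) (ν := sph n)).ae (sph_norm (n := n))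
  filter_upwards [h2] with z hz2
  exact ⟨trivial, by simp [hz2]⟩

lemma og_s2_int {n : ℕ} {F : OG n × (V n × V n) → ℝ} (hF : Continuous F) : Integrable F ((og n).prod ((sph n).prod (sph n))) := by
  refine integrable_of_cpt (K := Set.univ ×ˢ (closedBall 0 1 ×ˢ closedBall 0 1)) (isCompact_univ.prod ((isCompact_closedBall _ _).prod (isCompact_closedBall _ _))) ?_ hF
  have h2 := (Measure.quasiMeasurePreserving_snd (μ := og n) (ν := (sph n).prod (sph n))).ae (s2_ae n)
  filter_upwards [h2] with z hz2
  exact ⟨trivial, hz2⟩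

lemma og_int {n : ℕ} {F : OG n → ℝ} (hF : Continuous F) : Integrable F (og n) :=
  integrable_of_cpt isCompact_univ (ae_of_all _ fun _ => trivial) hF

lemma sph_comp {n : ℕ} (h : V n ≃ₗᵢ[ℝ] V n) (F : V n → ℝ) : ∫ x, F (h x) ∂sph n = ∫ x, F x ∂sph n :=
  (sph_mp h).integral_comp h.toHomeomorph.measurableEmbedding F

lemma og_sph {n : ℕ} (hn : 0 < n) {F : V n → ℝ} (hF : Continuous F) {e : V n} (he : ‖e‖ = 1) :
    NN n * ∫ g, F (act g e) ∂og n = ∫ x, F x ∂sph n := by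
  have h1 : ∀ x : V n, ‖x‖ = 1 → ∫ g, F (act g x) ∂og n = ∫ g, F (act g e) ∂og n := by
    intro x hx
    obtain ⟨h, hh⟩ := exists_rot (x := e) (y := x) (by rw [he, hx])
    rw [← hh]
    exact og_inv h (fun a => F (a e))
  have h2 : ∫ x, ∫ g, F (act g x) ∂og n ∂sph n = ∫ x, (∫ g, F (act g e) ∂og n) ∂sph n := sph_congr h1
  rw [integral_const, smul_eq_mul] at h2
  change _ = NN n * _ at h2
  rw [← h2]
  have hc : Continuous (fun z : OG n × V n => F (act z.1 z.2)) := hF.comp (act_cont n)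
  rw [← integral_integral_swap (f := fun g x => F (act g x)) (og_sph_int hc)]
  have h3 : ∀ g, ∫ x, F (act g x) ∂sph n = ∫ x, F x ∂sph n := by
    intro g
    obtain ⟨h, hh⟩ := act_iso g
    simp_rw [← hh]
    exact sph_comp h F
  simp_rw [h3]
  simp

lemma exists_rot2 {n : ℕ} {x y x' y' : V n} (h1 : ‖x‖ = ‖x'‖) (h2 : ‖y‖ = ‖y'‖) (h3 : inner ℝ x y = inner ℝ x' y') :
    ∃ g : V n ≃ₗᵢ[ℝ] V n, g x = x' ∧ g y = y' := by
  obtain ⟨g, hg⟩ := exists_rot h1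
  have hz : ‖g y‖ = ‖y'‖ := by rw [g.norm_map, h2]
  have hi : inner ℝ x' (g y - y') = (0:ℝ) := by
    rw [inner_sub_right, ← h3, ← hg, g.inner_map_map, sub_self]
  refine ⟨g.trans (ℝ ∙ (g y - y'))ᗮ.reflection, ?_, ?_⟩
  · rw [LinearIsometryEquiv.trans_apply, hg]
    apply Submodule.reflection_mem_subspace_eq_self
    rw [Submodule.mem_orthogonal_singleton_iff_inner_left]
    exact hi
  · rw [LinearIsometryEquiv.trans_apply]
    exact Submodule.reflection_sub hz

lemma og_inv2 {n : ℕ} {x y x' y' : V n} (h1 : ‖x‖ = ‖x'‖) (h2 : ‖y‖ = ‖y'‖) (h3 : inner ℝ x y = inner ℝ x' y')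
    (F : V n → V n → ℝ) : ∫ g, F (act g x) (act g y) ∂og n = ∫ g, F (act g x') (act g y') ∂og n := by
  obtain ⟨h, hx, hy⟩ := exists_rot2 h1 h2 h3
  rw [← hx, ← hy]
  exact (og_inv h (fun a => F (a x) (a y))).symm

lemma act_lin {n : ℕ} (g : OG n) (a b : ℝ) (x y : V n) : act g (a • x + b • y) = a • act g x + b • act g y := by
  unfold act; simp

lemma act_inner {n : ℕ} (g : OG n) (x y : V n) : inner ℝ (act g x) (act g y) = inner ℝ x y := by
  obtain ⟨h, hh⟩ := act_iso g
  rw [← hh, ← hh, h.inner_map_map]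

lemma act_cont1 {n : ℕ} (x : V n) : Continuous (fun g : OG n => act g x) :=
  Continuous.comp (g := fun p : OG n × V n => act p.1 p.2) (f := fun g : OG n => (g, x)) (act_cont n) (continuous_id.prodMk continuous_const)

lemma fd_cont {n : ℕ} {U : V n → ℝ} (hU : ContDiff ℝ (⊤ : ℕ∞) U) : Continuous (fun z : V n × V n => fderiv ℝ U z.1 z.2) := by
  have h := hU.continuous_fderiv (by simp)
  exact (h.comp continuous_fst).clm_apply continuous_snd

/-- the T functional -/
lemma T_sum {n : ℕ} (hn : 2 ≤ n) {U : V n → ℝ} (hU : ContDiff ℝ (⊤ : ℕ∞) U) {x ω : V n} (hx : ‖x‖ = 1) (hω : ‖ω‖ = 1)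
    (hxω : inner ℝ x ω = (0:ℝ)) :
    NN n * ((n-1) * ∫ g, (fderiv ℝ U (act g x) (act g ω))^2 ∂og n) = ∫ w, ‖tg U w‖^2 ∂sph n := by
  have hn0 : 0 < n := by omega
  let i0 : Fin n := ⟨0, hn0⟩
  let e : Fin n → V n := fun i => EuclideanSpace.single i (1:ℝ)
  have he : ∀ i, ‖e i‖ = 1 := by intro i; simp [e]
  have hei : ∀ i, i ≠ i0 → inner ℝ (e i0) (e i) = (0:ℝ) := by
    intro i hi; simp [e, EuclideanSpace.inner_single_left, hi.symm]
  have hc : Continuous (fun w => ‖tg U w‖^2) := ((tg_smooth hU).continuous.norm).pow 2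
  rw [← og_sph hn0 hc (he i0)]
  congr 1
  have h1 : ∀ g : OG n, ‖tg U (act g (e i0))‖^2 = ∑ i ∈ Finset.univ.erase i0, (fderiv ℝ U (act g (e i0)) (act g (e i)))^2 := by
    intro g
    obtain ⟨h, hh⟩ := act_iso g
    let b := (EuclideanSpace.basisFun (Fin n) ℝ).map h
    have hb : ∀ i, b i = act g (e i) := by intro i; simp [b, e, hh]
    rw [← b.sum_sq_norm_inner_right, ← Finset.add_sum_erase _ _ (Finset.mem_univ i0)]
    rw [hb i0, tg_perp]
    simp only [norm_zero, ne_eq, OfNat.ofNat_ne_zero, not_false_eq_true, zero_pow, zero_add]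
    refine Finset.sum_congr rfl fun i hi => ?_
    have hi' := Finset.ne_of_mem_erase hi
    rw [hb i, Real.norm_eq_abs, sq_abs]
    congr 1
    unfold tg
    rw [inner_sub_right, inner_smul_right, inner_smul_right, act_norm, he i0, real_inner_comm (act g (e i0)) (act g (e i)), act_inner, hei i hi',
      real_inner_comm, gr_inner]
    simp
  simp_rw [h1]
  have hcc : ∀ i, Continuous (fun g : OG n => (fderiv ℝ U (act g (e i0)) (act g (e i)))^2) := fun i =>
    ((fd_cont hU).comp ((act_cont1 (e i0)).prodMk (act_cont1 (e i)))).pow 2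
  rw [integral_finset_sum _ (fun i _ => og_int (hcc i))]
  have h2 : ∀ i ∈ Finset.univ.erase i0, ∫ g, (fderiv ℝ U (act g (e i0)) (act g (e i)))^2 ∂og n = ∫ g, (fderiv ℝ U (act g x) (act g ω))^2 ∂og n := by
    intro i hi
    exact og_inv2 (by rw [he, hx]) (by rw [he, hω]) (by rw [hei i (Finset.ne_of_mem_erase hi), hxω]) (fun a b => (fderiv ℝ U a b)^2)
  rw [Finset.sum_congr rfl h2, Finset.sum_const, Finset.card_erase_of_mem (Finset.mem_univ _), Finset.card_univ, Fintype.card_fin, nsmul_eq_mul,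
    Nat.cast_sub (by omega)]
  simp


def cx {n : ℕ} (x ω : V n) (s : ℝ) : V n := Real.cos s • x + Real.sin s • ω
def cw {n : ℕ} (x ω : V n) (s : ℝ) : V n := (-Real.sin s) • x + Real.cos s • ω

lemma cx_inner {n : ℕ} {x ω : V n} (hx : ‖x‖ = 1) (hω : ‖ω‖ = 1) (hxω : inner ℝ x ω = (0:ℝ)) (a b c d : ℝ) :
    inner ℝ (a • x + b • ω) (c • x + d • ω) = a * c + b * d := by
  have h2 : inner ℝ ω x = (0:ℝ) := by rw [real_inner_comm]; exact hxω
  simp only [inner_add_left, inner_add_right, inner_smul_left, inner_smul_right, real_inner_self_eq_norm_sq, hx, hω, hxω, h2]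
  simp; ring

lemma cx_norm {n : ℕ} {x ω : V n} (hx : ‖x‖ = 1) (hω : ‖ω‖ = 1) (hxω : inner ℝ x ω = (0:ℝ)) (a b : ℝ) (hab : a*a+b*b = 1) :
    ‖a • x + b • ω‖ = 1 := by
  have := cx_inner hx hω hxω a b a b
  rw [real_inner_self_eq_norm_sq, hab] at this
  have h0 := norm_nonneg (a • x + b • ω)
  nlinarith

lemma cx_cont {n : ℕ} (x ω : V n) : Continuous (cx x ω) := by unfold cx; fun_prop
lemma cw_cont {n : ℕ} (x ω : V n) : Continuous (cw x ω) := by unfold cw; fun_prop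

lemma og_circ_swap {n : ℕ} {F : OG n → ℝ → ℝ} (hF : Continuous (fun z : OG n × ℝ => F z.1 z.2)) :
    ∫ g, (∫ s in (0:ℝ)..2*Real.pi, F g s) ∂og n = ∫ s in (0:ℝ)..2*Real.pi, ∫ g, F g s ∂og n := by
  have hpi := Real.pi_pos
  simp_rw [intervalIntegral.integral_of_le (by positivity : (0:ℝ) ≤ 2*Real.pi)]
  apply integral_integral_swap
  refine integrable_of_cpt (K := Set.univ ×ˢ Set.Icc 0 (2*Real.pi)) (isCompact_univ.prod isCompact_Icc) ?_ hF
  have h2 := (Measure.quasiMeasurePreserving_snd (μ := og n) (ν := volume.restrict (Set.Ioc 0 (2*Real.pi)))).ae (ae_restrict_mem measurableSet_Ioc)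
  filter_upwards [h2] with z hz2
  exact ⟨trivial, Set.Ioc_subset_Icc_self hz2⟩

lemma act_comp_cont {n : ℕ} {Y : Type*} [TopologicalSpace Y] {a : Y → OG n} {b : Y → V n} (ha : Continuous a) (hb : Continuous b) :
    Continuous (fun y => act (a y) (b y)) :=
  Continuous.comp (g := fun p : OG n × V n => act p.1 p.2) (f := fun y => (a y, b y)) (act_cont n) (ha.prodMk hb)

lemma D_bound {n : ℕ} {U : V n → ℝ} (hU : ContDiff ℝ (⊤ : ℕ∞) U) {x ω : V n} (hx : ‖x‖ = 1) (hω : ‖ω‖ = 1)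
    (hxω : inner ℝ x ω = (0:ℝ)) (θ : ℝ) :
    ∫ g, (U (act g (cx x ω θ)) - U (act g x))^2 ∂og n ≤ (2 - 2*Real.cos θ) * ∫ g, (fderiv ℝ U (act g x) (act g ω))^2 ∂og n := by
  have hpi := Real.pi_pos
  have hUc := hU.continuous
  have hnx : ∀ s, ‖cx x ω s‖ = 1 := fun s => cx_norm hx hω hxω _ _ (by nlinarith [Real.sin_sq_add_cos_sq s])
  have hnw : ∀ s, ‖cw x ω s‖ = 1 := fun s => cx_norm hx hω hxω _ _ (by nlinarith [Real.sin_sq_add_cos_sq s])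
  have h1 : ∀ s, ∫ g, (U (act g (cx x ω (s+θ))) - U (act g (cx x ω s)))^2 ∂og n = ∫ g, (U (act g (cx x ω θ)) - U (act g x))^2 ∂og n := by
    intro s
    refine og_inv2 (by rw [hnx, hnx]) (by rw [hnx, hx]) ?_ (fun a b => (U a - U b)^2)
    have e1 := cx_inner hx hω hxω (Real.cos (s+θ)) (Real.sin (s+θ)) (Real.cos s) (Real.sin s)
    have e2 := cx_inner hx hω hxω (Real.cos θ) (Real.sin θ) 1 0
    simp only [one_smul, zero_smul, add_zero, mul_one, mul_zero] at e2
    unfold cx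
    rw [e1, e2, ← Real.cos_sub]; congr 1; ring
  have h2 : ∀ s, ∫ g, (fderiv ℝ U (act g (cx x ω s)) (act g (cw x ω s)))^2 ∂og n = ∫ g, (fderiv ℝ U (act g x) (act g ω))^2 ∂og n := by
    intro s
    refine og_inv2 (by rw [hnx, hx]) (by rw [hnw, hω]) ?_ (fun a b => (fderiv ℝ U a b)^2)
    unfold cx cw
    rw [cx_inner hx hω hxω, hxω]; ring
  have hcirc : ∀ g : OG n, ∫ s in (0:ℝ)..2*Real.pi, (U (act g (cx x ω (s+θ))) - U (act g (cx x ω s)))^2 ≤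
      (2 - 2*Real.cos θ) * ∫ s in (0:ℝ)..2*Real.pi, (fderiv ℝ U (act g (cx x ω s)) (act g (cw x ω s)))^2 := by
    intro g
    refine circle_ineq (φ := fun s => U (act g (cx x ω s))) (φ' := fun s => fderiv ℝ U (act g (cx x ω s)) (act g (cw x ω s))) ?_ ?_ ?_ θ
    · intro s
      have hd : HasDerivAt (fun s => act g (cx x ω s)) (act g (cw x ω s)) s := by
        unfold cx cw
        simp_rw [act_lin]
        exact ((Real.hasDerivAt_cos s).smul_const _).add ((Real.hasDerivAt_sin s).smul_const _)
      have hf := (hU.differentiable (by simp) (act g (cx x ω s))).hasFDerivAt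
      exact hf.comp_hasDerivAt s hd
    · exact (fd_cont hU).comp ((act_comp_cont continuous_const (cx_cont x ω)).prodMk (act_comp_cont continuous_const (cw_cont x ω)))
    · intro s
      simp [cx]
  have hc1 : Continuous (fun z : OG n × ℝ => (U (act z.1 (cx x ω (z.2+θ))) - U (act z.1 (cx x ω z.2)))^2) := by
    have a1 := act_comp_cont (Y := OG n × ℝ) continuous_fst ((cx_cont x ω).comp (continuous_snd.add (continuous_const (y := θ))))
    have a2 := act_comp_cont (Y := OG n × ℝ) continuous_fst ((cx_cont x ω).comp continuous_snd)
    exact ((hUc.comp a1).sub (hUc.comp a2)).pow 2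
  have hc2 : Continuous (fun z : OG n × ℝ => (fderiv ℝ U (act z.1 (cx x ω z.2)) (act z.1 (cw x ω z.2)))^2) := by
    have a1 := act_comp_cont (Y := OG n × ℝ) continuous_fst ((cw_cont x ω).comp continuous_snd)
    have a2 := act_comp_cont (Y := OG n × ℝ) continuous_fst ((cx_cont x ω).comp continuous_snd)
    exact ((fd_cont hU).comp (a2.prodMk a1)).pow 2
  have k1 := og_circ_swap (F := fun g s => (U (act g (cx x ω (s+θ))) - U (act g (cx x ω s)))^2) hc1
  have k2 := og_circ_swap (F := fun g s => (fderiv ℝ U (act g (cx x ω s)) (act g (cw x ω s)))^2) hc2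
  simp_rw [h1] at k1
  simp_rw [h2] at k2
  rw [intervalIntegral.integral_const, smul_eq_mul, sub_zero] at k1 k2
  have k3 : ∫ g, (∫ s in (0:ℝ)..2*Real.pi, (U (act g (cx x ω (s+θ))) - U (act g (cx x ω s)))^2) ∂og n ≤
     ∫ g, (2 - 2*Real.cos θ) * (∫ s in (0:ℝ)..2*Real.pi, (fderiv ℝ U (act g (cx x ω s)) (act g (cw x ω s)))^2) ∂og n := by
    refine integral_mono (og_int ?_) ((og_int ?_).const_mul _) hcirc
    · exact intervalIntegral.continuous_parametric_intervalIntegral_of_continuous' hc1 _ _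
    · exact intervalIntegral.continuous_parametric_intervalIntegral_of_continuous' hc2 _ _
  rw [integral_const_mul, k1, k2] at k3
  have : 0 < 2*Real.pi := by positivity
  refine le_of_mul_le_mul_left (k3.trans_eq ?_) this
  ring

lemma D_bound2 {n : ℕ} (hn : 2 ≤ n) {U : V n → ℝ} (hU : ContDiff ℝ (⊤ : ℕ∞) U) {x y : V n} (hx : ‖x‖ = 1) (hy : ‖y‖ = 1) :
    ∫ g, (U (act g x) - U (act g y))^2 ∂og n ≤ ‖x-y‖^2 * ((∫ w, ‖tg U w‖^2 ∂sph n) / (NN n * (n-1))) := by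
  have hn0 : 0 < n := by omega
  let i0 : Fin n := ⟨0, hn0⟩
  let i1 : Fin n := ⟨1, hn⟩
  let e : V n := EuclideanSpace.single i0 (1:ℝ)
  let ω : V n := EuclideanSpace.single i1 (1:ℝ)
  have he : ‖e‖ = 1 := by simp [e]
  have hω : ‖ω‖ = 1 := by simp [ω]
  have heω : inner ℝ e ω = (0:ℝ) := by
    simp [e, ω, EuclideanSpace.inner_single_left, i0, i1]
  have hT := T_sum hn hU he hω heω
  have hN := NN_pos hn0
  have hn1 : (0:ℝ) < n - 1 := by
    have : (2:ℝ) ≤ n := by exact_mod_cast hn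
    linarith
  have hc : |inner ℝ x y| ≤ 1 := by
    have := abs_real_inner_le_norm x y
    rwa [hx, hy, one_mul] at this
  have hcos := Real.cos_arccos (neg_le_of_abs_le hc) (le_of_abs_le hc)
  set θ := Real.arccos (inner ℝ x y) with hθ
  have h := D_bound hU he hω heω θ
  have hnx : ‖cx e ω θ‖ = 1 := cx_norm he hω heω _ _ (by nlinarith [Real.sin_sq_add_cos_sq θ])
  have e1 : ∫ g, (U (act g x) - U (act g y))^2 ∂og n = ∫ g, (U (act g (cx e ω θ)) - U (act g e))^2 ∂og n := by
    refine og_inv2 (by rw [hnx, hx]) (by rw [hy, he]) ?_ (fun a b => (U a - U b)^2)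
    have e2 := cx_inner he hω heω (Real.cos θ) (Real.sin θ) 1 0
    simp only [one_smul, zero_smul, add_zero, mul_one, mul_zero] at e2
    unfold cx
    rw [e2, hcos]
  have e3 : ‖x - y‖^2 = 2 - 2*Real.cos θ := by
    rw [norm_sub_sq_real, hx, hy, hcos]; ring
  rw [e1, e3]
  refine h.trans_eq ?_
  rw [← hT]
  congr 1
  field_simp

set_option maxHeartbeats 1000000 in
lemma claimC {n : ℕ} (hn : 2 ≤ n) {U : V n → ℝ} (hU : ContDiff ℝ (⊤ : ℕ∞) U) {p : ℝ → ℝ} (hp : Continuous p)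
    (hp0 : ∀ s, 0 ≤ s → s ≤ 4 → 0 ≤ p s) :
    ∫ x, ∫ y, p (‖x-y‖^2) * (U x - U y)^2 ∂sph n ∂sph n ≤
      (∫ x, ∫ y, p (‖x-y‖^2) * ‖x-y‖^2 ∂sph n ∂sph n) * ((∫ w, ‖tg U w‖^2 ∂sph n) / (NN n * (n-1))) := by
  have hUc := hU.continuous
  set a := (∫ w, ‖tg U w‖^2 ∂sph n) / (NN n * (n-1)) with ha
  have hinv : ∀ g : OG n, ∫ x, ∫ y, p (‖x-y‖^2) * (U (act g x) - U (act g y))^2 ∂sph n ∂sph n = ∫ x, ∫ y, p (‖x-y‖^2) * (U x - U y)^2 ∂sph n ∂sph n := by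
    intro g
    obtain ⟨h, hh⟩ := act_iso g
    simp_rw [← hh]
    have e1 : ∀ x y, ‖x - y‖ = ‖h x - h y‖ := by intro x y; rw [← map_sub, h.norm_map]
    calc ∫ x, ∫ y, p (‖x-y‖^2) * (U (h x) - U (h y))^2 ∂sph n ∂sph n
        = ∫ x, ∫ y, p (‖h x-h y‖^2) * (U (h x) - U (h y))^2 ∂sph n ∂sph n := by simp_rw [← e1]
      _ = ∫ x, (∫ y, p (‖h x-y‖^2) * (U (h x) - U y)^2 ∂sph n) ∂sph n := by
          congr 1; ext x
          exact sph_comp h (fun y => p (‖h x-y‖^2) * (U (h x) - U y)^2)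
      _ = _ := sph_comp h (fun x => ∫ y, p (‖x-y‖^2) * (U x - U y)^2 ∂sph n)
  have hc : Continuous (fun z : OG n × (V n × V n) => p (‖z.2.1-z.2.2‖^2) * (U (act z.1 z.2.1) - U (act z.1 z.2.2))^2) := by
    have a1 := act_comp_cont (Y := OG n × (V n × V n)) continuous_fst (continuous_fst.comp continuous_snd)
    have a2 := act_comp_cont (Y := OG n × (V n × V n)) continuous_fst (continuous_snd.comp continuous_snd)
    have a3 : Continuous (fun z : OG n × (V n × V n) => p (‖z.2.1-z.2.2‖^2)) := by fun_prop
    exact a3.mul (((hUc.comp a1).sub (hUc.comp a2)).pow 2)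
  have hcg : ∀ g : OG n, Continuous (fun z : V n × V n => p (‖z.1-z.2‖^2) * (U (act g z.1) - U (act g z.2))^2) := fun g =>
    Continuous.comp (f := fun z : V n × V n => (g, z)) (g := fun z : OG n × (V n × V n) => p (‖z.2.1-z.2.2‖^2) * (U (act z.1 z.2.1) - U (act z.1 z.2.2))^2) hc (continuous_const.prodMk continuous_id)
  have hc2 : Continuous (fun z : V n × V n => p (‖z.1-z.2‖^2) * ‖z.1-z.2‖^2) := by fun_prop
  have hprod : ∀ g : OG n, ∫ z, p (‖z.1-z.2‖^2) * (U (act g z.1) - U (act g z.2))^2 ∂((sph n).prod (sph n)) = ∫ x, ∫ y, p (‖x-y‖^2) * (U x - U y)^2 ∂sph n ∂sph n := by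
    intro g
    rw [← hinv g]
    exact integral_prod _ (s2_integrable (hcg g))
  have hsw := integral_integral_swap (f := fun (g : OG n) (z : V n × V n) => p (‖z.1-z.2‖^2) * (U (act g z.1) - U (act g z.2))^2) (og_s2_int hc)
  simp_rw [hprod] at hsw
  rw [integral_const, probReal_univ, one_smul] at hsw
  rw [hsw, ← integral_prod _ (s2_integrable hc2), ← integral_mul_const]
  refine integral_mono_ae ?_ ((s2_integrable hc2).mul_const a) ?_
  · exact (og_s2_int hc).integral_prod_right
  · filter_upwards [s2_ae' n] with z hz
    have hle : ‖z.1 - z.2‖ ≤ 2 := by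
      have := norm_sub_le z.1 z.2
      rw [hz.1, hz.2] at this; linarith
    have hpz : 0 ≤ p (‖z.1-z.2‖^2) := hp0 _ (by positivity) (by nlinarith [norm_nonneg (z.1-z.2)])
    rw [integral_const_mul, mul_assoc]
    exact mul_le_mul_of_nonneg_left (D_bound2 hn hU hz.1 hz.2) hpz

lemma iter_int {n : ℕ} {f : V n → V n → ℝ} (hf : Continuous (fun z : V n × V n => f z.1 z.2)) :
    Integrable (fun x => ∫ y, f x y ∂sph n) (sph n) := (s2_integrable hf).integral_prod_left

lemma poincare {n : ℕ} (hn : 2 ≤ n) {U : V n → ℝ} (hU : ContDiff ℝ (⊤ : ℕ∞) U) (h0 : ∫ x, U x ∂sph n = 0) :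
    (n-1) * ∫ x, U x^2 ∂sph n ≤ ∫ w, ‖tg U w‖^2 ∂sph n := by
  have hUc := hU.continuous
  have hn0 : 0 < n := by omega
  have hN := NN_pos hn0
  have hn1 : (0:ℝ) < n - 1 := by
    have : (2:ℝ) ≤ n := by exact_mod_cast hn
    linarith
  have h := claimC hn hU (p := fun _ => 1) continuous_const (fun _ _ _ => zero_le_one)
  have hU1 : Integrable U (sph n) := sph_integrable hUc.continuousOn
  have hU2 : Integrable (fun x => U x^2) (sph n) := sph_integrable (hUc.pow 2).continuousOn
  have e1 : ∫ x, ∫ y, 1 * (U x - U y)^2 ∂sph n ∂sph n = 2 * NN n * ∫ x, U x^2 ∂sph n := by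
    have : ∀ x, ∫ y, 1 * (U x - U y)^2 ∂sph n = NN n * U x^2 + ∫ y, U y^2 ∂sph n := by
      intro x
      have : ∀ y, 1 * (U x - U y)^2 = (U x^2 - 2*U x * U y) + U y^2 := by intro y; ring
      simp_rw [this]
      rw [integral_add (f := fun y => U x^2 - 2*U x * U y) (((integrable_const _).sub (hU1.const_mul _))) hU2, integral_sub (integrable_const _) (hU1.const_mul _), integral_const,
        integral_const_mul, h0]
      simp [NN]
    simp_rw [this]
    rw [integral_add (hU2.const_mul _) (integrable_const _), integral_const_mul, integral_const]
    simp only [smul_eq_mul]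
    change _ + NN n * _ = _
    ring
  have e2 : ∫ x, ∫ y, 1 * ‖x-y‖^2 ∂sph n ∂sph n = 2 * NN n^2 := by
    have k1 : ∀ x : V n, ‖x‖ = 1 → ∫ y, 1 * ‖x-y‖^2 ∂sph n = 2 * NN n - 2 * inner ℝ x (∫ y, y ∂sph n) := by
      intro x hx
      have hid : Integrable (fun y : V n => y) (sph n) := by
        refine Integrable.of_bound continuous_id.aestronglyMeasurable 1 ?_
        filter_upwards [sph_norm (n := n)] with y hy using hy.le
      have : ∫ y, 1 * ‖x-y‖^2 ∂sph n = ∫ y, (2 - 2 * inner ℝ x y) ∂sph n := by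
        refine sph_congr fun y hy => ?_
        rw [norm_sub_sq_real, hx, hy]; ring
      rw [this, integral_sub (integrable_const _) ((hid.const_inner x).const_mul _), integral_const, integral_const_mul, integral_inner hid]
      simp [NN]; ring
    have k2 : ∫ y, y ∂sph n = 0 := by
      have := (sph_mp (LinearIsometryEquiv.neg ℝ (E := V n))).integral_comp (LinearIsometryEquiv.neg ℝ (E := V n)).toHomeomorph.measurableEmbedding (fun y => y)
      simp only [LinearIsometryEquiv.coe_neg] at this
      rw [integral_neg (f := fun y : V n => y)] at this
      have h2 : (2:ℝ) • ∫ y, y ∂sph n = 0 := by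
        rw [two_smul]; nth_rewrite 1 [← this]; simp
      exact (smul_eq_zero.1 h2).resolve_left two_ne_zero
    rw [sph_congr k1, k2]
    simp [NN]; ring
  simp only [e1, e2] at h
  have : 2 * NN n^2 * ((∫ w, ‖tg U w‖^2 ∂sph n) / (NN n * (n-1))) = 2 * NN n * ((∫ w, ‖tg U w‖^2 ∂sph n) / (n-1)) := by field_simp
  rw [this] at h
  have h3 := le_of_mul_le_mul_left h (by positivity)
  rwa [le_div_iff₀ hn1, mul_comm] at h3


def JJ {n : ℕ} (K : V n → ℝ) (E : Set (V n)) : ℝ := ∫ w in E, ∫ w' in E, K (w - w')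

open Classical in
lemma fub {n : ℕ} {S : Set (V n × V n)} (hS : MeasurableSet S) {E : Set (V n)} (hE : MeasurableSet E) (hfin : volume E ≠ ⊤)
    {K : V n → ℝ} (hK : Integrable K) :
    Integrable (fun z => K z * volume.real {w | w ∈ E ∧ (w, z) ∈ S}) ∧
    Integrable (fun w => ∫ z, S.indicator (fun _ => (1:ℝ)) (w, z) * K z) (volume.restrict E) ∧
    ∫ w in E, ∫ z, S.indicator (fun _ => (1:ℝ)) (w, z) * K z = ∫ z, K z * volume.real {w | w ∈ E ∧ (w, z) ∈ S} := by
  have hfm : IsFiniteMeasure (volume.restrict E) := ⟨by rw [Measure.restrict_apply_univ]; exact hfin.lt_top⟩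
  have hintg : Integrable (fun q : V n × V n => S.indicator (fun _ => (1:ℝ)) q * K q.2) ((volume.restrict E).prod volume) := by
    have h1 : Integrable (fun q : V n × V n => K q.2) ((volume.restrict E).prod volume) := by
      have := (integrable_const (1:ℝ) (μ := volume.restrict E)).mul_prod hK
      simpa using this
    refine h1.bdd_mul (c := 1) (measurable_const.indicator hS).aestronglyMeasurable (ae_of_all _ fun q => ?_)
    rw [Set.indicator_apply]; split_ifs <;> simp
  have hz : ∀ z, ∫ w in E, S.indicator (fun _ => (1:ℝ)) (w, z) * K z = K z * volume.real {w | w ∈ E ∧ (w, z) ∈ S} := by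
    intro z
    have hSz : MeasurableSet {w | (w,z) ∈ S} := (measurable_id.prodMk measurable_const) hS
    rw [integral_mul_const, mul_comm]
    congr 1
    have : (fun w => S.indicator (fun _ => (1:ℝ)) (w, z)) = {w | (w,z) ∈ S}.indicator 1 := by
      ext w; simp [Set.indicator]
    rw [this, integral_indicator_one hSz, measureReal_restrict_apply hSz]
    congr 1; ext w; simp [and_comm]
  refine ⟨?_, hintg.integral_prod_left, ?_⟩
  · have := hintg.integral_prod_right
    simpa only [hz] using this
  · rw [integral_integral_swap (f := fun w z => S.indicator (fun _ => (1:ℝ)) (w, z) * K z) hintg]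
    simp_rw [hz]

open Classical in
lemma JJ_eq {n : ℕ} {E : Set (V n)} (hE : MeasurableSet E) (hfin : volume E ≠ ⊤) {K : V n → ℝ} (hK : Integrable K) :
    JJ K E = ∫ z, K z * volume.real {w | w ∈ E ∧ w - z ∈ E} := by
  have hS : MeasurableSet {q : V n × V n | q.1 - q.2 ∈ E} := (measurable_fst.sub measurable_snd) hE
  have := (fub hS hE hfin hK).2.2
  refine Eq.trans ?_ this
  unfold JJ
  congr 1; ext w
  rw [← integral_indicator hE]
  have e := integral_sub_left_eq_self (fun w' => E.indicator (fun w' => K (w - w')) w') volume w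
  rw [← e]
  congr 1; ext z
  simp only [Set.indicator_apply, Set.mem_setOf_eq, sub_sub_cancel]
  split_ifs <;> simp

lemma hyper_null {n : ℕ} {z : V n} (hz : z ≠ 0) : volume {w : V n | ‖w - z‖ = ‖w‖} = 0 := by
  -- preimage of a point under nonzero functional
  have h1 : {w : V n | ‖w - z‖ = ‖w‖} ⊆ (fun w => w - (2:ℝ)⁻¹ • z) ⁻¹' ((ℝ ∙ z)ᗮ : Submodule ℝ (V n)) := by
    intro w hw
    simp only [Set.mem_setOf_eq] at hw
    have h2 : ‖w - z‖^2 = ‖w‖^2 := by rw [hw]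
    rw [norm_sub_sq_real] at h2
    simp only [Set.mem_preimage, SetLike.mem_coe]
    rw [Submodule.mem_orthogonal_singleton_iff_inner_left, inner_sub_left, inner_smul_left, real_inner_self_eq_norm_sq]
    simp; linarith
  refine measure_mono_null h1 ?_
  rw [(measurePreserving_sub_right volume ((2:ℝ)⁻¹ • z)).measure_preimage (Submodule.closed_of_finiteDimensional _).measurableSet.nullMeasurableSet]
  apply Measure.addHaar_submodule
  intro h
  rw [Submodule.orthogonal_eq_top_iff] at h
  exact hz (Submodule.span_singleton_eq_bot.1 h)

lemma v_ne_zero {n : ℕ} (hn : 0 < n) : ∀ᵐ w : V n, w ≠ 0 := by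
  have : Nontrivial (V n) := by
    have : Nonempty (Fin n) := ⟨⟨0, hn⟩⟩
    infer_instance
  have h := measure_singleton (μ := (volume : Measure (V n))) 0
  rw [ae_iff]; simpa using h

lemma v_norm_ne {n : ℕ} (hn : 0 < n) {r : ℝ} (hr : r ≠ 0) : ∀ᵐ w : V n, ‖w‖ ≠ r := by
  have := Measure.addHaar_sphere_of_ne_zero (volume : Measure (V n)) 0 hr
  rw [ae_iff]
  convert this using 2
  ext w; simp

lemma meas_T {n : ℕ} {E : Set (V n)} (hE : MeasurableSet E) :
    MeasurableSet {q : V n × V n | q.1 - q.2 ∈ E} := (measurable_fst.sub measurable_snd) hE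

lemma meas_lt (n : ℕ) : MeasurableSet {q : V n × V n | ‖q.1 - q.2‖ < ‖q.1‖} :=
  measurableSet_lt (f := fun q : V n × V n => ‖q.1 - q.2‖) (g := fun q => ‖q.1‖) (by fun_prop) (by fun_prop)

def kap {n : ℕ} (K : V n → ℝ) (w : V n) : ℝ := ∫ z, {q : V n × V n | ‖q.1 - q.2‖ < ‖q.1‖}.indicator (fun _ => (1:ℝ)) (w, z) * K z

lemma JJ_split {n : ℕ} (hn : 0 < n) {E : Set (V n)} (hE : MeasurableSet E) (hfin : volume E ≠ ⊤) {K : V n → ℝ} (hK : Integrable K)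
    (heven : ∀ᵐ z, K (-z) = K z) :
    JJ K E = 2 * (∫ w in E, kap K w) - 2 * ∫ z, K z * volume.real {w | w ∈ E ∧ w - z ∉ E ∧ ‖w - z‖ < ‖w‖} := by
  have hEz : ∀ z, MeasurableSet {w | w - z ∈ E} := fun z => (measurable_id.sub measurable_const) hE
  have hlz : ∀ z : V n, MeasurableSet {w : V n | ‖w - z‖ < ‖w‖} := fun z =>
    measurableSet_lt (f := fun w : V n => ‖w - z‖) (g := fun w => ‖w‖) (by fun_prop) (by fun_prop)
  have hfin' : ∀ T : Set (V n), volume {w | w ∈ E ∧ w ∈ T} ≠ ⊤ := fun T => ne_top_of_le_ne_top hfin (measure_mono fun w hw => hw.1)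
  rw [JJ_eq hE hfin hK]
  set b : V n → ℝ := fun z => volume.real {w | w ∈ E ∧ w - z ∈ E ∧ ‖w - z‖ < ‖w‖} with hb
  have hI1 := (fub ((meas_T hE).inter (meas_lt n)) hE hfin hK).1
  have hI2 := (fub ((meas_T hE).compl.inter (meas_lt n)) hE hfin hK).1
  have hI3 := fub (meas_lt n) hE hfin hK
  have hsplit : ∀ z, z ≠ 0 → volume.real {w | w ∈ E ∧ w - z ∈ E} = b z + b (-z) := by
    intro z hz
    have e1 : b (-z) = volume.real {w | w ∈ E ∧ w - z ∈ E ∧ ‖w‖ < ‖w - z‖} := by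
      have : {w | w ∈ E ∧ w - z ∈ E ∧ ‖w‖ < ‖w - z‖} = (fun w => w - z) ⁻¹' {w | w ∈ E ∧ w - (-z) ∈ E ∧ ‖w - (-z)‖ < ‖w‖} := by
        ext w; simp; tauto
      rw [this]
      unfold Measure.real
      have hm : MeasurableSet {w | w ∈ E ∧ w - -z ∈ E ∧ ‖w - -z‖ < ‖w‖} := hE.inter ((hEz (-z)).inter (hlz (-z)))
      rw [(measurePreserving_sub_right volume z).measure_preimage hm.nullMeasurableSet]
      rfl
    rw [e1]
    have hlz' : MeasurableSet {w : V n | ‖w‖ < ‖w - z‖} :=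
      measurableSet_lt (f := fun w : V n => ‖w‖) (g := fun w => ‖w-z‖) (by fun_prop) (by fun_prop)
    have hd : Disjoint {w | w ∈ E ∧ w - z ∈ E ∧ ‖w - z‖ < ‖w‖} {w | w ∈ E ∧ w - z ∈ E ∧ ‖w‖ < ‖w - z‖} := by
      rw [Set.disjoint_left]; intro w h1 h2; exact absurd h1.2.2 (not_lt.2 h2.2.2.le)
    rw [hb]
    simp only
    rw [← measureReal_union hd (hE.inter ((hEz z).inter hlz')) (hfin' _) (hfin' _)]
    apply measureReal_congr
    have hnull := hyper_null hz
    have : ∀ᵐ w : V n, ‖w - z‖ ≠ ‖w‖ := by rw [ae_iff]; simpa using hnull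
    filter_upwards [this] with w hw
    apply propext
    change (w ∈ E ∧ w - z ∈ E) ↔ (w ∈ E ∧ w - z ∈ E ∧ ‖w - z‖ < ‖w‖) ∨ (w ∈ E ∧ w - z ∈ E ∧ ‖w‖ < ‖w - z‖)
    rcases lt_or_gt_of_ne hw with h | h <;> tauto
  have hI1' : Integrable (fun z => K z * b z) := hI1
  have hI1n : Integrable (fun z => K z * b (-z)) := by
    refine (hI1'.comp_neg).congr ?_
    filter_upwards [heven] with z hz
    rw [hz]
  have s1 : ∫ z, K z * volume.real {w | w ∈ E ∧ w - z ∈ E} = 2 * ∫ z, K z * b z := by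
    have : ∫ z, K z * volume.real {w | w ∈ E ∧ w - z ∈ E} = ∫ z, (K z * b z + K z * b (-z)) := by
      apply integral_congr_ae
      filter_upwards [v_ne_zero hn] with z hz
      simp only [hsplit z hz, mul_add]
    rw [this, integral_add hI1' hI1n]
    have h2 : ∫ z, K z * b (-z) = ∫ z, K z * b z := by
      rw [← integral_neg_eq_self (fun z => K z * b z)]
      apply integral_congr_ae
      filter_upwards [heven] with z hz
      rw [hz]
    rw [h2]; ring
  rw [s1]
  have s2 : ∀ z, b z = volume.real {w | w ∈ E ∧ ‖w - z‖ < ‖w‖} - volume.real {w | w ∈ E ∧ w - z ∉ E ∧ ‖w - z‖ < ‖w‖} := by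
    intro z
    rw [eq_sub_iff_add_eq]
    have hd : Disjoint {w | w ∈ E ∧ w - z ∈ E ∧ ‖w - z‖ < ‖w‖} {w | w ∈ E ∧ w - z ∉ E ∧ ‖w - z‖ < ‖w‖} := by
      rw [Set.disjoint_left]; intro w h1 h2; exact h2.2.1 h1.2.1
    rw [hb]
    simp only
    rw [← measureReal_union hd (hE.inter ((hEz z).compl.inter (hlz z))) (hfin' _) (hfin' _)]
    congr 1
    ext w
    simp only [Set.mem_union, Set.mem_setOf_eq]; tauto
  simp_rw [s2, mul_sub]
  have hI3a : Integrable (fun z => K z * volume.real {w | w ∈ E ∧ ‖w - z‖ < ‖w‖}) := hI3.1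
  have hI2a : Integrable (fun z => K z * volume.real {w | w ∈ E ∧ w - z ∉ E ∧ ‖w - z‖ < ‖w‖}) := hI2
  have hI3b : ∫ w in E, kap K w = ∫ z, K z * volume.real {w | w ∈ E ∧ ‖w - z‖ < ‖w‖} := hI3.2.2
  rw [integral_sub hI3a hI2a, hI3b]
  ring

lemma kap_rot {n : ℕ} {K : V n → ℝ} (hrot : ∀ g : V n ≃ₗᵢ[ℝ] V n, ∀ᵐ z, K (g z) = K z) {x y : V n} (h : ‖x‖ = ‖y‖) :
    kap K x = kap K y := by
  obtain ⟨g, hg⟩ := exists_rot h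
  unfold kap
  rw [← g.measurePreserving.integral_comp g.toHomeomorph.measurableEmbedding (fun z => {q : V n × V n | ‖q.1 - q.2‖ < ‖q.1‖}.indicator (fun _ => (1:ℝ)) (y, z) * K z)]
  apply integral_congr_ae
  filter_upwards [hrot g] with z hz
  rw [hz]
  congr 1
  simp only [Set.indicator_apply, Set.mem_setOf_eq]
  rw [← hg, ← map_sub, g.norm_map, g.norm_map]


def om {n : ℕ} (z : V n) : ℝ := (√|1-‖z‖/2|)⁻¹

lemma om_nonneg {n : ℕ} (z : V n) : 0 ≤ om z := by unfold om; positivity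

def MM (n : ℕ) (δ : ℝ) : Set (V n × V n) := {q | |‖q.1‖ - 1| ≤ δ ∧ |inner ℝ q.1 (‖q.2‖⁻¹ • q.2) - ‖q.2‖/2| ≤ δ}

lemma MM_meas (n : ℕ) (δ : ℝ) : MeasurableSet (MM n δ) :=
  (measurableSet_le (f := fun q : V n × V n => |‖q.1‖ - 1|) (g := fun _ => δ) (by fun_prop) (by fun_prop)).inter
  (measurableSet_le (f := fun q : V n × V n => |inner ℝ q.1 (‖q.2‖⁻¹ • q.2) - ‖q.2‖/2|) (g := fun _ => δ) (by fun_prop) (by fun_prop))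

lemma MM_vol {d : ℕ} (hd : 0 < d) : ∃ C : ℝ, 0 < C ∧ ∀ δ, 0 < δ → δ ≤ 1/8 → ∀ z : V (d+1), z ≠ 0 → ‖z‖ ≠ 2 →
    volume {w | (w,z) ∈ MM (d+1) δ} ≤ ENNReal.ofReal (C * δ^2 * om z) := by
  obtain ⟨C, hC, h⟩ := S_lemma hd
  refine ⟨C, hC, fun δ h1 h2 z hz hz2 => ?_⟩
  have h0 : ‖z‖ ≠ 0 := norm_ne_zero_iff.2 hz
  exact h (‖z‖⁻¹ • z) (by rw [norm_smul, norm_inv, norm_norm, inv_mul_cancel₀ h0]) (‖z‖/2) δ (by positivity) (by intro h; apply hz2; linarith) h1 h2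

lemma lt_iff_inner {n : ℕ} {w z : V n} (hz : z ≠ 0) : ‖w - z‖ < ‖w‖ ↔ ‖z‖/2 < inner ℝ w (‖z‖⁻¹ • z) := by
  have h0 : 0 < ‖z‖ := norm_pos_iff.2 hz
  rw [inner_smul_right, ← sq_lt_sq₀ (norm_nonneg _) (norm_nonneg _), norm_sub_sq_real]
  rw [← mul_lt_mul_iff_right₀ h0 (b := ‖z‖/2), mul_inv_cancel_left₀ h0.ne']
  constructor <;> intro h <;> nlinarith

open Classical in
lemma kap_diff {n : ℕ} (hn : 0 < n) {K : V n → ℝ} (hK : Integrable K) (hK0 : ∀ z, 0 ≤ K z)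
    (hrot : ∀ g : V n ≃ₗᵢ[ℝ] V n, ∀ᵐ z, K (g z) = K z) {δ : ℝ} {w e : V n} (he : ‖e‖ = 1) (hw0 : w ≠ 0) (hw : |‖w‖ - 1| ≤ δ) :
    |kap K w - kap K e| ≤ ∫ z, (MM n δ).indicator (fun _ => (1:ℝ)) (w, z) * K z := by
  obtain ⟨x, hx, hwx⟩ := vnorm_decomp hw0
  rw [kap_rot hrot (x := e) (y := x) (by rw [he, hx])]
  have hintg : ∀ (S : Set (V n × V n)), MeasurableSet S → ∀ v : V n, Integrable (fun z => S.indicator (fun _ => (1:ℝ)) (v, z) * K z) := by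
    intro S hS v
    refine hK.bdd_mul (c := 1) ((measurable_const.indicator hS).comp (measurable_const.prodMk measurable_id)).aestronglyMeasurable (ae_of_all _ fun q => ?_)
    rw [Set.indicator_apply]; split_ifs <;> simp
  unfold kap
  rw [← integral_sub (hintg _ (meas_lt n) w) (hintg _ (meas_lt n) x), ← Real.norm_eq_abs]
  refine norm_integral_le_of_norm_le (hintg _ (MM_meas n δ) w) ?_
  filter_upwards [v_ne_zero hn] with z hz
  rw [← sub_mul, norm_mul, Real.norm_of_nonneg (hK0 z)]
  refine mul_le_mul_of_nonneg_right ?_ (hK0 z)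
  have hz1 : ‖‖z‖⁻¹ • z‖ = 1 := by rw [norm_smul, norm_inv, norm_norm, inv_mul_cancel₀ (norm_ne_zero_iff.2 hz)]
  have hb : |inner ℝ x (‖z‖⁻¹ • z)| ≤ 1 := by
    have := abs_real_inner_le_norm x (‖z‖⁻¹ • z)
    rwa [hx, hz1, one_mul] at this
  have hwi : inner ℝ w (‖z‖⁻¹ • z) = ‖w‖ * inner ℝ x (‖z‖⁻¹ • z) := by
    conv_lhs => rw [hwx]
    rw [inner_smul_left]; simp
  have hd : |inner ℝ w (‖z‖⁻¹ • z) - inner ℝ x (‖z‖⁻¹ • z)| ≤ δ := by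
    rw [hwi, show ‖w‖ * inner ℝ x (‖z‖⁻¹ • z) - inner ℝ x (‖z‖⁻¹ • z) = (‖w‖-1) * inner ℝ x (‖z‖⁻¹ • z) by ring, abs_mul]
    calc _ ≤ δ * 1 := mul_le_mul hw hb (abs_nonneg _) ((abs_nonneg _).trans hw)
      _ = δ := mul_one _
  simp only [Set.indicator_apply, Set.mem_setOf_eq, lt_iff_inner hz]
  by_cases h1 : ‖z‖/2 < inner ℝ w (‖z‖⁻¹ • z) <;> by_cases h2 : ‖z‖/2 < inner ℝ x (‖z‖⁻¹ • z)
  · simp only [h1, h2, if_true, sub_self, norm_zero]; split_ifs <;> simp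
  · have hm : (w, z) ∈ MM n δ := by
      refine ⟨hw, ?_⟩
      simp only
      rw [abs_le] at hd ⊢
      constructor <;> linarith [hd.1, hd.2]
    simp [h1, h2, hm]
  · have hm : (w, z) ∈ MM n δ := by
      refine ⟨hw, ?_⟩
      simp only
      rw [abs_le] at hd ⊢
      constructor <;> linarith [hd.1, hd.2]
    simp [h1, h2, hm]
  · simp only [h1, h2, if_false, sub_self, norm_zero]; split_ifs <;> simp

open Classical in
lemma LL_shell {n : ℕ} (hn : 0 < n) {C t : ℝ} {u : V n → ℝ} {E R} (h : NB C t u E R) (hC : C * |t| ≤ 1/8) {δ : ℝ} (hδ : C * |t| ≤ δ)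
    {f : V n → ℝ} (hf : IntegrableOn f E) (hf' : IntegrableOn f (ball 0 1)) (hf'' : IntegrableOn f {w | |‖w‖ - 1| ≤ δ}) :
    |LL E f| ≤ ∫ w in {w : V n | |‖w‖ - 1| ≤ δ}, |f w| := by
  have hS : MeasurableSet {w : V n | |‖w‖ - 1| ≤ δ} := measurableSet_le (f := fun w : V n => |‖w‖ - 1|) (g := fun _ => δ) (by fun_prop) (by fun_prop)
  unfold LL
  rw [← integral_indicator h.meas, ← integral_indicator measurableSet_ball, ← integral_indicator hS,
    ← integral_sub (hf.integrable_indicator h.meas) (hf'.integrable_indicator measurableSet_ball), ← Real.norm_eq_abs]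
  refine norm_integral_le_of_norm_le ((integrable_indicator_iff hS).2 hf''.abs) ?_
  filter_upwards [v_ne_zero hn] with w hw
  have h1 := nb_mem h hw
  have hx : ‖‖w‖⁻¹ • w‖ = 1 := by rw [norm_smul, norm_inv, norm_norm, inv_mul_cancel₀ (norm_ne_zero_iff.2 hw)]
  have h2 := abs_le.1 (h.near _ hx)
  simp only [Set.indicator_apply, mem_ball_zero_iff, Set.mem_setOf_eq]
  have key : ¬ (w ∈ E ↔ ‖w‖ < 1) → |‖w‖ - 1| ≤ δ := by
    intro hk
    rw [h1] at hk
    rw [abs_le]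
    by_cases h3 : ‖w‖ < 1
    · have : ¬ ‖w‖ < R (‖w‖⁻¹ • w) := fun h => hk (by tauto)
      constructor <;> linarith [h2.1, h2.2]
    · have : ‖w‖ < R (‖w‖⁻¹ • w) := by by_contra h; exact hk (by tauto)
      constructor <;> linarith [h2.1, h2.2]
  by_cases a1 : w ∈ E <;> by_cases a2 : ‖w‖ < 1
  · simp only [a1, a2, if_true, sub_self, norm_zero]; split_ifs <;> positivity
  · have := key (by tauto); simp [a1, a2, this]
  · have := key (by tauto); simp [a1, a2, this]
  · simp only [a1, a2, if_false, sub_self, norm_zero]; split_ifs <;> positivity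

lemma tau_sub {n : ℕ} {C t : ℝ} (hC0 : 0 ≤ C) {u : V n → ℝ} {E R} (h : NB C t u E R) (hC : C * |t| ≤ 1/24) {z : V n} (hz : z ≠ 0)
    {w : V n} (hw0 : w ≠ 0) (hw0' : w - z ≠ 0) (hw : w ∈ E) (hw' : w - z ∉ E) (hlt : ‖w - z‖ < ‖w‖) : (w, z) ∈ MM n (3 * (C * |t|)) := by
  set m := C * |t| with hm
  have hm0 : 0 ≤ m := by positivity
  have hz0 : 0 < ‖z‖ := norm_pos_iff.2 hz
  rw [nb_mem h hw0] at hw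
  rw [nb_mem h hw0', not_lt] at hw'
  have hx : ‖‖w‖⁻¹ • w‖ = 1 := by rw [norm_smul, norm_inv, norm_norm, inv_mul_cancel₀ (norm_ne_zero_iff.2 hw0)]
  have hy : ‖‖w - z‖⁻¹ • (w - z)‖ = 1 := by rw [norm_smul, norm_inv, norm_norm, inv_mul_cancel₀ (norm_ne_zero_iff.2 hw0')]
  have n1 := abs_le.1 (h.near _ hx)
  have n2 := abs_le.1 (h.near _ hy)
  have l := le_of_abs_le (h.lip _ _ hx hy)
  rw [← hm] at n1 n2 l
  set a := ‖w‖ with ha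
  set b := ‖w - z‖ with hb
  have ha1 : a ≤ 25/24 := by linarith
  have hb1 : 23/24 ≤ b := by linarith
  have hbz : a - b ≤ ‖z‖ := by
    have := norm_sub_norm_le w (w - z)
    simpa [← ha, ← hb] using this
  have hdist : b * ‖a⁻¹ • w - b⁻¹ • (w - z)‖ ≤ 2 * ‖z‖ := by
    have hb0 : 0 < b := by linarith
    have ha0 : 0 < a := by linarith
    have e : b • (a⁻¹ • w - b⁻¹ • (w - z)) = (b - a) • (a⁻¹ • w) + z := by
      rw [smul_sub, sub_smul, smul_smul b b⁻¹, mul_inv_cancel₀ hb0.ne', smul_smul a a⁻¹, mul_inv_cancel₀ ha0.ne']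
      simp only [one_smul]; abel
    have : ‖b • (a⁻¹ • w - b⁻¹ • (w - z))‖ ≤ (a - b) * 1 + ‖z‖ := by
      rw [e]
      refine (norm_add_le _ _).trans ?_
      rw [norm_smul, hx, Real.norm_eq_abs, abs_of_neg (by linarith)]; linarith
    rw [norm_smul, Real.norm_of_nonneg hb0.le] at this
    linarith
  have hd2 : ‖a⁻¹ • w - b⁻¹ • (w - z)‖ ≤ 48/23 * ‖z‖ := by
    have h0 := norm_nonneg (a⁻¹ • w - b⁻¹ • (w - z))
    have := mul_le_mul_of_nonneg_right hb1 h0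
    linarith
  have hab : a - b ≤ m * (48/23 * ‖z‖) := by
    have := mul_le_mul_of_nonneg_left hd2 hm0
    linarith
  refine ⟨?_, ?_⟩
  · simp only
    rw [abs_le]; constructor <;> linarith
  · simp only
    have hin : a^2 - b^2 = 2 * inner ℝ w z - ‖z‖^2 := by
      rw [hb, norm_sub_sq_real, ← ha]; ring
    have e2 : inner ℝ w (‖z‖⁻¹ • z) - ‖z‖/2 = (a^2-b^2) / (2*‖z‖) := by
      rw [hin, inner_smul_right]; field_simp
    rw [e2, abs_of_nonneg (by apply div_nonneg _ (by positivity); nlinarith), div_le_iff₀ (by positivity)]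
    have hp : a^2 - b^2 = (a-b)*(a+b) := by ring
    rw [hp]
    have : (a-b)*(a+b) ≤ (m * (48/23 * ‖z‖)) * (25/12) := mul_le_mul hab (by linarith) (by linarith) (by positivity)
    have h5 : 0 ≤ m * ‖z‖ := by positivity
    nlinarith

lemma shell_fin (n : ℕ) (δ : ℝ) : volume {w : V n | |‖w‖ - 1| ≤ δ} ≠ ⊤ := by
  refine ne_top_of_le_ne_top (measure_closedBall_lt_top (x := (0 : V n)) (r := 1+δ)).ne (measure_mono fun w hw => ?_)
  rw [mem_closedBall_zero_iff]
  have hw' : |‖w‖ - 1| ≤ δ := hw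
  have := (abs_le.1 hw').2
  linarith

lemma LL_sub_const {n : ℕ} {E : Set (V n)} (hvol : volume E = volume (ball (0 : V n) 1)) {f : V n → ℝ}
    (hf : IntegrableOn f E) (hf' : IntegrableOn f (ball 0 1)) (c : ℝ) :
    LL E (fun w => f w - c) = LL E f := by
  have hb : volume (ball (0 : V n) 1) ≠ ⊤ := measure_ball_lt_top.ne
  unfold LL
  rw [integral_sub hf (integrableOn_const (by rw [hvol]; exact hb)), integral_sub hf' (integrableOn_const hb)]
  simp only [integral_const, measureReal_restrict_apply_univ]
  unfold Measure.real
  rw [hvol]; ring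

lemma claimA {d : ℕ} (hd : 0 < d) {C : ℝ} (hC : 0 < C) : ∃ C' : ℝ, 0 < C' ∧ ∀ (t : ℝ) (u : V (d+1) → ℝ) (E : Set (V (d+1))) (R : V (d+1) → ℝ),
    NB C t u E R → t ≠ 0 → C * |t| ≤ 1/24 → volume E = volume (ball (0 : V (d+1)) 1) →
    ∀ K : V (d+1) → ℝ, Integrable K → (∀ z, 0 ≤ K z) → (∀ g : V (d+1) ≃ₗᵢ[ℝ] V (d+1), ∀ᵐ z, K (g z) = K z) →
    Integrable (fun z => K z * om z) → |JJ K E - JJ K (ball 0 1)| ≤ C' * t^2 * ∫ z, K z * om z := by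
  obtain ⟨C1, hC1, hM⟩ := MM_vol hd
  refine ⟨2 * (C1 * 9 * C^2) + 2 * (C1 * 9 * C^2), by positivity, ?_⟩
  intro t u E R h ht hCt hvol K hK hK0 hrot hKo
  have hn : 0 < d+1 := by omega
  have htp : 0 < |t| := abs_pos.2 ht
  set δ := 3 * (C * |t|) with hδ
  have hδ0 : 0 < δ := by positivity
  have hδ1 : δ ≤ 1/8 := by rw [hδ]; linarith
  have hδ2 : δ^2 = 9 * C^2 * t^2 := by rw [hδ, mul_pow, mul_pow, sq_abs]; ring
  have heven : ∀ᵐ z, K (-z) = K z := by simpa using hrot (LinearIsometryEquiv.neg ℝ)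
  have hbfin : volume (ball (0 : V (d+1)) 1) ≠ ⊤ := measure_ball_lt_top.ne
  have hEfin : volume E ≠ ⊤ := by rw [hvol]; exact hbfin
  have hMv : ∀ᵐ z : V (d+1), volume.real {w | (w,z) ∈ MM (d+1) δ} ≤ C1 * δ^2 * om z := by
    filter_upwards [v_ne_zero hn, v_norm_ne hn (two_ne_zero)] with z h1 h2
    exact ENNReal.toReal_le_of_le_ofReal (by have := om_nonneg z; positivity) (hM δ hδ0 hδ1 z h1 h2)
  have hMfin : ∀ z : V (d+1), volume {w | (w,z) ∈ MM (d+1) δ} ≠ ⊤ := fun z =>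
    ne_top_of_le_ne_top (shell_fin (d+1) δ) (measure_mono fun w hw => hw.1)
  have hI : ∫ z, K z * (C1 * δ^2 * om z) = C1 * δ^2 * ∫ z, K z * om z := by
    rw [← integral_const_mul]; congr 1; ext z; ring
  have hIi : Integrable (fun z => K z * (C1 * δ^2 * om z)) := by
    refine (hKo.const_mul (C1 * δ^2)).congr (ae_of_all _ fun z => ?_); simp only; ring
  -- tau bounds
  have hE := JJ_split hn h.meas hEfin hK heven
  have hB := JJ_split hn measurableSet_ball hbfin hK heven
  have hτB : ∫ z, K z * volume.real {w | w ∈ ball (0 : V (d+1)) 1 ∧ w - z ∉ ball (0 : V (d+1)) 1 ∧ ‖w - z‖ < ‖w‖} = 0 := by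
    have : ∀ z, {w | w ∈ ball (0 : V (d+1)) 1 ∧ w - z ∉ ball (0 : V (d+1)) 1 ∧ ‖w - z‖ < ‖w‖} = ∅ := by
      intro z; ext w
      simp only [mem_ball_zero_iff, Set.mem_setOf_eq, Set.mem_empty_iff_false, iff_false, not_and]
      intro h1 h2 h3; exact h2 (h3.trans h1)
    simp only [this, measureReal_empty, mul_zero, integral_zero]
  have hτ0 : 0 ≤ ∫ z, K z * volume.real {w | w ∈ E ∧ w - z ∉ E ∧ ‖w - z‖ < ‖w‖} :=
    integral_nonneg fun z => mul_nonneg (hK0 z) measureReal_nonneg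
  have hτ1 : ∫ z, K z * volume.real {w | w ∈ E ∧ w - z ∉ E ∧ ‖w - z‖ < ‖w‖} ≤ C1 * δ^2 * ∫ z, K z * om z := by
    rw [← hI]
    refine integral_mono_ae ?_ hIi ?_
    · exact (fub ((meas_T h.meas).compl.inter (meas_lt (d+1))) h.meas hEfin hK).1
    · filter_upwards [hMv, v_ne_zero hn] with z hz hz0
      refine mul_le_mul_of_nonneg_left (le_trans ?_ hz) (hK0 z)
      unfold Measure.real
      refine ENNReal.toReal_mono (hMfin z) ?_
      apply measure_mono_ae
      have hne : ∀ᵐ w : V (d+1), w - z ≠ 0 := by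
        have := (measurePreserving_sub_right (volume : Measure (V (d+1))) z).quasiMeasurePreserving.ae (v_ne_zero hn)
        exact this
      filter_upwards [v_ne_zero hn, hne] with w hw hwz
      intro ⟨a1, a2, a3⟩
      exact tau_sub hC.le h hCt hz0 hw hwz a1 a2 a3
  -- kappa
  have hkE : IntegrableOn (kap K) E := (fub (meas_lt (d+1)) h.meas hEfin hK).2.1
  have hkB : IntegrableOn (kap K) (ball 0 1) := (fub (meas_lt (d+1)) measurableSet_ball hbfin hK).2.1
  have hS : MeasurableSet {w : V (d+1) | |‖w‖ - 1| ≤ δ} := measurableSet_le (f := fun w : V (d+1) => |‖w‖ - 1|) (g := fun _ => δ) (by fun_prop) (by fun_prop)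
  have hkS : IntegrableOn (kap K) {w | |‖w‖ - 1| ≤ δ} := (fub (meas_lt (d+1)) hS (shell_fin _ _) hK).2.1
  let e : V (d+1) := EuclideanSpace.single 0 1
  have he : ‖e‖ = 1 := by simp [e]
  have hL : |LL E (kap K)| ≤ C1 * δ^2 * ∫ z, K z * om z := by
    rw [← LL_sub_const hvol hkE hkB (kap K e)]
    have hc1 : IntegrableOn (fun _ : V (d+1) => kap K e) E := integrableOn_const hEfin
    have hc2 : IntegrableOn (fun _ : V (d+1) => kap K e) (ball 0 1) := integrableOn_const hbfin
    have hc3 : IntegrableOn (fun _ : V (d+1) => kap K e) {w | |‖w‖ - 1| ≤ δ} := integrableOn_const (shell_fin _ _)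
    have l1 := LL_shell hn h (by linarith) (δ := δ) (by rw [hδ]; linarith [mul_pos hC htp]) (f := fun w => kap K w - kap K e) (hkE.sub hc1) (hkB.sub hc2) (hkS.sub hc3)
    refine l1.trans ?_
    have f3 := fub (MM_meas (d+1) δ) hS (shell_fin _ _) hK
    calc ∫ w in {w : V (d+1) | |‖w‖ - 1| ≤ δ}, |kap K w - kap K e|
        ≤ ∫ w in {w : V (d+1) | |‖w‖ - 1| ≤ δ}, ∫ z, (MM (d+1) δ).indicator (fun _ => (1:ℝ)) (w, z) * K z := by
          refine integral_mono_ae (hkS.sub hc3).abs f3.2.1 ?_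
          filter_upwards [ae_restrict_mem hS, ae_restrict_of_ae (v_ne_zero hn)] with w hw hw0
          exact kap_diff hn hK hK0 hrot he hw0 hw
      _ = _ := f3.2.2
      _ ≤ ∫ z, K z * (C1 * δ^2 * om z) := by
          refine integral_mono_ae f3.1 hIi ?_
          filter_upwards [hMv] with z hz
          refine mul_le_mul_of_nonneg_left (le_trans ?_ hz) (hK0 z)
          exact ENNReal.toReal_mono (hMfin z) (measure_mono fun w hw => hw.2)
      _ = _ := hI
  have hfin : JJ K E - JJ K (ball 0 1) = 2 * LL E (kap K) - 2 * ∫ z, K z * volume.real {w | w ∈ E ∧ w - z ∉ E ∧ ‖w - z‖ < ‖w‖} := by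
    rw [hE, hB, hτB]; unfold LL; ring
  rw [hfin]
  rw [hδ2] at hL hτ1
  rw [abs_le] at hL ⊢
  constructor <;> linarith [hL.1, hL.2]


structure TB (p p' : ℝ → ℝ) (M : ℝ) : Prop where
  cont : Continuous p
  cont' : Continuous p'
  nonneg : 0 ≤ M
  b0 : ∀ s, 0 ≤ s → s ≤ 16 → |p s| ≤ M
  b1 : ∀ s, 0 ≤ s → s ≤ 16 → |p' s| ≤ M
  lip : ∀ s r, 0 ≤ s → s ≤ 16 → 0 ≤ r → r ≤ 16 → |p s - p r| ≤ M * |s - r|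
  tay : ∀ s r, 0 ≤ s → s ≤ 16 → 0 ≤ r → r ≤ 16 → |p s - p r - p' r * (s - r)| ≤ M * (s - r)^2

lemma tb_poly (P : Polynomial ℝ) : ∃ M, TB (fun s => P.eval s) (fun s => P.derivative.eval s) M := by
  have hc : ∀ Q : Polynomial ℝ, ∃ C, 0 ≤ C ∧ ∀ s, 0 ≤ s → s ≤ 16 → |Q.eval s| ≤ C := by
    intro Q
    obtain ⟨C, hC⟩ := (isCompact_Icc (a := (0:ℝ)) (b := 16)).exists_bound_of_continuousOn Q.continuous.continuousOn
    refine ⟨C, (norm_nonneg _).trans (hC 0 (by norm_num)), fun s h1 h2 => hC s ⟨h1, h2⟩⟩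
  have hl : ∀ Q : Polynomial ℝ, ∀ C, (∀ s, 0 ≤ s → s ≤ 16 → |Q.derivative.eval s| ≤ C) →
      ∀ s r, 0 ≤ s → s ≤ 16 → 0 ≤ r → r ≤ 16 → |Q.eval s - Q.eval r| ≤ C * |s - r| := by
    intro Q C hC s r h1 h2 h3 h4
    have := Convex.norm_image_sub_le_of_norm_hasDerivWithin_le (f := fun s => Q.eval s) (f' := fun s => Q.derivative.eval s) (C := C)
      (s := Set.Icc 0 16) (fun x _ => (Q.hasDerivAt x).hasDerivWithinAt) (fun x hx => hC x hx.1 hx.2) (convex_Icc _ _)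
      (⟨h3, h4⟩ : r ∈ Set.Icc (0:ℝ) 16) (⟨h1, h2⟩ : s ∈ Set.Icc (0:ℝ) 16)
    simpa [Real.norm_eq_abs] using this
  obtain ⟨C0, h0, hC0⟩ := hc P
  obtain ⟨C1, h1, hC1⟩ := hc P.derivative
  obtain ⟨C2, h2, hC2⟩ := hc P.derivative.derivative
  have hM : 0 ≤ C0 + C1 + C2 := by positivity
  refine ⟨C0 + C1 + C2, P.continuous, P.derivative.continuous, hM, ?_, ?_, ?_, ?_⟩
  · intro s a b; have := hC0 s a b; linarith
  · intro s a b; have := hC1 s a b; linarith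
  · intro s r a b c d
    refine (hl P C1 hC1 s r a b c d).trans ?_
    gcongr; linarith
  · intro s r a b c d
    have hsub : ∀ x ∈ Set.uIcc r s, 0 ≤ x ∧ x ≤ 16 ∧ |x - r| ≤ |s - r| := by
      intro x hx
      have h1 := Set.abs_sub_left_of_mem_uIcc hx
      rw [Set.mem_uIcc] at hx
      refine ⟨by rcases hx with h | h <;> linarith [h.1], by rcases hx with h | h <;> linarith [h.2], ?_⟩
      exact h1
    have := Convex.norm_image_sub_le_of_norm_hasDerivWithin_le (f := fun x => P.eval x - P.derivative.eval r * x)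
      (f' := fun x => P.derivative.eval x - P.derivative.eval r * 1) (C := C2 * |s - r|)
      (s := Set.uIcc r s) (fun x _ => ((P.hasDerivAt x).sub ((hasDerivAt_id x).const_mul _)).hasDerivWithinAt)
      (fun x hx => ?_) (convex_uIcc _ _) Set.left_mem_uIcc Set.right_mem_uIcc
    · rw [Real.norm_eq_abs, Real.norm_eq_abs, mul_assoc, abs_mul_abs_self] at this
      have e : P.eval s - P.eval r - P.derivative.eval r * (s - r) = P.eval s - P.derivative.eval r * s - (P.eval r - P.derivative.eval r * r) := by ring
      rw [e]
      refine this.trans ?_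
      rw [sq]
      have := mul_self_nonneg (s - r)
      gcongr; linarith
    · obtain ⟨q1, q2, q3⟩ := hsub x hx
      rw [mul_one, Real.norm_eq_abs]
      exact (hl P.derivative C2 hC2 x r q1 q2 c d).trans (by gcongr)

lemma L0 {n : ℕ} (hn : 0 < n) (C : ℝ) (hC0 : 0 ≤ C) : ∃ C' : ℝ, 0 < C' ∧ ∀ (t : ℝ) (u : V n → ℝ) (E : Set (V n)) (R : V n → ℝ),
    NB C t u E R → C * |t| ≤ 1/8 → ∀ (K : ℝ) (F : V n → ℝ), Continuous F → 0 ≤ K →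
    (∀ w, ‖w‖ ≤ 9/8 → |F w| ≤ K) → |LL E F| ≤ C' * K * |t| := by
  obtain ⟨c, hc, hp⟩ := pow_near (n-1)
  have hN := NN_pos hn
  refine ⟨c * (C + 1) * NN n, by positivity, ?_⟩
  intro t u E R h hCt K F hF hK hb
  rw [nb_L hn h hCt hF]
  have := sph_abs_le (n := n) (F := fun x => ∫ ρ in (1:ℝ)..R x, ρ^(n-1) * F (ρ • x)) (C := (c * K) * (C * |t|)) ?_
  · refine this.trans ?_
    have h1 := abs_nonneg t
    have : 0 ≤ c * K * |t| * NN n := by positivity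
    nlinarith
  · intro x hx
    have hR := h.near x hx
    have := intervalIntegral.norm_integral_le_of_norm_le_const (a := 1) (b := R x) (f := fun ρ => ρ^(n-1) * F (ρ • x)) (C := c * K) ?_
    · rw [Real.norm_eq_abs] at this
      exact this.trans (by gcongr)
    · intro ρ hρ
      have h1 := Set.abs_sub_left_of_mem_uIcc (Set.uIoc_subset_uIcc hρ)
      have h2 : |ρ - 1| ≤ 1/8 := by linarith
      rw [norm_mul, Real.norm_eq_abs, Real.norm_eq_abs]
      refine mul_le_mul (hp ρ h2).2 (hb _ ?_) (abs_nonneg _) (by linarith)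
      rw [norm_smul, hx, mul_one, Real.norm_eq_abs]
      have := abs_le.1 h2
      rw [abs_le]; constructor <;> linarith

lemma set_int_cont {n : ℕ} {E : Set (V n)} (hE : MeasurableSet E) {r : ℝ} (hr : E ⊆ closedBall 0 r) {f : V n → V n → ℝ}
    (hf : Continuous (Function.uncurry f)) : Continuous (fun w => ∫ w' in E, f w w') := by
  have := continuous_parametric_integral_of_continuous (μ := volume.restrict E) hf (isCompact_closedBall (0 : V n) r)
  rw [Measure.restrict_restrict isClosed_closedBall.measurableSet, Set.inter_eq_right.2 hr] at this
  exact this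

lemma cont_intOn {n : ℕ} {E : Set (V n)} {r : ℝ} (hr : E ⊆ closedBall 0 r) {f : V n → ℝ} (hf : Continuous f) : IntegrableOn f E :=
  (hf.continuousOn.integrableOn_compact (isCompact_closedBall 0 r)).mono_set hr

lemma JJ_LL {n : ℕ} {E : Set (V n)} (hE : MeasurableSet E) (hr : E ⊆ closedBall 0 (9/8)) {K : V n → ℝ} (hK : Continuous K)
    (hev : ∀ z, K (-z) = K z) :
    JJ K E - JJ K (ball 0 1) = LL E (fun w => LL E (fun w' => K (w - w'))) + 2 * LL E (fun w => ∫ w' in ball (0 : V n) 1, K (w - w')) := by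
  have hbr : ball (0 : V n) 1 ⊆ closedBall 0 (9/8) := (ball_subset_ball (by norm_num)).trans ball_subset_closedBall
  have hKc : Continuous (Function.uncurry fun w w' : V n => K (w - w')) := by unfold Function.uncurry; fun_prop
  have ha := set_int_cont hE hr hKc
  have hv := set_int_cont measurableSet_ball hbr hKc
  have hsw : ∫ w in ball (0 : V n) 1, ∫ w' in E, K (w - w') = ∫ w in E, ∫ w' in ball (0 : V n) 1, K (w - w') := by
    have hfE : volume E ≠ ⊤ := ne_top_of_le_ne_top (measure_closedBall_lt_top (x := (0 : V n)) (r := 9/8)).ne (measure_mono hr)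
    have : IsFiniteMeasure (volume.restrict E) := ⟨by simpa using hfE.lt_top⟩
    have : IsFiniteMeasure (volume.restrict (ball (0 : V n) 1)) := ⟨by simpa using measure_ball_lt_top⟩
    rw [integral_integral_swap]
    · congr 1; ext w; congr 1; ext w'
      rw [← hev, neg_sub]
    · refine integrable_of_cpt (K := closedBall 0 (9/8) ×ˢ closedBall 0 (9/8)) ((isCompact_closedBall _ _).prod (isCompact_closedBall _ _)) ?_ hKc
      have h1 := (Measure.quasiMeasurePreserving_fst (μ := volume.restrict (ball (0 : V n) 1)) (ν := volume.restrict E)).ae (ae_restrict_mem measurableSet_ball)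
      have h2 := (Measure.quasiMeasurePreserving_snd (μ := volume.restrict (ball (0 : V n) 1)) (ν := volume.restrict E)).ae (ae_restrict_mem hE)
      filter_upwards [h1, h2] with z hz1 hz2
      exact ⟨hbr hz1, hr hz2⟩
  unfold JJ LL
  rw [integral_sub (cont_intOn hr ha) (cont_intOn hr hv), integral_sub (cont_intOn hbr ha) (cont_intOn hbr hv), hsw]
  ring


def qq {n : ℕ} (p : ℝ → ℝ) (z : V n) : ℝ := p (‖z‖^2)

lemma qq_cont {n : ℕ} {p : ℝ → ℝ} (hp : Continuous p) : Continuous (qq (n := n) p) := by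
  unfold qq; fun_prop

lemma qq_dist {n : ℕ} {x y : V n} {a b : ℝ} (hx : ‖x‖ ≤ a) (hy : ‖y‖ ≤ b) (hab : a + b ≤ 4) : 0 ≤ ‖x - y‖^2 ∧ ‖x - y‖^2 ≤ 16 := by
  have := norm_sub_le x y
  have h0 := norm_nonneg (x - y)
  exact ⟨by positivity, by nlinarith⟩

def kapp {n : ℕ} (p' : ℝ → ℝ) (x : V n) : ℝ := ∫ y in ball (0 : V n) 1, p' (‖x - y‖^2) * (2 - 2 * inner ℝ x y)

lemma ball_rot {n : ℕ} (g : V n ≃ₗᵢ[ℝ] V n) (f : V n → ℝ) : ∫ y in ball (0 : V n) 1, f (g y) = ∫ y in ball (0 : V n) 1, f y := by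
  have := g.measurePreserving.setIntegral_preimage_emb g.toHomeomorph.measurableEmbedding f (ball (0 : V n) 1)
  rw [← this]
  congr 2
  ext y; simp

lemma kapp_rot {n : ℕ} (p' : ℝ → ℝ) {x y : V n} (h : ‖x‖ = ‖y‖) : kapp p' x = kapp p' y := by
  obtain ⟨g, hg⟩ := exists_rot h
  unfold kapp
  rw [← ball_rot g (fun z => p' (‖y - z‖^2) * (2 - 2 * inner ℝ y z))]
  congr 1; ext z
  rw [← hg, ← map_sub, g.norm_map, g.inner_map_map]

lemma vv_rot {n : ℕ} (p : ℝ → ℝ) {x y : V n} (h : ‖x‖ = ‖y‖) :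
    ∫ z in ball (0 : V n) 1, qq p (x - z) = ∫ z in ball (0 : V n) 1, qq p (y - z) := by
  obtain ⟨g, hg⟩ := exists_rot h
  rw [← ball_rot g (fun z => qq p (y - z))]
  congr 1; ext z
  unfold qq
  rw [← hg, ← map_sub, g.norm_map]

lemma vv_exp {n : ℕ} {p p' : ℝ → ℝ} {M : ℝ} (h : TB p p' M) {x : V n} (hx : ‖x‖ = 1) {ρ : ℝ} (hρ : |ρ - 1| ≤ 1/8) :
    |(∫ z in ball (0 : V n) 1, qq p (ρ • x - z)) - (∫ z in ball (0 : V n) 1, qq p (x - z)) - kapp p' x * (ρ - 1)| ≤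
      26 * M * volume.real (ball (0 : V n) 1) * (ρ - 1)^2 := by
  have hbr : ball (0 : V n) 1 ⊆ closedBall 0 1 := ball_subset_closedBall
  have hc1 : Continuous fun z => qq p (ρ • x - z) := (qq_cont h.cont).comp (continuous_const.sub continuous_id)
  have hc2 : Continuous fun z => qq p (x - z) := (qq_cont h.cont).comp (continuous_const.sub continuous_id)
  have hcp := h.cont'
  have hc3 : Continuous fun y : V n => p' (‖x - y‖^2) * (2 - 2 * inner ℝ x y) := by fun_prop
  have hM := h.nonneg
  unfold kapp
  rw [← integral_mul_const, ← integral_sub (cont_intOn hbr hc1) (cont_intOn hbr hc2),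
    ← integral_sub (f := fun z => qq p (ρ • x - z) - qq p (x - z)) (cont_intOn hbr (hc1.sub hc2)) ((cont_intOn hbr hc3).mul_const _), ← Real.norm_eq_abs]
  refine (norm_setIntegral_le_of_norm_le_const measure_ball_lt_top (C := 26 * M * (ρ - 1)^2) ?_).trans (le_of_eq (by ring))
  intro y hy
  have hy1 : ‖y‖ ≤ 1 := (mem_ball_zero_iff.1 hy).le
  have hρ' := abs_le.1 hρ
  have hρx : ‖ρ • x‖ ≤ 9/8 := by
    rw [norm_smul, hx, mul_one, Real.norm_eq_abs, abs_le]; constructor <;> linarith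
  obtain ⟨a1, a2⟩ := qq_dist hρx hy1 (by norm_num)
  obtain ⟨b1, b2⟩ := qq_dist hx.le hy1 (by norm_num)
  have hin : |inner ℝ x y| ≤ 1 := by
    have := abs_real_inner_le_norm x y
    rw [hx, one_mul] at this; linarith
  have hin' := abs_le.1 hin
  have hA : ‖ρ • x - y‖^2 - ‖x - y‖^2 = (ρ - 1) * (ρ + 1 - 2 * inner ℝ x y) := by
    rw [norm_sub_sq_real, norm_sub_sq_real, inner_smul_left, norm_smul, hx]
    simp; ring
  have h1 := h.tay _ _ a1 a2 b1 b2
  have h2 := h.b1 _ b1 b2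
  have h3 : (‖ρ • x - y‖^2 - ‖x - y‖^2)^2 ≤ 25 * (ρ - 1)^2 := by
    rw [hA, mul_pow]
    have : (ρ + 1 - 2 * inner ℝ x y)^2 ≤ 25 := by
      have : |ρ + 1 - 2 * inner ℝ x y| ≤ 5 := by rw [abs_le]; constructor <;> linarith
      rw [← sq_abs]; nlinarith [abs_nonneg (ρ + 1 - 2 * inner ℝ x y)]
    nlinarith [sq_nonneg (ρ - 1)]
  have e : qq p (ρ • x - y) - qq p (x - y) - p' (‖x - y‖^2) * (2 - 2 * inner ℝ x y) * (ρ - 1) =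
      (p (‖ρ • x - y‖^2) - p (‖x - y‖^2) - p' (‖x - y‖^2) * (‖ρ • x - y‖^2 - ‖x - y‖^2)) + p' (‖x - y‖^2) * (ρ - 1)^2 := by
    rw [hA]; unfold qq; ring
  have e2 : ‖qq p (ρ • x - y) - qq p (x - y) - p' (‖x - y‖^2) * (2 - 2 * inner ℝ x y) * (ρ - 1)‖ ≤ 26 * M * (ρ - 1)^2 := by
    rw [e, Real.norm_eq_abs]
    refine (abs_add_le _ _).trans ?_
    rw [abs_mul, abs_of_nonneg (sq_nonneg (ρ - 1))]
    have q1 : M * (‖ρ • x - y‖^2 - ‖x - y‖^2)^2 ≤ M * (25 * (ρ - 1)^2) := by gcongr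
    have q2 : |p' (‖x - y‖^2)| * (ρ - 1)^2 ≤ M * (ρ - 1)^2 := by gcongr
    linarith
  exact e2

lemma kapp_le {n : ℕ} {p p' : ℝ → ℝ} {M : ℝ} (h : TB p p' M) {x : V n} (hx : ‖x‖ = 1) :
    |kapp p' x| ≤ 26 * M * volume.real (ball (0 : V n) 1) := by
  have hM := h.nonneg
  rw [kapp, ← Real.norm_eq_abs]
  refine norm_setIntegral_le_of_norm_le_const measure_ball_lt_top ?_
  intro y hy
  have hy1 : ‖y‖ ≤ 1 := (mem_ball_zero_iff.1 hy).le
  obtain ⟨b1, b2⟩ := qq_dist hx.le hy1 (by norm_num)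
  have h2 := h.b1 _ b1 b2
  have hin : |inner ℝ x y| ≤ 1 := by
    have := abs_real_inner_le_norm x y
    rw [hx, one_mul] at this; linarith
  have hin' := abs_le.1 hin
  rw [norm_mul, Real.norm_eq_abs, Real.norm_eq_abs]
  have : |2 - 2 * inner ℝ x y| ≤ 4 := by rw [abs_le]; constructor <;> linarith
  calc _ ≤ M * 4 := mul_le_mul h2 this (abs_nonneg _) hM
    _ ≤ _ := by linarith

/-- increments of the kernel in the radial direction -/
lemma qq_inc {n : ℕ} {p p' : ℝ → ℝ} {M : ℝ} (h : TB p p' M) {w x y : V n} (hx : ‖x‖ ≤ 9/8) (hy : ‖y‖ ≤ 9/8) (hw : ‖w‖ ≤ 9/8) :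
    |qq p (w - x) - qq p (w - y)| ≤ 5 * M * ‖x - y‖ := by
  have hM := h.nonneg
  obtain ⟨a1, a2⟩ := qq_dist hw hx (by norm_num)
  obtain ⟨b1, b2⟩ := qq_dist hw hy (by norm_num)
  refine (h.lip _ _ a1 a2 b1 b2).trans ?_
  have h1 : |‖w - x‖ - ‖w - y‖| ≤ ‖x - y‖ := by
    refine (abs_norm_sub_norm_le _ _).trans (le_of_eq ?_)
    have e0 : w - x - (w - y) = y - x := by abel
    rw [e0, norm_sub_rev]
  have e : ‖w - x‖^2 - ‖w - y‖^2 = (‖w - x‖ - ‖w - y‖) * (‖w - x‖ + ‖w - y‖) := by ring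
  rw [e, abs_mul, abs_of_nonneg (by positivity : 0 ≤ ‖w - x‖ + ‖w - y‖)]
  have h2 := norm_sub_le w x
  have h3 := norm_sub_le w y
  have : |‖w - x‖ - ‖w - y‖| * (‖w - x‖ + ‖w - y‖) ≤ ‖x - y‖ * 5 := by
    gcongr; linarith
  nlinarith

lemma rho_norm {n : ℕ} {x : V n} (hx : ‖x‖ = 1) {ρ : ℝ} (hρ : |ρ - 1| ≤ 1/8) : ‖ρ • x‖ ≤ 9/8 ∧ ‖ρ • x - x‖ = |ρ - 1| := by
  constructor
  · have := abs_le.1 hρ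
    rw [norm_smul, hx, mul_one, Real.norm_eq_abs, abs_le]; constructor <;> linarith
  · have : ρ • x - x = (ρ - 1) • x := by module
    rw [this, norm_smul, hx, mul_one, Real.norm_eq_abs]


lemma LL_add {n : ℕ} {E : Set (V n)} (hr : E ⊆ closedBall 0 (9/8)) {f g : V n → ℝ} (hf : Continuous f) (hg : Continuous g) (a : ℝ) :
    LL E f = LL E (fun w => f w - a * g w) + a * LL E g := by
  have hbr : ball (0 : V n) 1 ⊆ closedBall 0 (9/8) := (ball_subset_ball (by norm_num)).trans ball_subset_closedBall
  unfold LL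
  rw [integral_sub (cont_intOn hr hf) (cont_intOn hr (hg.const_mul a)), integral_sub (cont_intOn hbr hf) (cont_intOn hbr (hg.const_mul a)),
    integral_const_mul, integral_const_mul]
  ring

lemma claimB0 {n : ℕ} (hn : 0 < n) {p p' : ℝ → ℝ} {M : ℝ} (h : TB p p' M) {e : V n} (he : ‖e‖ = 1) {C : ℝ} (hC0 : 0 ≤ C)
    {u : V n → ℝ} (hu : Continuous u) : ∃ C' : ℝ, 0 < C' ∧ ∀ (t : ℝ) (E : Set (V n)) (R : V n → ℝ),
    NB C t u E R → C * |t| ≤ 1/8 → |t| ≤ 1 → volume E = volume (ball (0 : V n) 1) →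
    |JJ (qq p) E - JJ (qq p) (ball (0 : V n) 1) - t^2 * (kapp p' e * (∫ x, u x^2 ∂(sph n)) +
      ∫ x, (∫ y, qq p (x - y) * u y ∂(sph n)) * u x ∂(sph n))| ≤ C' * |t|^3 := by
  have hM := h.nonneg
  have hN := NN_pos hn
  obtain ⟨C0, hC0p, hL0⟩ := L0 hn C hC0
  obtain ⟨C1, hC1p, hL1⟩ := L1 hn C hC0
  obtain ⟨C2, hC2p, hL2⟩ := L2 hn C hC0
  obtain ⟨Ku, hKu⟩ := (isCompact_sphere (0 : V n) 1).exists_bound_of_continuousOn hu.continuousOn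
  have hKu0 : 0 ≤ Ku := (norm_nonneg _).trans (hKu e (by simpa using he))
  have hKu' : ∀ x : V n, ‖x‖ = 1 → |u x| ≤ Ku := fun x hx => hKu x (by simpa using hx)
  set B := volume.real (ball (0 : V n) 1) with hB
  have hB0 : 0 ≤ B := measureReal_nonneg
  refine ⟨C0 * (C1 * (5 * M)) + C1 * (5 * M * Ku * NN n) + 2 * (C2 * (26 * M * B)) + 1, by positivity, ?_⟩
  intro t E R hE hCt ht hvol
  have hr := nb_sub' hE hCt
  have hbr : ball (0 : V n) 1 ⊆ closedBall 0 (9/8) := (ball_subset_ball (by norm_num)).trans ball_subset_closedBall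
  have hqc := qq_cont (n := n) h.cont
  have hq2 : Continuous (Function.uncurry fun w w' : V n => qq p (w - w')) := by unfold Function.uncurry; fun_prop
  rw [JJ_LL hE.meas hr hqc (fun z => by simp [qq])]
  have hv := set_int_cont measurableSet_ball hbr hq2
  have hlc : Continuous (fun w => LL E (fun w' => qq p (w - w'))) := (set_int_cont hE.meas hr hq2).sub hv
  have hF1 : Continuous (fun w => ∫ y, qq p (w - y) * u y ∂(sph n)) := by
    refine sph_int_cont (F := fun w y => qq p (w - y) * u y) ?_
    unfold Function.uncurry; fun_prop
  -- the potential of the ball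
  have hvL := hL2 t u E R hE hCt ht hu.continuousOn hvol (26 * M * B) (kapp p' e) (∫ z in ball (0 : V n) 1, qq p (e - z)) _ hv
    (by positivity) (kapp_le h he) (by
      intro x hx ρ hρ
      have := vv_exp h hx hρ
      rwa [vv_rot p (hx.trans he.symm), kapp_rot p' (hx.trans he.symm)] at this)
  -- the remainder
  have hrem : ∀ w : V n, ‖w‖ ≤ 9/8 → |LL E (fun w' => qq p (w - w')) - t * ∫ y, qq p (w - y) * u y ∂(sph n)| ≤ C1 * (5 * M) * t^2 := by
    intro w hw
    refine hL1 t u E R hE hCt hu.continuousOn (5 * M) _ (hqc.comp (continuous_const.sub continuous_id)) (by positivity) ?_ ?_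
    · intro x hx
      obtain ⟨b1, b2⟩ := qq_dist hw hx.le (by norm_num)
      have := h.b0 _ b1 b2
      have : |qq p (w - x)| ≤ M := this
      have h5 : |qq p (w - x)| ≤ 5 * M := by linarith
      exact h5
    · intro x hx ρ hρ
      obtain ⟨h1, h2⟩ := rho_norm hx hρ
      rw [← h2]
      exact qq_inc h h1 (by rw [hx]; norm_num) hw
  have hremL := hL0 t u E R hE hCt (C1 * (5 * M) * t^2) _ (hlc.sub (hF1.const_mul t)) (by positivity) hrem
  have hF1b : ∀ w x : V n, ‖w‖ ≤ 9/8 → ‖x‖ = 1 → |qq p (w - x)| ≤ M := by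
    intro w x hw hx
    obtain ⟨b1, b2⟩ := qq_dist hw hx.le (by norm_num)
    exact h.b0 _ b1 b2
  have hF1L := hL1 t u E R hE hCt hu.continuousOn (5 * M * Ku * NN n) _ hF1 (by positivity) (by
      intro x hx
      refine (sph_abs_le (C := M * Ku) ?_).trans ?_
      · intro y hy
        rw [abs_mul]
        exact mul_le_mul (hF1b x y (by rw [hx]; norm_num) hy) (hKu' y hy) (abs_nonneg _) hM
      · have : 0 ≤ M * Ku * NN n := by positivity
        linarith) (by
      intro x hx ρ hρ
      obtain ⟨h1, h2⟩ := rho_norm hx hρ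
      have hi : ∀ w : V n, Integrable (fun y => qq p (w - y) * u y) (sph n) := fun w => sph_integrable (F := fun y => qq p (w - y) * u y) (by fun_prop)
      rw [← integral_sub (hi _) (hi _)]
      refine (sph_abs_le (C := 5 * M * |ρ - 1| * Ku) ?_).trans (le_of_eq (by ring))
      intro y hy
      rw [← sub_mul, abs_mul]
      refine mul_le_mul ?_ (hKu' y hy) (abs_nonneg _) (by positivity)
      have e1 : ∀ z, qq p (z - y) = qq p (y - z) := fun z => by unfold qq; rw [norm_sub_rev]
      rw [e1, e1, ← h2]
      exact qq_inc h h1 (by rw [hx]; norm_num) (by rw [hy]; norm_num))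
  rw [LL_add hr hlc hF1 t]
  set a1 := LL E (fun w => LL E (fun w' => qq p (w - w')) - t * ∫ y, qq p (w - y) * u y ∂(sph n))
  set a2 := LL E (fun w => ∫ y, qq p (w - y) * u y ∂(sph n))
  set a3 := LL E (fun w => ∫ w' in ball (0 : V n) 1, qq p (w - w'))
  set b2 := ∫ x, (∫ y, qq p (x - y) * u y ∂(sph n)) * u x ∂(sph n)
  set b3 := ∫ x, u x^2 ∂(sph n)
  have e1 : a1 + t * a2 + 2 * a3 - t^2 * (kapp p' e * b3 + b2) = a1 + t * (a2 - t * b2) + 2 * (a3 - t^2 * (kapp p' e / 2) * b3) := by ring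
  rw [e1]
  have e3 : |t|^3 = |t| * t^2 := by rw [← sq_abs t]; ring
  calc _ ≤ |a1| + |t| * |a2 - t * b2| + 2 * |a3 - t^2 * (kapp p' e / 2) * b3| := by
        refine (abs_add_le _ _).trans (add_le_add ((abs_add_le _ _).trans (le_of_eq ?_)) (le_of_eq ?_))
        · rw [abs_mul]
        · rw [abs_mul, abs_two]
    _ ≤ C0 * (C1 * (5 * M) * t^2) * |t| + |t| * (C1 * (5 * M * Ku * NN n) * t^2) + 2 * (C2 * (26 * M * B) * |t|^3) := 
        add_le_add (add_le_add hremL (mul_le_mul_of_nonneg_left hF1L (abs_nonneg t))) (mul_le_mul_of_nonneg_left hvL (by norm_num))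
    _ = (C0 * (C1 * (5 * M)) + C1 * (5 * M * Ku * NN n) + 2 * (C2 * (26 * M * B))) * |t|^3 := by rw [e3]; ring
    _ ≤ _ := mul_le_mul_of_nonneg_right (by linarith) (pow_nonneg (abs_nonneg t) 3)


lemma sph_dist_rot {n : ℕ} (F : ℝ → ℝ) {x e : V n} (h : ‖x‖ = ‖e‖) :
    ∫ y, F ‖x - y‖ ∂(sph n) = ∫ y, F ‖e - y‖ ∂(sph n) := by
  obtain ⟨g, hg⟩ := exists_rot h
  rw [← sph_comp g (fun y => F ‖e - y‖)]
  congr 1; ext y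
  rw [← hg, ← map_sub, g.norm_map]

lemma JJ_trans {n : ℕ} (K : V n → ℝ) (a : V n) : JJ K {w | ‖w - a‖ < 1} = JJ K (ball 0 1) := by
  have key : ∀ f : V n → ℝ, ∫ w in {w : V n | ‖w - a‖ < 1}, f w = ∫ w in ball (0 : V n) 1, f (w + a) := by
    intro f
    have := (measurePreserving_add_right (volume : Measure (V n)) a).setIntegral_preimage_emb (Homeomorph.addRight a).measurableEmbedding f {w | ‖w - a‖ < 1}
    rw [← this]
    congr 2
    ext w; simp
  unfold JJ
  rw [key]
  congr 1; ext w
  rw [key]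
  congr 1; ext w'
  congr 1; abel

lemma claimB_z {n : ℕ} (hn : 0 < n) {p p' : ℝ → ℝ} {M : ℝ} (h : TB p p' M) {e : V n} (he : ‖e‖ = 1) :
    kapp p' e * (∫ x, (inner ℝ e x)^2 ∂(sph n)) + ∫ x, (∫ y, qq p (x - y) * inner ℝ e y ∂(sph n)) * inner ℝ e x ∂(sph n) = 0 := by
  obtain ⟨C', hC', hb⟩ := claimB0 hn h he (C := 48) (by norm_num) (u := fun x => inner ℝ e x) (by fun_prop)
  set Z := kapp p' e * (∫ x, (inner ℝ e x)^2 ∂(sph n)) + ∫ x, (∫ y, qq p (x - y) * inner ℝ e y ∂(sph n)) * inner ℝ e x ∂(sph n) with hZ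
  have hsm : ∀ t : ℝ, 0 < t → t ≤ 1/400 → |Z| ≤ C' * t := by
    intro t ht0 ht
    have hta : |t| = t := abs_of_pos ht0
    obtain ⟨R, hR⟩ := trans_nb e he.le t (by rw [hta]; linarith)
    have hvol : volume {w : V n | ‖w - t • e‖ < 1} = volume (ball (0 : V n) 1) := by
      have : {w : V n | ‖w - t • e‖ < 1} = ball (t • e) 1 := by ext w; simp [dist_eq_norm]
      rw [this, Measure.addHaar_ball_center]
    have := hb t _ R hR (by rw [hta]; linarith) (by rw [hta]; linarith) hvol
    rw [JJ_trans, sub_self, zero_sub, abs_neg, abs_mul, abs_of_nonneg (sq_nonneg t), hta] at this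
    have h3 : t^2 * |Z| ≤ t^2 * (C' * t) := by linarith [this, (by ring : t^2 * (C' * t) = C' * t^3)]
    exact le_of_mul_le_mul_left h3 (by positivity)
  by_contra hne
  have hZp : 0 < |Z| := abs_pos.2 hne
  have := hsm (min (1/400) (|Z| / (2 * C'))) (by positivity) (min_le_left _ _)
  have h2 : C' * min (1/400) (|Z| / (2 * C')) ≤ C' * (|Z| / (2 * C')) := by gcongr; exact min_le_right _ _
  have h3 : C' * (|Z| / (2 * C')) = |Z| / 2 := by field_simp
  linarith

lemma claimB_kap {n : ℕ} (hn : 0 < n) {p p' : ℝ → ℝ} {M : ℝ} (h : TB p p' M) {e : V n} (he : ‖e‖ = 1) :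
    kapp p' e = - (∫ y, qq p (e - y) ∂(sph n)) + (∫ y, qq p (e - y) * ‖e - y‖^2 ∂(sph n)) / 2 := by
  have hN := NN_pos hn
  have hqc := qq_cont (n := n) h.cont
  have hz : ∀ i : Fin n, kapp p' e * (∫ x, (x i)^2 ∂(sph n)) + ∫ x, (∫ y, qq p (x - y) * (x i * y i) ∂(sph n)) ∂(sph n) = 0 := by
    intro i
    have hi : ‖(EuclideanSpace.single i (1:ℝ) : V n)‖ = 1 := by simp
    have := claimB_z hn h hi
    rw [kapp_rot p' (hi.trans he.symm)] at this
    have e1 : ∀ x : V n, inner ℝ (EuclideanSpace.single i (1:ℝ) : V n) x = x i := by intro x; simp [EuclideanSpace.inner_single_left]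
    simp only [e1] at this
    rw [← this]
    congr 2; ext x
    rw [← integral_mul_const]
    congr 1; ext y; ring
  have hsum := Finset.sum_eq_zero (s := Finset.univ) (fun i _ => hz i)
  rw [Finset.sum_add_distrib, ← Finset.mul_sum, ← integral_finsetSum _ (fun i _ => sph_integrable (F := fun x => (x i)^2) (by fun_prop)),
    ← integral_finsetSum _ (fun i _ => iter_int (f := fun x y => qq p (x - y) * (x i * y i)) (by fun_prop))] at hsum
  have s1 : ∫ x : V n, ∑ i, (x i)^2 ∂(sph n) = NN n := by
    rw [sph_congr (F' := fun _ => 1)]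
    · simp [NN]
    · intro x hx
      have := EuclideanSpace.norm_sq_eq x
      rw [hx] at this
      simpa using this.symm
  have s2 : ∫ x : V n, ∑ i, (∫ y, qq p (x - y) * (x i * y i) ∂(sph n)) ∂(sph n) =
      NN n * ((∫ y, qq p (e - y) ∂(sph n)) - (∫ y, qq p (e - y) * ‖e - y‖^2 ∂(sph n)) / 2) := by
    rw [sph_congr (F' := fun _ => (∫ y, qq p (e - y) ∂(sph n)) - (∫ y, qq p (e - y) * ‖e - y‖^2 ∂(sph n)) / 2)]
    · simp [NN]
    · intro x hx
      rw [← integral_finsetSum _ (fun i _ => sph_integrable (F := fun y => qq p (x - y) * (x i * y i)) (by fun_prop))]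
      have r1 := sph_dist_rot (fun s => p (s^2)) (hx.trans he.symm)
      have r2 := sph_dist_rot (fun s => p (s^2) * s^2) (hx.trans he.symm)
      have r1' : ∫ y, qq p (x - y) ∂(sph n) = ∫ y, qq p (e - y) ∂(sph n) := r1
      have r2' : ∫ y, qq p (x - y) * ‖x - y‖^2 ∂(sph n) = ∫ y, qq p (e - y) * ‖e - y‖^2 ∂(sph n) := r2
      rw [← r1', ← r2', ← integral_div, ← integral_sub (sph_integrable (F := fun y => qq p (x - y)) (by fun_prop)) (sph_integrable (F := fun y => qq p (x - y) * ‖x - y‖^2 / 2) (by fun_prop))]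
      apply sph_congr
      intro y hy
      have hin : inner ℝ x y = ∑ i, x i * y i := by
        rw [PiLp.inner_apply]; apply Finset.sum_congr rfl; intro i _; simp [mul_comm]
      rw [← Finset.mul_sum, ← hin, norm_sub_sq_real, hx, hy]; ring
  rw [s1, s2] at hsum
  have : NN n * (kapp p' e + (∫ y, qq p (e - y) ∂(sph n)) - (∫ y, qq p (e - y) * ‖e - y‖^2 ∂(sph n)) / 2) = 0 := by linarith
  have := (mul_eq_zero.1 this).resolve_left hN.ne'
  linarith

lemma claimB_Q {n : ℕ} {p : ℝ → ℝ} (hp : Continuous p) {e : V n} (he : ‖e‖ = 1) {u : V n → ℝ} (hu : Continuous u) :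
    ∫ x, ∫ y, qq p (x - y) * (u x - u y)^2 ∂(sph n) ∂(sph n) = 2 * ((∫ y, qq p (e - y) ∂(sph n)) * (∫ x, u x^2 ∂(sph n))) -
      2 * ∫ x, (∫ y, qq p (x - y) * u y ∂(sph n)) * u x ∂(sph n) := by
  have hqc := qq_cont (n := n) hp
  have i1 : Integrable (fun x => ∫ y, qq p (x - y) * (u x)^2 ∂(sph n)) (sph n) := iter_int (f := fun x y => qq p (x - y) * (u x)^2) (by fun_prop)
  have i2 : Integrable (fun x => ∫ y, qq p (x - y) * (u y)^2 ∂(sph n)) (sph n) := iter_int (f := fun x y => qq p (x - y) * (u y)^2) (by fun_prop)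
  have i3 : Integrable (fun x => ∫ y, 2 * (qq p (x - y) * u y * u x) ∂(sph n)) (sph n) := iter_int (f := fun x y => 2 * (qq p (x - y) * u y * u x)) (by fun_prop)
  have r : ∀ x : V n, ‖x‖ = 1 → ∫ y, qq p (x - y) ∂(sph n) = ∫ y, qq p (e - y) ∂(sph n) := 
    fun x hx => sph_dist_rot (fun s => p (s^2)) (hx.trans he.symm)
  have j1 : ∫ x, ∫ y, qq p (x - y) * (u x)^2 ∂(sph n) ∂(sph n) = (∫ y, qq p (e - y) ∂(sph n)) * (∫ x, u x^2 ∂(sph n)) := by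
    rw [← integral_const_mul]
    apply sph_congr
    intro x hx
    rw [integral_mul_const, r x hx]
  have j2 : ∫ x, ∫ y, qq p (x - y) * (u y)^2 ∂(sph n) ∂(sph n) = (∫ y, qq p (e - y) ∂(sph n)) * (∫ x, u x^2 ∂(sph n)) := by
    rw [integral_integral_swap (s2_integrable (F := fun z => qq p (z.1 - z.2) * (u z.2)^2) (by fun_prop)), ← j1]
    congr 1; ext x; congr 1; ext y
    unfold qq; rw [norm_sub_rev]
  have j3 : ∫ x, ∫ y, 2 * (qq p (x - y) * u y * u x) ∂(sph n) ∂(sph n) = 2 * ∫ x, (∫ y, qq p (x - y) * u y ∂(sph n)) * u x ∂(sph n) := by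
    rw [← integral_const_mul]
    congr 1; ext x
    rw [integral_const_mul, integral_mul_const]
  rw [← j3]
  have e2 : 2 * ((∫ y, qq p (e - y) ∂(sph n)) * (∫ x, u x^2 ∂(sph n))) = (∫ x, ∫ y, qq p (x - y) * (u x)^2 ∂(sph n) ∂(sph n)) + ∫ x, ∫ y, qq p (x - y) * (u y)^2 ∂(sph n) ∂(sph n) := by
    rw [j1, j2]; ring
  rw [e2, ← integral_add i1 i2, ← integral_sub (f := fun x => (∫ y, qq p (x - y) * (u x)^2 ∂(sph n)) + ∫ y, qq p (x - y) * (u y)^2 ∂(sph n)) (i1.add i2) i3]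
  congr 1; ext x
  have k1 := sph_integrable (n := n) (F := fun y => qq p (x - y) * (u x)^2) (by fun_prop)
  have k2 := sph_integrable (n := n) (F := fun y => qq p (x - y) * (u y)^2) (by fun_prop)
  have k3 := sph_integrable (n := n) (F := fun y => 2 * (qq p (x - y) * u y * u x)) (by fun_prop)
  rw [← integral_add k1 k2, ← integral_sub (f := fun y => qq p (x - y) * (u x)^2 + qq p (x - y) * (u y)^2) (k1.add k2) k3]
  congr 1; ext y; ring

/-- second order expansion of the smooth nonlocal energy -/
lemma claimB {n : ℕ} (hn : 0 < n) {p p' : ℝ → ℝ} {M : ℝ} (h : TB p p' M) {e : V n} (he : ‖e‖ = 1) {C : ℝ} (hC0 : 0 ≤ C)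
    {u : V n → ℝ} (hu : Continuous u) : ∃ C' : ℝ, 0 < C' ∧ ∀ (t : ℝ) (E : Set (V n)) (R : V n → ℝ),
    NB C t u E R → C * |t| ≤ 1/8 → |t| ≤ 1 → volume E = volume (ball (0 : V n) 1) →
    |JJ (qq p) E - JJ (qq p) (ball (0 : V n) 1) - t^2 / 2 * ((∫ y, qq p (e - y) * ‖e - y‖^2 ∂(sph n)) * (∫ x, u x^2 ∂(sph n)) -
      ∫ x, ∫ y, qq p (x - y) * (u x - u y)^2 ∂(sph n) ∂(sph n))| ≤ C' * |t|^3 := by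
  obtain ⟨C', hC', hb⟩ := claimB0 hn h he hC0 hu
  refine ⟨C', hC', ?_⟩
  intro t E R h1 h2 h3 h4
  have := hb t E R h1 h2 h3 h4
  rw [claimB_kap hn h he] at this
  rw [claimB_Q h.cont he hu]
  refine le_of_eq_of_le ?_ this
  congr 1; ring


lemma stab_smooth {n : ℕ} (hn : 2 ≤ n) {U : V n → ℝ} (hU : ContDiff ℝ (⊤ : ℕ∞) U) (h0 : ∫ x, U x ∂sph n = 0)
    {γ : ℝ} (hγ : 0 ≤ γ) {p p' : ℝ → ℝ} {M : ℝ} (h : TB p p' M) (hp0 : ∀ s, 0 ≤ s → s ≤ 16 → 0 ≤ p s) {e : V n} (he : ‖e‖ = 1)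
    (hc : γ * (∫ y, qq p (e - y) * ‖e - y‖^2 ∂(sph n)) ≤ n - 1) {C : ℝ} (hC0 : 0 ≤ C) :
    ∃ C' : ℝ, 0 < C' ∧ ∃ δ : ℝ, 0 < δ ∧ ∀ (t : ℝ) (E : Set (V n)) (R : V n → ℝ), |t| ≤ δ → NB C t U E R →
      C * |t| ≤ 1/8 → volume E = volume (ball (0 : V n) 1) → perimeter E ≠ ⊤ →
      NN n - C' * |t|^3 ≤ P E + γ * (JJ (qq p) E - JJ (qq p) (ball (0 : V n) 1)) := by
  have hn0 : 0 < n := by omega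
  have hN := NN_pos hn0
  have hn1 : (0:ℝ) < n - 1 := by
    have : (2:ℝ) ≤ n := by exact_mod_cast hn
    linarith
  obtain ⟨C1, hC1, δ1, hδ1, hper⟩ := per_lower hn0 hU C hC0
  obtain ⟨C2, hC2, hB⟩ := claimB hn0 h he hC0 hU.continuous
  have hcC := claimC hn hU h.cont (fun s h1 h2 => hp0 s h1 (by linarith))
  have hpo := poincare hn hU h0
  have hD : ∫ x, ∫ y, p (‖x-y‖^2) * ‖x-y‖^2 ∂sph n ∂sph n = (∫ y, qq p (e - y) * ‖e - y‖^2 ∂(sph n)) * NN n := by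
    rw [sph_congr (F' := fun _ => ∫ y, qq p (e - y) * ‖e - y‖^2 ∂(sph n))]
    · simp [NN, mul_comm]
    · intro x hx
      exact sph_dist_rot (fun s => p (s^2) * s^2) (hx.trans he.symm)
  rw [hD] at hcC
  refine ⟨C1 + γ * C2, by positivity, min δ1 1, by positivity, ?_⟩
  intro t E R ht hE hCt hvol hfin
  have e1 := hper t E R (ht.trans (min_le_left _ _)) hE hCt hvol hfin
  have e2 := hB t E R hE hCt (ht.trans (min_le_right _ _)) hvol
  have hcC' : ∫ x, ∫ y, qq p (x - y) * (U x - U y)^2 ∂(sph n) ∂(sph n) ≤ (∫ y, qq p (e - y) * ‖e - y‖^2 ∂(sph n)) * NN n * ((∫ w, ‖tg U w‖^2 ∂sph n) / (NN n * (n-1))) := hcC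
  generalize (∫ x, ∫ y, qq p (x - y) * (U x - U y)^2 ∂(sph n) ∂(sph n)) = Q at e2 hcC'
  generalize (∫ y, qq p (e - y) * ‖e - y‖^2 ∂(sph n)) = c2 at e2 hcC' hc
  generalize (∫ w, ‖tg U w‖^2 ∂sph n) = A at e1 hcC' hpo
  generalize (∫ x, U x^2 ∂sph n) = S at e1 e2 hpo
  generalize JJ (qq p) E - JJ (qq p) (ball (0 : V n) 1) = J at e2 ⊢
  have hQ : Q ≤ c2 * A / (n-1) := by
    refine hcC'.trans (le_of_eq ?_)
    field_simp
  have e3 := (abs_le.1 e2).1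
  have e4 : γ * (t^2/2 * (c2 * S - Q) - C2 * |t|^3) ≤ γ * J := by
    gcongr; linarith
  have key : 0 ≤ (A - (n-1) * S) + γ * (c2 * S - Q) := by
    have q1 : γ * Q ≤ γ * (c2 * A / (n-1)) := by gcongr
    have q2 : 0 ≤ (A - (n-1) * S) * (1 - γ * c2 / (n-1)) := by
      refine mul_nonneg (by linarith) ?_
      rw [sub_nonneg, div_le_one hn1]; exact hc
    have q3 : (A - (n-1) * S) * (1 - γ * c2 / (n-1)) = (A - (n-1) * S) + γ * (c2 * S) - γ * (c2 * A / (n-1)) := by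
      field_simp; ring
    linarith
  have key2 := mul_nonneg (by positivity : 0 ≤ t^2/2) key
  linarith

lemma JJ_add {n : ℕ} {E : Set (V n)} (hE : MeasurableSet E) (hfin : volume E ≠ ⊤) {K K' K'' : V n → ℝ} (hK : Integrable K) (hK' : Integrable K')
    (hK'' : Integrable K'') : JJ (fun z => K z + K' z - K'' z) E = JJ K E + JJ K' E - JJ K'' E := by
  have hS : MeasurableSet {q : V n × V n | q.1 - q.2 ∈ E} := (measurable_fst.sub measurable_snd) hE
  have h1 := (fub hS hE hfin hK).1
  have h2 := (fub hS hE hfin hK').1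
  have h3 := (fub hS hE hfin hK'').1
  have h4 : Integrable (fun z => K z + K' z - K'' z) := (hK.add hK').sub hK''
  rw [JJ_eq hE hfin h4, JJ_eq hE hfin hK, JJ_eq hE hfin hK', JJ_eq hE hfin hK'']
  simp only [Set.mem_setOf_eq] at h1 h2 h3
  rw [← integral_add h1 h2, ← integral_sub (f := fun z => K z * volume.real {w | w ∈ E ∧ w - z ∈ E} + K' z * volume.real {w | w ∈ E ∧ w - z ∈ E}) (h1.add h2) h3]
  congr 1; ext z
  ring

lemma JJ_congr {n : ℕ} {E : Set (V n)} (hE : MeasurableSet E) (hr : E ⊆ closedBall 0 (9/8)) {K K' : V n → ℝ} (h : ∀ z ∈ ball (0 : V n) 4, K z = K' z) :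
    JJ K E = JJ K' E := by
  unfold JJ
  refine setIntegral_congr_fun hE fun w hw => setIntegral_congr_fun hE fun w' hw' => h _ ?_
  have h1 := hr hw
  have h2 := hr hw'
  rw [mem_closedBall_zero_iff] at h1 h2
  rw [mem_ball_zero_iff]
  have := norm_sub_le w w'
  linarith

lemma PerG_eq {n : ℕ} {E : Set (V n)} (hE : MeasurableSet E) (hfin : volume E ≠ ⊤) {K : V n → ℝ} (hK : Integrable K) :
    PerG K E = volume.real E * (∫ z, K z) - JJ K E := by
  have hw : ∀ w, Integrable (fun w' => K (w - w')) := fun w => hK.comp_sub_left w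
  have e1 : ∀ w, ∫ w' in Eᶜ, K (w - w') = (∫ z, K z) - ∫ w' in E, K (w - w') := by
    intro w
    rw [← integral_sub_left_eq_self K volume w, ← integral_add_compl hE (hw w)]; ring
  have hS : MeasurableSet {q : V n × V n | q.1 - q.2 ∈ E} := (measurable_fst.sub measurable_snd) hE
  have hi : IntegrableOn (fun w => ∫ w' in E, K (w - w')) E := by
    have := (fub hS hE hfin hK).2.1
    refine this.congr (ae_of_all _ fun w => ?_)
    simp only
    rw [← integral_indicator hE]
    have e := integral_sub_left_eq_self (fun w' => E.indicator (fun w' => K (w - w')) w') volume w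
    rw [← e]
    congr 1; ext z
    by_cases hz : w - z ∈ E <;> simp [hz, Set.indicator]
  unfold PerG JJ
  simp_rw [e1]
  have hcst : IntegrableOn (fun _ : V n => ∫ z, K z) E := integrableOn_const hfin
  rw [integral_sub hcst hi]
  simp


lemma om1_int : IntegrableOn (fun r : ℝ => (√|1-r/2|)⁻¹) (Set.Ioc 0 4) := by
  have e : Set.Ioc (0:ℝ) 4 = Set.Ioc 0 2 ∪ Set.Ioc 2 4 := by
    rw [Set.Ioc_union_Ioc_eq_Ioc] <;> norm_num
  rw [e]
  refine IntegrableOn.union ?_ ?_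
  · refine intervalIntegral.integrableOn_deriv_of_nonneg (g := fun r : ℝ => -4 * √(1-r/2)) (by fun_prop) ?_ (fun x _ => by positivity)
    intro x hx
    have hp : 0 < 1 - x/2 := by linarith [hx.2]
    have h1 : HasDerivAt (fun r : ℝ => 1 - r/2) (-(1/2)) x := by
      have := ((hasDerivAt_id x).div_const 2).const_sub 1
      simpa using this
    have := (h1.sqrt hp.ne').const_mul (-4)
    refine HasDerivAt.congr_deriv this ?_
    rw [abs_of_pos hp]
    have := Real.sqrt_pos.2 hp
    field_simp; norm_num
  · refine intervalIntegral.integrableOn_deriv_of_nonneg (g := fun r : ℝ => 4 * √(r/2-1)) (by fun_prop) ?_ (fun x _ => by positivity)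
    intro x hx
    have hp : 0 < x/2 - 1 := by linarith [hx.1]
    have h1 : HasDerivAt (fun r : ℝ => r/2 - 1) (1/2) x := by
      have := ((hasDerivAt_id x).div_const 2).sub_const 1
      simpa using this
    have := (h1.sqrt hp.ne').const_mul 4
    refine HasDerivAt.congr_deriv this ?_
    rw [abs_sub_comm, abs_of_pos hp]
    have := Real.sqrt_pos.2 hp
    field_simp; norm_num

lemma om_meas (n : ℕ) : Measurable (om (n := n)) := by unfold om; fun_prop

lemma om_int {n : ℕ} (hn : 0 < n) : IntegrableOn (om (n := n)) (ball (0 : V n) 4) := by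
  have hm := om_meas n
  refine ⟨hm.aestronglyMeasurable, ?_⟩
  rw [hasFiniteIntegral_iff_ofReal (ae_of_all _ om_nonneg), ← lintegral_indicator measurableSet_ball,
    lint_polar hn _ ((Measurable.ennreal_ofReal hm).indicator measurableSet_ball)]
  set B := ∫⁻ r in Set.Ioc (0:ℝ) 4, ENNReal.ofReal (4^(n-1)) * ENNReal.ofReal ((√|1-r/2|)⁻¹) with hB
  have hBfin : B < ⊤ := by
    rw [hB, lintegral_const_mul _ (by fun_prop)]
    exact ENNReal.mul_lt_top ENNReal.ofReal_lt_top ((hasFiniteIntegral_iff_ofReal (ae_of_all _ fun r => by positivity)).1 om1_int.2)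
  calc _ ≤ ∫⁻ x, B ∂(sph n) := by
        apply lintegral_mono_ae
        filter_upwards [sph_norm n] with x hx
        rw [lint_rad (fun r : ℝ => (ball (0 : V n) 4).indicator (fun z => ENNReal.ofReal (om z)) (r • x)) (((Measurable.ennreal_ofReal hm).indicator measurableSet_ball).comp (measurable_id.smul_const x)), hB,
          ← lintegral_indicator measurableSet_Ioi, ← lintegral_indicator measurableSet_Ioc]
        apply lintegral_mono
        intro r
        simp only
        by_cases hr : r ∈ Set.Ioi (0:ℝ)
        · have hr0 : 0 < r := hr
          have hnr : ‖r • x‖ = r := by rw [norm_smul, hx, mul_one, Real.norm_of_nonneg hr0.le]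
          rw [Set.indicator_of_mem hr]
          by_cases hr4 : r < 4
          · have h1 : r • x ∈ ball (0 : V n) 4 := by rw [mem_ball_zero_iff, hnr]; exact hr4
            have h2 : r ∈ Set.Ioc (0:ℝ) 4 := ⟨hr0, hr4.le⟩
            rw [Set.indicator_of_mem h1, Set.indicator_of_mem h2]
            unfold om
            rw [hnr]
            gcongr
          · have h1 : r • x ∉ ball (0 : V n) 4 := by rw [mem_ball_zero_iff, hnr]; exact hr4
            rw [Set.indicator_of_notMem h1]; simp
        · rw [Set.indicator_of_notMem hr]; exact zero_le
    _ < ⊤ := by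
        rw [lintegral_const]; exact ENNReal.mul_lt_top hBfin (measure_lt_top _ _)

lemma om_ge_one {n : ℕ} {z : V n} (hz : z ∈ ball (0 : V n) 4) (h2 : ‖z‖ ≠ 2) : 1 ≤ om z := by
  rw [mem_ball_zero_iff] at hz
  unfold om
  have h0 := norm_nonneg z
  have h1 : |1 - ‖z‖/2| ≤ 1 := by rw [abs_le]; constructor <;> linarith
  have h3 : 0 < |1 - ‖z‖/2| := abs_pos.2 (fun h => h2 (by linarith))
  rw [one_le_inv₀ (Real.sqrt_pos.2 h3)]
  exact Real.sqrt_le_one.2 h1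

lemma approx {n : ℕ} (hn : 0 < n) {H : V n → ℝ} (hH0 : ∀ z, 0 ≤ H z) {k : ℝ → ℝ} (hk : Measurable k) (hr : ∀ᵐ z, H z = k ‖z‖)
    (hi : IntegrableOn (fun z => H z * om z) (ball (0 : V n) 4)) {ε : ℝ} (hε : 0 < ε) :
    ∃ Q : Polynomial ℝ, (∀ s, 0 ≤ s → s ≤ 16 → 0 ≤ Q.eval s) ∧
      ∫ z in ball (0 : V n) 4, |H z - Q.eval (‖z‖^2)| * om z ≤ ε := by
  have hm := om_meas n
  set μ : Measure (V n) := (volume.restrict (ball (0 : V n) 4)).withDensity (fun z => ENNReal.ofReal (om z)) with hμ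
  have hμf : IsFiniteMeasure μ := isFiniteMeasure_withDensity_ofReal (om_int hn).2
  set T : V n → ℝ := fun z => ‖z‖^2 with hT
  have hTm : Measurable T := by rw [hT]; fun_prop
  set ν := μ.map T with hν
  have hνf : IsFiniteMeasure ν := Measure.isFiniteMeasure_map _ _
  set κ : ℝ → ℝ := fun s => |k (√s)| with hκ
  have hκm : Measurable κ := by rw [hκ]; fun_prop
  have hae : ∀ᵐ z ∂μ, H z = κ (T z) := by
    have h1 : ∀ᵐ z ∂(volume.restrict (ball (0 : V n) 4)), H z = κ (T z) := by
      refine ae_restrict_of_ae ?_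
      filter_upwards [hr] with z hz
      simp only [hκ, hT]
      rw [Real.sqrt_sq (norm_nonneg z), ← hz, abs_of_nonneg (hH0 z)]
    exact (withDensity_absolutelyContinuous _ _).ae_le h1
  have conv : ∀ f : V n → ℝ, ∫ z, f z ∂μ = ∫ z in ball (0 : V n) 4, f z * om z := by
    intro f
    rw [hμ, integral_withDensity_eq_integral_toReal_smul (by fun_prop) (ae_of_all _ fun z => ENNReal.ofReal_lt_top)]
    congr 1; ext z
    rw [ENNReal.toReal_ofReal (om_nonneg z), smul_eq_mul, mul_comm]
  have hHμ : Integrable H μ := by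
    rw [hμ, integrable_withDensity_iff_integrable_smul' (by fun_prop) (ae_of_all _ fun z => ENNReal.ofReal_lt_top)]
    refine Integrable.congr hi (ae_of_all _ fun z => ?_)
    simp only
    rw [ENNReal.toReal_ofReal (om_nonneg z), smul_eq_mul, mul_comm]
  have hκν : Integrable κ ν := by
    rw [hν, integrable_map_measure hκm.aestronglyMeasurable hTm.aemeasurable]
    exact hHμ.congr hae
  obtain ⟨ψ, hψc, hψ, hψcont, hψi⟩ := hκν.exists_hasCompactSupport_integral_sub_le (ε := ε/2) (by positivity)
  set m := μ.real Set.univ with hmdef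
  have hm0 : 0 ≤ m := measureReal_nonneg
  set η := ε / (4 * (m + 1)) with hη
  have hη0 : 0 < η := by positivity
  obtain ⟨Q0, hQ0⟩ := exists_polynomial_near_of_continuousOn 0 16 (fun s => max (ψ s) 0) (by fun_prop) η hη0
  refine ⟨Q0 + Polynomial.C η, ?_, ?_⟩
  · intro s h1 h2
    have := (abs_lt.1 (hQ0 s ⟨h1, h2⟩)).1
    have h3 : 0 ≤ max (ψ s) 0 := le_max_right _ _
    simp only [Polynomial.eval_add, Polynomial.eval_C]
    linarith
  · rw [← conv]
    have hb : ∀ᵐ z ∂μ, z ∈ ball (0 : V n) 4 :=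
      (withDensity_absolutelyContinuous _ _).ae_le (ae_restrict_mem measurableSet_ball)
    have hi1 : Integrable (fun z => |κ (T z) - ψ (T z)|) μ := by
      have := (hκν.sub hψi).abs
      rw [hν, integrable_map_measure (by fun_prop) hTm.aemeasurable] at this
      exact this
    have hle : ∫ z, |κ (T z) - ψ (T z)| ∂μ ≤ ε/2 := by
      have : ∫ s, |κ s - ψ s| ∂ν = ∫ z, |κ (T z) - ψ (T z)| ∂μ := by
        rw [hν, integral_map hTm.aemeasurable (by fun_prop)]
      rw [← this]
      exact hψ
    calc ∫ z, |H z - (Q0 + Polynomial.C η).eval (‖z‖^2)| ∂μ ≤ ∫ z, (|κ (T z) - ψ (T z)| + 2 * η) ∂μ := by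
          refine integral_mono_of_nonneg (ae_of_all _ fun z => abs_nonneg _) (hi1.add (integrable_const _)) ?_
          filter_upwards [hae, hb] with z h1 h2
          rw [mem_ball_zero_iff] at h2
          have h3 := norm_nonneg z
          have h4 := hQ0 (T z) ⟨by simp only [hT]; positivity, by simp only [hT]; nlinarith⟩
          have h5 : |κ (T z) - max (ψ (T z)) 0| ≤ |κ (T z) - ψ (T z)| := by
            have h6 : κ (T z) = max (κ (T z)) 0 := by
              rw [max_eq_left]; exact abs_nonneg _
            conv_lhs => rw [h6]
            exact abs_max_sub_max_le_abs _ _ _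
          simp only [Polynomial.eval_add, Polynomial.eval_C]
          rw [h1]
          have h7 : κ (T z) - (Q0.eval (‖z‖^2) + η) = (κ (T z) - max (ψ (T z)) 0) - (Q0.eval (T z) - max (ψ (T z)) 0) - η := by
            simp only [hT]; ring
          rw [h7]
          have h8 := abs_sub ((κ (T z) - max (ψ (T z)) 0) - (Q0.eval (T z) - max (ψ (T z)) 0)) η
          have h9 := abs_sub (κ (T z) - max (ψ (T z)) 0) (Q0.eval (T z) - max (ψ (T z)) 0)
          rw [abs_of_pos hη0] at h8
          linarith
      _ = (∫ z, |κ (T z) - ψ (T z)| ∂μ) + 2 * η * m := by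
          rw [integral_add hi1 (integrable_const _), integral_const, smul_eq_mul, mul_comm m]
      _ ≤ ε/2 + ε/2 := by
          have : 2 * η * m ≤ 2 * η * (m + 1) := by gcongr; linarith
          have h2 : 2 * η * (m+1) = ε/2 := by rw [hη]; field_simp; norm_num
          linarith
      _ = ε := by ring


lemma Wt_le_om {d : ℕ} (hd : 0 < d) {z : V (d+1)} (hz : z ∈ ball (0 : V (d+1)) 2) : Wt d ‖z‖ ≤ om z := by
  rw [mem_ball_zero_iff] at hz
  have h0 := norm_nonneg z
  have hd' : (1:ℝ) ≤ d := by exact_mod_cast hd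
  unfold Wt om
  rw [if_pos hz]
  have hb : 0 < 1 - ‖z‖/2 := by linarith
  have hbb : 1 - ‖z‖/2 ≤ 1 - ‖z‖^2/4 := by nlinarith
  have hb1 : 1 - ‖z‖^2/4 ≤ 1 := by nlinarith
  rw [abs_of_pos hb]
  calc (1 - ‖z‖^2/4)^(((d:ℝ)-2)/2) ≤ (1 - ‖z‖^2/4)^(-(1/2) : ℝ) :=
        Real.rpow_le_rpow_of_exponent_ge (by linarith) hb1 (by linarith)
    _ = (√(1 - ‖z‖^2/4))⁻¹ := by rw [Real.rpow_neg (by linarith), ← Real.sqrt_eq_rpow]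
    _ ≤ _ := by
        have := Real.sqrt_pos.2 hb
        gcongr

lemma coord_le {n : ℕ} (z : V n) (i : Fin n) : |z i| ≤ ‖z‖ := by
  simpa using PiLp.norm_apply_le z i

lemma w_int {d : ℕ} (hd : 0 < d) {H : V (d+1) → ℝ} (hH0 : ∀ z, 0 ≤ H z) (hHm : Measurable H)
    (hi : IntegrableOn (fun z => H z * om z) (ball (0 : V (d+1)) 4)) :
    IntegrableOn (fun z => |z 0| * H z * Wt d ‖z‖) (ball (0 : V (d+1)) 2) := by
  have hWm := Wt_meas d
  refine Integrable.mono' ((hi.mono_set (ball_subset_ball (by norm_num))).const_mul 2) (by fun_prop) ?_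
  filter_upwards [ae_restrict_mem measurableSet_ball] with z hz
  have h1 := Wt_le_om hd hz
  rw [mem_ball_zero_iff] at hz
  have h2 := (coord_le z 0).trans hz.le
  have h3 := Wt_nonneg d (norm_nonneg z)
  have h4 := hH0 z
  rw [Real.norm_of_nonneg (by positivity)]
  calc |z 0| * H z * Wt d ‖z‖ ≤ 2 * H z * om z := by gcongr
    _ = _ := by ring

lemma c2_bound {d : ℕ} (hd : 0 < d) {H : V (d+1) → ℝ} (hH0 : ∀ z, 0 ≤ H z) (hHm : Measurable H)
    (hi : IntegrableOn (fun z => H z * om z) (ball (0 : V (d+1)) 4)) (Q : Polynomial ℝ) (hQ : ∀ s, 0 ≤ s → s ≤ 16 → 0 ≤ Q.eval s) {ε : ℝ}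
    (hε : ∫ z in ball (0 : V (d+1)) 4, |H z - Q.eval (‖z‖^2)| * om z ≤ ε) {e : V (d+1)} (he : ‖e‖ = 1) :
    ∫ y, qq (fun s => Q.eval s) (e - y) * ‖e - y‖^2 ∂(sph (d+1)) ≤
      d/2 * ((∫ z in ball (0 : V (d+1)) 2, |z 0| * H z * Wt d ‖z‖) + 2 * ε) := by
  have hWm := Wt_meas d
  have hQm : Measurable fun s => Q.eval s := Q.continuous.measurable
  have hom := om_meas (d+1)
  have hd' : (0:ℝ) < d := by exact_mod_cast hd
  have hio : Integrable (fun z => |H z - Q.eval (‖z‖^2)| * om z) (volume.restrict (ball (0 : V (d+1)) 4)) := by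
    have hb : Integrable (fun z => Q.eval (‖z‖^2) * om z) (volume.restrict (ball (0 : V (d+1)) 4)) := by
      obtain ⟨M, hM⟩ := tb_poly Q
      refine Integrable.mono' ((om_int (n := d+1) (by omega)).const_mul M) (by fun_prop) ?_
      filter_upwards [ae_restrict_mem measurableSet_ball] with z hz
      rw [mem_ball_zero_iff] at hz
      have h0 := norm_nonneg z
      rw [norm_mul, Real.norm_of_nonneg (om_nonneg z), Real.norm_eq_abs]
      have := hM.b0 (‖z‖^2) (by positivity) (by nlinarith)
      have h2 := om_nonneg z
      gcongr
    refine ((Integrable.sub hi hb).abs).congr (ae_of_all _ fun z => ?_)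
    simp only [Pi.sub_apply]
    rw [← sub_mul, abs_mul, abs_of_nonneg (om_nonneg z)]
  have hio2 := hio.mono_measure (Measure.restrict_mono (ball_subset_ball (x := (0 : V (d+1))) (by norm_num : (2:ℝ) ≤ 4)) le_rfl)
  have hε2 : ∫ z in ball (0 : V (d+1)) 2, |H z - Q.eval (‖z‖^2)| * om z ≤ ε := by
    refine le_trans ?_ hε
    refine setIntegral_mono_set hio (ae_of_all _ fun z => mul_nonneg (abs_nonneg _) (om_nonneg z)) ?_
    exact Filter.Eventually.of_forall (ball_subset_ball (by norm_num))
  have hε0 : 0 ≤ ε := le_trans (integral_nonneg fun z => mul_nonneg (abs_nonneg _) (om_nonneg z)) hε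
  have hw := w_int hd hH0 hHm hi
  have hw0 : 0 ≤ ∫ z in ball (0 : V (d+1)) 2, |z 0| * H z * Wt d ‖z‖ := 
    integral_nonneg fun z => mul_nonneg (mul_nonneg (abs_nonneg _) (hH0 z)) (Wt_nonneg d (norm_nonneg z))
  set I := ∫ y, qq (fun s => Q.eval s) (e - y) * ‖e - y‖^2 ∂(sph (d+1)) with hI
  have hnn : ∀ᵐ y ∂(sph (d+1)), 0 ≤ Q.eval (‖e - y‖^2) := by
    filter_upwards [sph_norm (d+1)] with y hy
    obtain ⟨h1, h2⟩ := qq_dist he.le hy.le (by norm_num)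
    exact hQ _ h1 h2
  have hqc := qq_cont (n := d+1) (p := fun s => Q.eval s) Q.continuous
  have hIl : ENNReal.ofReal I = ∫⁻ y, ENNReal.ofReal (Q.eval (‖e - y‖^2)) * ENNReal.ofReal (‖e - y‖^2) ∂(sph (d+1)) := by
    rw [hI, ofReal_integral_eq_lintegral_ofReal]
    · apply lintegral_congr_ae
      filter_upwards [hnn] with y hy
      rw [← ENNReal.ofReal_mul hy]; rfl
    · exact sph_integrable (F := fun y => qq (fun s => Q.eval s) (e - y) * ‖e - y‖^2) (by fun_prop)
    · filter_upwards [hnn] with y hy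
      exact mul_nonneg hy (by positivity)
  have hid := c2_identity hd (fun r => ENNReal.ofReal (Q.eval (r^2))) (by fun_prop) he
  rw [← hIl] at hid
  have hfin : ENNReal.ofReal I ≤ ENNReal.ofReal (d/2 * ((∫ z in ball (0 : V (d+1)) 2, |z 0| * H z * Wt d ‖z‖) + 2 * ε)) := by
    rw [hid, ENNReal.ofReal_mul (p := (d:ℝ)/2) (by positivity)]
    gcongr
    calc ∫⁻ z : V (d+1), ENNReal.ofReal |z 0| * (ENNReal.ofReal (Q.eval (‖z‖^2)) * ENNReal.ofReal (Wt d ‖z‖)) 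
        ≤ ∫⁻ z, (ball (0 : V (d+1)) 2).indicator (fun z => ENNReal.ofReal (|z 0| * H z * Wt d ‖z‖ + 2 * (|H z - Q.eval (‖z‖^2)| * om z))) z := by
          apply lintegral_mono
          intro z
          simp only
          by_cases hz : z ∈ ball (0 : V (d+1)) 2
          · rw [Set.indicator_of_mem hz]
            have h1 := Wt_le_om hd hz
            rw [mem_ball_zero_iff] at hz
            have h0 := norm_nonneg z
            have h2 := (coord_le z 0).trans hz.le
            have h3 := Wt_nonneg d (norm_nonneg z)
            have hq := hQ (‖z‖^2) (by positivity) (by nlinarith)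
            rw [← ENNReal.ofReal_mul hq, ← ENNReal.ofReal_mul (abs_nonneg _)]
            apply ENNReal.ofReal_le_ofReal
            have h5 : Q.eval (‖z‖^2) ≤ H z + |H z - Q.eval (‖z‖^2)| := by
              have := neg_abs_le (H z - Q.eval (‖z‖^2)); linarith
            calc |z 0| * (Q.eval (‖z‖^2) * Wt d ‖z‖) ≤ |z 0| * ((H z + |H z - Q.eval (‖z‖^2)|) * Wt d ‖z‖) := by gcongr
              _ = |z 0| * H z * Wt d ‖z‖ + |z 0| * (|H z - Q.eval (‖z‖^2)| * Wt d ‖z‖) := by ring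
              _ ≤ _ := by gcongr
          · rw [Set.indicator_of_notMem hz]
            rw [mem_ball_zero_iff] at hz
            have : Wt d ‖z‖ = 0 := by unfold Wt; rw [if_neg hz]
            rw [this]; simp
      _ = ENNReal.ofReal (∫ z in ball (0 : V (d+1)) 2, (|z 0| * H z * Wt d ‖z‖ + 2 * (|H z - Q.eval (‖z‖^2)| * om z))) := by
          rw [lintegral_indicator measurableSet_ball, ofReal_integral_eq_lintegral_ofReal]
          · exact Integrable.add hw (hio2.const_mul 2)
          · refine ae_of_all _ fun z => ?_
            have h3 := Wt_nonneg d (norm_nonneg z)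
            have h4 := hH0 z
            have h5 := om_nonneg z
            simp only [Pi.zero_apply]
            positivity
      _ ≤ _ := by
          apply ENNReal.ofReal_le_ofReal
          rw [integral_add hw (hio2.const_mul 2), integral_const_mul]
          linarith
  refine (ENNReal.ofReal_le_ofReal_iff ?_).1 hfin
  positivity


lemma cut_int {n : ℕ} (hn : 0 < n) {K : V n → ℝ} (hK : Measurable K) 
    (hi : IntegrableOn (fun z => K z * om z) (ball (0 : V n) 4)) : IntegrableOn K (ball (0 : V n) 4) := by
  refine Integrable.mono' hi.abs hK.aestronglyMeasurable ?_
  filter_upwards [ae_restrict_mem measurableSet_ball, ae_restrict_of_ae (v_norm_ne hn (by norm_num : (2:ℝ) ≠ 0))] with z hz h2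
  have h1 := om_ge_one hz h2
  rw [abs_mul, abs_of_nonneg (om_nonneg z), Real.norm_eq_abs]
  exact le_mul_of_one_le_right (abs_nonneg _) h1

lemma rot_ae {n : ℕ} {K : V n → ℝ} {k : ℝ → ℝ} (hr : ∀ᵐ z, K z = k ‖z‖) (g : V n ≃ₗᵢ[ℝ] V n) : ∀ᵐ z, K (g z) = K z := by
  have h2 : ∀ᵐ z, K (g z) = k ‖g z‖ := (g.measurePreserving).quasiMeasurePreserving.ae hr
  filter_upwards [hr, h2] with z h1 h2
  rw [h2, h1, g.norm_map]

lemma JJ_sum {n : ℕ} {E : Set (V n)} (hE : MeasurableSet E) (hr : E ⊆ closedBall 0 (9/8)) {H K K' K'' : V n → ℝ}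
    (hK : IntegrableOn K (ball 0 4)) (hK' : IntegrableOn K' (ball 0 4)) (hK'' : IntegrableOn K'' (ball 0 4))
    (hs : ∀ z ∈ ball (0 : V n) 4, H z = K z + K' z - K'' z) : JJ H E = JJ K E + JJ K' E - JJ K'' E := by
  have hfin : volume E ≠ ⊤ := ((measure_mono hr).trans_lt measure_closedBall_lt_top).ne
  have hB := measurableSet_ball (x := (0 : V n)) (ε := 4)
  have e : ∀ F : V n → ℝ, JJ F E = JJ ((ball (0 : V n) 4).indicator F) E := fun F =>
    JJ_congr hE hr fun z hz => (Set.indicator_of_mem hz F).symm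
  rw [e K, e K', e K'', ← JJ_add hE hfin (hK.integrable_indicator hB) (hK'.integrable_indicator hB) (hK''.integrable_indicator hB)]
  refine JJ_congr hE hr fun z hz => ?_
  simp only [Set.indicator_of_mem hz]
  exact hs z hz

lemma claimA_cut {d : ℕ} (hd : 0 < d) {C : ℝ} (hC : 0 < C) : ∃ C' : ℝ, 0 < C' ∧ ∀ (t : ℝ) (u : V (d+1) → ℝ) (E : Set (V (d+1))) (R : V (d+1) → ℝ),
    NB C t u E R → t ≠ 0 → C * |t| ≤ 1/24 → volume E = volume (ball (0 : V (d+1)) 1) →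
    ∀ (K : V (d+1) → ℝ) (k : ℝ → ℝ), Measurable K → (∀ z, 0 ≤ K z) → (∀ᵐ z, K z = k ‖z‖) →
    IntegrableOn (fun z => K z * om z) (ball (0 : V (d+1)) 4) → |JJ K E - JJ K (ball 0 1)| ≤ C' * t^2 * ∫ z in ball (0 : V (d+1)) 4, K z * om z := by
  obtain ⟨C', hC', h⟩ := claimA hd hC
  refine ⟨C', hC', fun t u E R hN ht hCt hv K k hKm hK0 hr hi => ?_⟩
  have hB := measurableSet_ball (x := (0 : V (d+1))) (ε := 4)
  have hs := nb_sub' hN (by linarith)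
  have hc := cut_int (by omega) hKm hi
  have e1 : JJ K E = JJ ((ball (0 : V (d+1)) 4).indicator K) E := 
    JJ_congr hN.meas hs fun z hz => (Set.indicator_of_mem hz K).symm
  have e2 : JJ K (ball 0 1) = JJ ((ball (0 : V (d+1)) 4).indicator K) (ball 0 1) := 
    JJ_congr measurableSet_ball ((ball_subset_closedBall).trans (closedBall_subset_closedBall (by norm_num))) fun z hz => (Set.indicator_of_mem hz K).symm
  have e3 : (fun z => (ball (0 : V (d+1)) 4).indicator K z * om z) = (ball (0 : V (d+1)) 4).indicator (fun z => K z * om z) := by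
    ext z; rw [Set.indicator_mul_left]
  rw [e1, e2, ← integral_indicator hB, ← e3]
  refine h t u E R hN ht hCt hv _ (hc.integrable_indicator hB) (fun z => Set.indicator_nonneg (fun z _ => hK0 z) z) ?_ ?_
  · refine rot_ae (k := fun r => if r < 4 then k r else 0) ?_
    filter_upwards [hr] with z hz
    by_cases h4 : z ∈ ball (0 : V (d+1)) 4
    · rw [Set.indicator_of_mem h4, if_pos (by simpa using h4), hz]
    · rw [Set.indicator_of_notMem h4, if_neg (by simpa using h4)]
  · rw [e3]; exact hi.integrable_indicator hB

lemma stab_H {d : ℕ} (hd : 0 < d) {H : V (d+1) → ℝ} (hH0 : ∀ z, 0 ≤ H z) (hHm : Measurable H) {k : ℝ → ℝ} (hk : Measurable k) (hr : ∀ᵐ z, H z = k ‖z‖)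
    (hi : IntegrableOn (fun z => H z * om z) (ball (0 : V (d+1)) 4)) {γ : ℝ} (hγ : 0 < γ)
    (hW : γ * (∫ z in ball (0 : V (d+1)) 2, |z 0| * H z * Wt d ‖z‖) < 2)
    {U : V (d+1) → ℝ} (hU : ContDiff ℝ (⊤ : ℕ∞) U) (h0 : ∫ x, U x ∂sph (d+1) = 0) {C : ℝ} (hC : 0 < C) {ε : ℝ} (hε : 0 < ε) :
    ∃ δ : ℝ, 0 < δ ∧ ∀ (t : ℝ) (E : Set (V (d+1))) (R : V (d+1) → ℝ), t ≠ 0 → |t| ≤ δ → NB C t U E R →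
      volume E = volume (ball (0 : V (d+1)) 1) → perimeter E ≠ ⊤ →
      NN (d+1) - ε * t^2 ≤ P E + γ * (JJ H E - JJ H (ball (0 : V (d+1)) 1)) := by
  have hd' : (0:ℝ) < d := by exact_mod_cast hd
  have hom := om_meas (d+1)
  obtain ⟨CA, hCA, hA⟩ := claimA_cut hd hC
  set W := ∫ z in ball (0 : V (d+1)) 2, |z 0| * H z * Wt d ‖z‖ with hWd
  set ε1 := min (ε / (4 * γ * CA)) ((2 - γ * W)/(2 * γ)) with hε1
  have hε1p : 0 < ε1 := lt_min (by positivity) (div_pos (by linarith) (by positivity))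
  have hε1a : γ * CA * (2 * ε1) ≤ ε/2 := by
    have : ε1 ≤ ε / (4 * γ * CA) := min_le_left _ _
    rw [le_div_iff₀ (by positivity)] at this
    linarith
  have hε1b : γ * (W + 2 * ε1) ≤ 2 := by
    have : ε1 ≤ (2 - γ * W)/(2 * γ) := min_le_right _ _
    rw [le_div_iff₀ (by positivity)] at this
    linarith
  obtain ⟨Q, hQ0, hQ⟩ := approx (by omega) hH0 hk hr hi hε1p
  have he : ‖(EuclideanSpace.single 0 1 : V (d+1))‖ = 1 := by simp
  have hc2 := c2_bound hd hH0 hHm hi Q hQ0 hQ he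
  obtain ⟨M, hM⟩ := tb_poly Q
  have hc : γ * (∫ y, qq (fun s => Q.eval s) (EuclideanSpace.single 0 1 - y) * ‖EuclideanSpace.single 0 1 - y‖^2 ∂(sph (d+1))) ≤ ((d+1 : ℕ) : ℝ) - 1 := by
    push_cast
    calc _ ≤ γ * (d/2 * (W + 2 * ε1)) := mul_le_mul_of_nonneg_left hc2 hγ.le
      _ = d/2 * (γ * (W + 2 * ε1)) := by ring
      _ ≤ d/2 * 2 := mul_le_mul_of_nonneg_left hε1b (by positivity)
      _ = _ := by ring
  obtain ⟨C', hC', δ, hδ, hS⟩ := stab_smooth (by omega) hU h0 hγ.le hM hQ0 he hc hC.le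
  have hQm : Measurable fun s => Q.eval s := Q.continuous.measurable
  have hqo : Integrable (fun z => Q.eval (‖z‖^2) * om z) (volume.restrict (ball (0 : V (d+1)) 4)) := by
    refine Integrable.mono' ((om_int (n := d+1) (by omega)).const_mul M) (by fun_prop) ?_
    filter_upwards [ae_restrict_mem measurableSet_ball] with z hz
    rw [mem_ball_zero_iff] at hz
    have h0 := norm_nonneg z
    rw [norm_mul, Real.norm_of_nonneg (om_nonneg z), Real.norm_eq_abs]
    have := hM.b0 (‖z‖^2) (by positivity) (by nlinarith)
    have h2 := om_nonneg z
    gcongr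
  have hio : Integrable (fun z => |H z - Q.eval (‖z‖^2)| * om z) (volume.restrict (ball (0 : V (d+1)) 4)) := by
    refine ((Integrable.sub hi hqo).abs).congr (ae_of_all _ fun z => ?_)
    simp only [Pi.sub_apply]
    rw [← sub_mul, abs_mul, abs_of_nonneg (om_nonneg z)]
  have part : ∀ (F : V (d+1) → ℝ) (f : ℝ → ℝ), Measurable F → (∀ z, 0 ≤ F z) → (∀ᵐ z, F z = f ‖z‖) →
      (∀ z, F z ≤ |H z - Q.eval (‖z‖^2)|) → IntegrableOn F (ball (0 : V (d+1)) 4) ∧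
      ∀ (t : ℝ) (E : Set (V (d+1))) (R : V (d+1) → ℝ), NB C t U E R → t ≠ 0 → C * |t| ≤ 1/24 →
        volume E = volume (ball (0 : V (d+1)) 1) → |JJ F E - JJ F (ball 0 1)| ≤ CA * t^2 * ε1 := by
    intro F f hFm hF0 hFr hFl
    have hFi : IntegrableOn (fun z => F z * om z) (ball (0 : V (d+1)) 4) := by
      refine Integrable.mono' hio (by fun_prop) (ae_of_all _ fun z => ?_)
      rw [Real.norm_of_nonneg (mul_nonneg (hF0 z) (om_nonneg z))]
      exact mul_le_mul_of_nonneg_right (hFl z) (om_nonneg z)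
    refine ⟨cut_int (by omega) hFm hFi, fun t E R hN ht hCt hv => ?_⟩
    refine (hA t U E R hN ht hCt hv F f hFm hF0 hFr hFi).trans ?_
    refine mul_le_mul_of_nonneg_left (le_trans ?_ hQ) (by positivity)
    refine integral_mono hFi hio fun z => ?_
    exact mul_le_mul_of_nonneg_right (hFl z) (om_nonneg z)
  obtain ⟨hp1, hp2⟩ := part (fun z => max (H z - Q.eval (‖z‖^2)) 0) (fun r => max (k r - Q.eval (r^2)) 0) (by fun_prop) (fun z => le_max_right _ _)
    (by filter_upwards [hr] with z hz; simp only [hz]) (fun z => max_le (le_abs_self _) (abs_nonneg _))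
  obtain ⟨hm1, hm2⟩ := part (fun z => max (-(H z - Q.eval (‖z‖^2))) 0) (fun r => max (-(k r - Q.eval (r^2))) 0) (by fun_prop) (fun z => le_max_right _ _)
    (by filter_upwards [hr] with z hz; simp only [hz]) (fun z => max_le (neg_le_abs _) (abs_nonneg _))
  have hq1 : IntegrableOn (qq (fun s => Q.eval s)) (ball (0 : V (d+1)) 4) := cut_int (by omega) (qq_cont (n := d+1) (p := fun s => Q.eval s) Q.continuous).measurable hqo
  have hsum : ∀ z ∈ ball (0 : V (d+1)) 4, H z = qq (fun s => Q.eval s) z + max (H z - Q.eval (‖z‖^2)) 0 - max (-(H z - Q.eval (‖z‖^2))) 0 := by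
    intro z _
    unfold qq
    rcases le_total 0 (H z - Q.eval (‖z‖^2)) with h | h
    · rw [max_eq_left h, max_eq_right (by linarith)]; ring
    · rw [max_eq_right h, max_eq_left (by linarith)]; ring
  refine ⟨min δ (min (1/(24 * C)) (ε/(2*C'))), by positivity, fun t E R ht htd hN hv hp => ?_⟩
  have ht1 : |t| ≤ δ := htd.trans (min_le_left _ _)
  have ht2 : C * |t| ≤ 1/24 := by
    have := htd.trans ((min_le_right _ _).trans (min_le_left _ _))
    rw [le_div_iff₀ (by positivity)] at this
    linarith
  have ht3 : C' * |t| ≤ ε/2 := by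
    have := htd.trans ((min_le_right _ _).trans (min_le_right _ _))
    rw [le_div_iff₀ (by positivity)] at this
    linarith
  have hs := hS t E R ht1 hN (by linarith) hv hp
  have a1 := hp2 t E R hN ht ht2 hv
  have a2 := hm2 t E R hN ht ht2 hv
  rw [JJ_sum hN.meas (nb_sub' hN (by linarith)) hq1 hp1 hm1 hsum, 
    JJ_sum measurableSet_ball ((ball_subset_closedBall).trans (closedBall_subset_closedBall (by norm_num))) hq1 hp1 hm1 hsum]
  have b1 := neg_le_of_abs_le a1
  have b2 := le_of_abs_le a2
  generalize JJ (fun z => max (H z - Q.eval (‖z‖^2)) 0) E = x1 at *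
  generalize JJ (fun z => max (-(H z - Q.eval (‖z‖^2))) 0) E = x2 at *
  generalize JJ (fun z => max (H z - Q.eval (‖z‖^2)) 0) (ball 0 1) = y1 at *
  generalize JJ (fun z => max (-(H z - Q.eval (‖z‖^2))) 0) (ball 0 1) = y2 at *
  have c1 : γ * ((x1 - y1) - (x2 - y2)) ≥ γ * (- (2 * (CA * t^2 * ε1))) := 
    mul_le_mul_of_nonneg_left (by linarith) hγ.le
  have c2 : γ * CA * (2 * ε1) * t^2 ≤ ε/2 * t^2 := mul_le_mul_of_nonneg_right hε1a (sq_nonneg t)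
  have c3 : C' * |t|^3 ≤ ε/2 * t^2 := by
    rw [← sq_abs t]
    calc C' * |t|^3 = C' * |t| * |t|^2 := by ring
      _ ≤ _ := mul_le_mul_of_nonneg_right ht3 (sq_nonneg _)
  linarith


lemma red_deriv {f : ℝ → ℝ} (ha : ∀ ε : ℝ, 0 < ε → ∃ δ : ℝ, 0 < δ ∧ ∀ t, t ≠ 0 → |t| ≤ δ → f 0 - ε * t^2 ≤ f t)
    (hb : ∀ ε : ℝ, 0 < ε → ∃ δ : ℝ, 0 < δ ∧ ∀ t, |t| ≤ δ → f t ≤ f 0 + ε) :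
    deriv f 0 = 0 ∧ 0 ≤ deriv (deriv f) 0 := by
  have h1 : deriv f 0 = 0 := by
    by_cases hd : DifferentiableAt ℝ f 0
    · obtain ⟨δ, hδ, h⟩ := ha 1 one_pos
      have hm : IsLocalMin (fun t => f t + t^2) 0 := by
        filter_upwards [Metric.closedBall_mem_nhds (0:ℝ) hδ] with t ht
        rw [mem_closedBall_zero_iff, Real.norm_eq_abs] at ht
        by_cases h0 : t = 0
        · rw [h0]
        · have := h t h0 ht
          nlinarith
      have e := hm.hasDerivAt_eq_zero (hd.hasDerivAt.add ((hasDerivAt_id (0:ℝ)).pow 2))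
      simpa using e
    · exact deriv_zero_of_not_differentiableAt hd
  refine ⟨h1, ?_⟩
  by_contra hneg
  push Not at hneg
  have hd : DifferentiableAt ℝ (deriv f) 0 := by
    by_contra h
    rw [deriv_zero_of_not_differentiableAt h] at hneg
    exact lt_irrefl _ hneg
  set a := -(deriv (deriv f) 0)/2 with haa
  have ha0 : 0 < a := by rw [haa]; linarith
  have hD : HasDerivAt (deriv f) (-(2*a)) 0 := by
    have := hd.hasDerivAt
    refine HasDerivAt.congr_deriv this ?_
    rw [haa]; ring
  have hev : ∀ᶠ t in 𝓝 (0:ℝ), ‖deriv f t - deriv f 0 - (t - 0) • (-(2*a))‖ ≤ a * ‖t - 0‖ := 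
    (hasDerivAt_iff_isLittleO.1 hD).def ha0
  obtain ⟨δ1, hδ1, h2⟩ := Metric.eventually_nhds_iff.1 hev
  have h3 : ∀ t, 0 < t → t < δ1 → deriv f t ≤ -(a * t) := by
    intro t ht ht1
    have := h2 (y := t) (by rw [dist_zero_right, Real.norm_eq_abs, abs_of_pos ht]; exact ht1)
    rw [h1] at this
    simp only [sub_zero, smul_eq_mul, Real.norm_eq_abs, abs_of_pos ht] at this
    have := le_of_abs_le this
    linarith
  have h4 : ∀ t, 0 < t → t < δ1 → DifferentiableAt ℝ f t := by
    intro t ht ht1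
    by_contra h
    have := h3 t ht ht1
    rw [deriv_zero_of_not_differentiableAt h] at this
    have : 0 < a * t := by positivity
    linarith
  have h5 : ∀ s t, 0 < s → s < t → t < δ1 → f t + a/2 * t^2 ≤ f s + a/2 * s^2 := by
    intro s t hs hst ht
    have hdd : ∀ x ∈ Set.Icc s t, HasDerivAt (fun x => f x + a/2 * x^2) (deriv f x + a * x) x := by
      intro x hx
      have := (h4 x (by linarith [hx.1]) (by linarith [hx.2])).hasDerivAt.add (((hasDerivAt_id x).pow 2).const_mul (a/2))
      refine HasDerivAt.congr_deriv this ?_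
      simp; ring
    have hanti : AntitoneOn (fun x => f x + a/2 * x^2) (Set.Icc s t) := by
      refine antitoneOn_of_deriv_nonpos (convex_Icc s t) (fun x hx => (hdd x hx).continuousAt.continuousWithinAt) ?_ ?_
      · intro x hx; exact (hdd x (interior_subset hx)).differentiableAt.differentiableWithinAt
      · intro x hx
        have hx' := interior_subset hx
        rw [(hdd x hx').deriv]
        have := h3 x (by linarith [hx'.1]) (by linarith [hx'.2])
        linarith
    exact hanti ⟨le_rfl, hst.le⟩ ⟨hst.le, le_rfl⟩ hst.le
  obtain ⟨δ2, hδ2, h6⟩ := ha (a/4) (by positivity)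
  set t := min (δ1/2) δ2 with ht
  have ht0 : 0 < t := by positivity
  have ht1 : t < δ1 := (min_le_left _ _).trans_lt (by linarith)
  have h7 := h6 t ht0.ne' (by rw [abs_of_pos ht0]; exact min_le_right _ _)
  have hcp : 0 < a/16 * t^2 := by positivity
  obtain ⟨δ3, hδ3, h8⟩ := hb (a/16 * t^2) hcp
  set s := min δ3 (t/4) with hs
  have hs0 : 0 < s := by positivity
  have hst : s ≤ t/4 := min_le_right _ _
  have h9 := h8 s (by rw [abs_of_pos hs0]; exact min_le_left _ _)
  have h10 := h5 s t hs0 (by linarith) ht1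
  have h11 : s^2 ≤ (t/4)^2 := by gcongr
  have h12 : a/2 * s^2 ≤ a/2 * (t/4)^2 := by gcongr
  nlinarith


lemma P_ball {n : ℕ} (hn : 0 < n) : P (ball (0 : V n) 1) = NN n := by
  have hle := per_image_le (n := n) hn (T := id) (T' := id) LipschitzWith.id LipschitzWith.id (fun _ => rfl) (fun _ => rfl)
  simp only [Set.image_id, NNReal.coe_one, one_pow, one_mul] at hle
  have hfin : perimeter (ball (0 : V n) 1) ≠ ⊤ := (hle.trans_lt ENNReal.ofReal_lt_top).ne
  apply le_antisymm
  · have := ENNReal.toReal_mono ENNReal.ofReal_ne_top hle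
    rwa [ENNReal.toReal_ofReal (NN_pos hn).le] at this
  · obtain ⟨C', _, δ, hδ, h⟩ := per_lower hn (U := fun _ => 0) contDiff_const 0 le_rfl
    have := h 0 _ _ (by simpa using hδ.le) (nb_ball n) (by norm_num) rfl hfin
    simpa using this

lemma u_mean {n : ℕ} (hn : 0 < n) {X : V n → V n} {Φ : ℝ → V n → V n} (h : IsFlowOf X Φ)
    (hv : PreservesVolume Φ (ball (0 : V n) 1)) : ∫ x, inner ℝ (X x) x ∂(sph n) = 0 := by
  obtain ⟨M, hM, hF⟩ := flow_nb h
  obtain ⟨δ, hδ, hv⟩ := hv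
  have hXc := h.smooth.continuous
  set C := 40 * M + 7 * M^2 + M with hC
  have hCp : 0 < C := by positivity
  obtain ⟨C', hC', hL⟩ := L1 hn C hCp.le
  set I := ∫ x, inner ℝ (X x) x ∂(sph n) with hI
  by_contra hne
  have hIp : 0 < |I| := abs_pos.2 hne
  set t := min (min (1/2) (δ/2)) (min (1/(100*M)) (min (1/(8*C)) (|I|/(2*C')))) with ht
  have ht0 : 0 < t := by positivity
  have ha : |t| = t := abs_of_pos ht0
  have h1 : t ≤ 1/2 := (min_le_left _ _).trans (min_le_left _ _)
  have h2 : t ≤ δ/2 := (min_le_left _ _).trans (min_le_right _ _)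
  have h3 : t ≤ 1/(100*M) := (min_le_right _ _).trans (min_le_left _ _)
  have h4 : t ≤ 1/(8*C) := (min_le_right _ _).trans ((min_le_right _ _).trans (min_le_left _ _))
  have h5 : t ≤ |I|/(2*C') := (min_le_right _ _).trans ((min_le_right _ _).trans (min_le_right _ _))
  rw [le_div_iff₀ (by positivity)] at h3 h4 h5
  obtain ⟨R, hN⟩ := (hF t (by rw [ha]; linarith)).1 (by rw [ha]; linarith)
  have hvt := hv t (by rw [ha]; linarith)
  have := hL t _ _ R hN (by rw [ha]; linarith) (by fun_prop) 1 (fun _ => 1) continuous_const zero_le_one (by simp) (by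
    intro x _ ρ _; simp)
  have hLL : LL (Φ t '' ball (0 : V n) 1) (fun _ => 1) = 0 := by
    unfold LL
    simp only [setIntegral_const, smul_eq_mul, mul_one, Measure.real, hvt, sub_self]
  rw [hLL] at this
  simp only [one_mul, zero_sub, abs_neg, mul_one, ← hI] at this
  rw [abs_mul, ha] at this
  have h6 : t * |I| ≤ t * (C' * t) := by nlinarith
  have h7 := le_of_mul_le_mul_left h6 ht0
  nlinarith

lemma stab_main {d : ℕ} (hd : 0 < d) {H : V (d+1) → ℝ} (hH0 : ∀ z, 0 ≤ H z) (hHm : Measurable H) (hHi : Integrable H) {k : ℝ → ℝ} (hk : Measurable k) (hr : ∀ᵐ z, H z = k ‖z‖)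
    (hi : IntegrableOn (fun z => H z * om z) (ball (0 : V (d+1)) 4)) {γ : ℝ} (hγ : 0 < γ)
    (hW : γ * (∫ z in ball (0 : V (d+1)) 2, |z 0| * H z * Wt d ‖z‖) < 2)
    {X : V (d+1) → V (d+1)} {Φ : ℝ → V (d+1) → V (d+1)} (h : IsFlowOf X Φ)
    (hv : PreservesVolume Φ (ball (0 : V (d+1)) 1)) :
    deriv (fun t => P (Φ t '' ball (0 : V (d+1)) 1) - γ * PerG H (Φ t '' ball (0 : V (d+1)) 1)) 0 = 0 ∧
    0 ≤ deriv (deriv (fun t => P (Φ t '' ball (0 : V (d+1)) 1) - γ * PerG H (Φ t '' ball (0 : V (d+1)) 1))) 0 := by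
  have hn : 0 < d + 1 := by omega
  have hmean := u_mean hn h hv
  obtain ⟨M, hM, hF⟩ := flow_nb h
  obtain ⟨δ, hδ, hv⟩ := hv
  set C := 40 * M + 7 * M^2 + M with hC
  have hCp : 0 < C := by positivity
  have hU : ContDiff ℝ (⊤ : ℕ∞) (fun x => inner ℝ (X x) x) := h.smooth.inner ℝ contDiff_id
  have hNp := NN_pos hn
  have h00 : Φ 0 '' ball (0 : V (d+1)) 1 = ball (0 : V (d+1)) 1 := by
    have : Φ 0 = id := funext h.init
    rw [this, Set.image_id]
  have hbfin : volume (ball (0 : V (d+1)) 1) ≠ ⊤ := measure_ball_lt_top.ne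
  set S := volume.real (ball (0 : V (d+1)) 1) * (∫ z, H z) with hS
  have hf0 : P (Φ 0 '' ball (0 : V (d+1)) 1) - γ * PerG H (Φ 0 '' ball (0 : V (d+1)) 1) = NN (d+1) - γ * (S - JJ H (ball 0 1)) := by
    rw [h00, P_ball hn, PerG_eq measurableSet_ball hbfin hHi]
  -- facts for small t
  have hsmall : ∃ δ0 : ℝ, 0 < δ0 ∧ ∀ t, |t| ≤ δ0 → C * |t| ≤ 1/24 ∧ M * |t| ≤ 1 ∧
      (∃ R, NB C t (fun x => inner ℝ (X x) x) (Φ t '' ball (0 : V (d+1)) 1) R) ∧ volume (Φ t '' ball (0 : V (d+1)) 1) = volume (ball (0 : V (d+1)) 1) ∧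
      perimeter (Φ t '' ball (0 : V (d+1)) 1) ≠ ⊤ ∧ P (Φ t '' ball (0 : V (d+1)) 1) ≤ (1 + M * |t|)^(d+1+1) * NN (d+1) ∧
      PerG H (Φ t '' ball (0 : V (d+1)) 1) = S - JJ H (Φ t '' ball (0 : V (d+1)) 1) := by
    refine ⟨min (min 1 (δ/2)) (min (1/(100*M)) (1/(24*C))), by positivity, fun t ht => ?_⟩
    have h1 : |t| ≤ 1 := ht.trans ((min_le_left _ _).trans (min_le_left _ _))
    have h2 : |t| ≤ δ/2 := ht.trans ((min_le_left _ _).trans (min_le_right _ _))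
    have h3 : |t| ≤ 1/(100*M) := ht.trans ((min_le_right _ _).trans (min_le_left _ _))
    have h4 : |t| ≤ 1/(24*C) := ht.trans ((min_le_right _ _).trans (min_le_right _ _))
    rw [le_div_iff₀ (by positivity)] at h3 h4
    obtain ⟨hN, hl1, hl2, e1, e2⟩ := hF t h1
    obtain ⟨R, hN⟩ := hN (by linarith)
    have hp := per_image_le hn hl1 hl2 e2 e1
    have hM0 : 0 ≤ 1 + M * |t| := by positivity
    rw [Real.coe_toNNReal _ hM0] at hp
    have hvt := hv t (by linarith)
    refine ⟨by linarith, by linarith, ⟨R, hN⟩, hvt, (hp.trans_lt ENNReal.ofReal_lt_top).ne, ?_, ?_⟩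
    · have := ENNReal.toReal_mono ENNReal.ofReal_ne_top hp
      rwa [ENNReal.toReal_ofReal (by positivity)] at this
    · rw [PerG_eq hN.meas (by rw [hvt]; exact hbfin) hHi, Measure.real, hvt]; rfl
  obtain ⟨δ0, hδ0, hsm⟩ := hsmall
  apply red_deriv
  · intro ε hε
    obtain ⟨δ1, hδ1, hst⟩ := stab_H hd hH0 hHm hk hr hi hγ hW hU hmean hCp hε
    refine ⟨min δ0 δ1, by positivity, fun t ht htd => ?_⟩
    obtain ⟨a1, _, ⟨R, a3⟩, a4, a5, a6, a7⟩ := hsm t (htd.trans (min_le_left _ _))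
    have := hst t _ R ht (htd.trans (min_le_right _ _)) a3 a4 a5
    rw [hf0, a7]
    linarith
  · intro ε hε
    obtain ⟨CA, hCA, hA⟩ := claimA_cut hd hCp
    set J := ∫ z in ball (0 : V (d+1)) 4, H z * om z with hJ
    have hlim : Tendsto (fun t : ℝ => (1 + M * |t|)^(d+1+1) * NN (d+1) + γ * (CA * t^2 * J)) (𝓝 0) (𝓝 (NN (d+1))) := by
      have hc : Continuous (fun t : ℝ => (1 + M * |t|)^(d+1+1) * NN (d+1) + γ * (CA * t^2 * J)) := by fun_prop
      have := hc.tendsto 0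
      simpa using this
    have hev := hlim.eventually (ge_mem_nhds (show NN (d+1) < NN (d+1) + ε by linarith))
    obtain ⟨δ1, hδ1, h2⟩ := Metric.eventually_nhds_iff.1 hev
    refine ⟨min δ0 (δ1/2), by positivity, fun t ht => ?_⟩
    by_cases ht0 : t = 0
    · rw [ht0]; linarith
    obtain ⟨a1, _, ⟨R, a3⟩, a4, a5, a6, a7⟩ := hsm t (ht.trans (min_le_left _ _))
    have b1 := h2 (y := t) (by rw [dist_zero_right, Real.norm_eq_abs]; exact (ht.trans (min_le_right _ _)).trans_lt (by linarith))
    have b2 := le_of_abs_le (hA t _ _ R a3 ht0 a1 a4 H k hHm hH0 hr hi)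
    rw [hf0, a7]
    have b3 := mul_le_mul_of_nonneg_left b2 hγ.le
    linarith


lemma half_fin {d : ℕ} {v : V (d+1)} (hv : ‖v‖ = 1) : μH[(d:ℝ)] {x : V (d+1) | ‖x‖ = 1 ∧ inner ℝ v x ≤ 0} < ⊤ := by
  have hv0 : v ≠ 0 := by rintro rfl; simp at hv
  have hfact : Fact (Module.finrank ℝ (V (d+1)) = d + 1) := ⟨by simp⟩
  have hfr : Module.finrank ℝ (Submodule.orthogonal (Submodule.span ℝ {v})) = d := Submodule.finrank_orthogonal_span_singleton hv0
  set W := Submodule.orthogonal (Submodule.span ℝ {v}) with hW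
  have hcd : ContDiff ℝ 1 (fun w : W => stereoInvFunAux v (w : V (d+1))) := 
    contDiff_stereoInvFunAux.comp W.subtypeL.contDiff
  obtain ⟨K, hK⟩ := hcd.contDiffOn.exists_lipschitzOnWith one_ne_zero (convex_closedBall (0 : W) 2) (isCompact_closedBall (0 : W) 2)
  have hsub : {x : V (d+1) | ‖x‖ = 1 ∧ inner ℝ v x ≤ 0} ⊆ (fun w : W => stereoInvFunAux v (w : V (d+1))) '' (closedBall (0 : W) 2) := by
    rintro x ⟨hx, hvx⟩
    refine ⟨stereoToFun v x, ?_, ?_⟩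
    · rw [mem_closedBall_zero_iff, stereoToFun_apply, norm_smul]
      have h1 : ‖W.orthogonalProjectionOnto x‖ ≤ 1 := by
        rw [← hx]; exact W.norm_orthogonalProjectionOnto_apply_le x
      have h2 : ‖2 / ((1:ℝ) - innerSL ℝ v x)‖ ≤ 2 := by
        simp only [innerSL_apply_apply]
        rw [Real.norm_of_nonneg (div_nonneg (by norm_num) (by linarith)), div_le_iff₀ (by linarith)]
        linarith
      calc _ ≤ (2:ℝ) * 1 := mul_le_mul h2 h1 (norm_nonneg _) (by norm_num)
        _ = 2 := by norm_num
    · have hne : x ≠ v := by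
        rintro rfl
        rw [real_inner_self_eq_norm_sq, hx] at hvx
        norm_num at hvx
      have := stereo_left_inv hv (x := ⟨x, by simpa using hx⟩) hne
      have := congrArg Subtype.val this
      exact this
  refine (measure_mono hsub).trans_lt ((hK.hausdorffMeasure_image_le (d := (d:ℝ)) (by positivity)).trans_lt ?_)
  refine ENNReal.mul_lt_top (by rw [ENNReal.rpow_natCast]; exact ENNReal.pow_lt_top ENNReal.coe_lt_top) ?_
  have hb : μH[(Module.finrank ℝ W : ℝ)] (closedBall (0 : W) 2) < ⊤ := (isCompact_closedBall (0 : W) 2).measure_lt_top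
  rwa [hfr] at hb

lemma muS_fin (d : ℕ) : μH[(d:ℝ)] (sphere (0 : V (d+1)) 1) < ⊤ := by
  have hv : ‖(EuclideanSpace.single 0 1 : V (d+1))‖ = 1 := by simp
  have hsub : sphere (0 : V (d+1)) 1 ⊆ {x | ‖x‖ = 1 ∧ inner ℝ (EuclideanSpace.single 0 1) x ≤ 0} ∪ {x | ‖x‖ = 1 ∧ inner ℝ (-(EuclideanSpace.single 0 1)) x ≤ 0} := by
    intro x hx
    rw [mem_sphere_zero_iff_norm] at hx
    rcases le_total (inner ℝ (EuclideanSpace.single 0 1) x) 0 with h | h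
    · left; exact ⟨hx, h⟩
    · right; refine ⟨hx, ?_⟩
      rw [inner_neg_left]; linarith
  refine (measure_mono hsub).trans_lt ((measure_union_le _ _).trans_lt ?_)
  exact ENNReal.add_lt_top.2 ⟨half_fin hv, half_fin (by rw [norm_neg]; exact hv)⟩

lemma muS_pos (d : ℕ) : 0 < μH[(d:ℝ)] (sphere (0 : V (d+1)) 1) := by
  set f : V (d+1) → (Fin d → ℝ) := fun x i => x i.succ with hf
  have hL : LipschitzWith 1 f := by
    refine LipschitzWith.of_dist_le_mul fun x y => ?_
    rw [NNReal.coe_one, one_mul, dist_eq_norm, dist_eq_norm, pi_norm_le_iff_of_nonneg (norm_nonneg _)]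
    intro i
    simpa [hf] using coord_le (x - y) i.succ
  have h1 := hL.hausdorffMeasure_image_le (d := (d:ℝ)) (by positivity) (sphere (0 : V (d+1)) 1)
  simp only [ENNReal.coe_one, ENNReal.one_rpow, one_mul] at h1
  refine lt_of_lt_of_le ?_ h1
  have hsub : ball (0 : Fin d → ℝ) (1/(d+1)) ⊆ f '' (sphere (0 : V (d+1)) 1) := by
    intro y hy
    rw [mem_ball_zero_iff] at hy
    have hs : ∑ i, y i ^ 2 ≤ 1 := by
      have : ∀ i, y i ^ 2 ≤ 1/(d+1) := by
        intro i
        have h2 := (norm_le_pi_norm y i).trans hy.le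
        rw [Real.norm_eq_abs] at h2
        have h3 : (1:ℝ)/(d+1) ≤ 1 := by rw [div_le_one (by positivity)]; linarith [(Nat.cast_nonneg d : (0:ℝ) ≤ d)]
        rw [← sq_abs]
        nlinarith [abs_nonneg (y i)]
      calc _ ≤ ∑ i : Fin d, (1:ℝ)/(d+1) := Finset.sum_le_sum fun i _ => this i
        _ = d/(d+1) := by simp; ring
        _ ≤ 1 := by rw [div_le_one (by positivity)]; linarith
    refine ⟨WithLp.toLp 2 (Fin.cons (√(1 - ∑ i, y i ^ 2)) y), ?_, ?_⟩
    · rw [mem_sphere_zero_iff_norm, EuclideanSpace.norm_eq, Fin.sum_univ_succ]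
      simp only [Fin.cons_zero, Fin.cons_succ, Real.norm_eq_abs, sq_abs]
      rw [Real.sq_sqrt (by linarith)]
      simp
    · ext i; simp [hf]
  refine lt_of_lt_of_le ?_ (measure_mono hsub)
  have e : (μH[(d:ℝ)] : Measure (Fin d → ℝ)) = volume := by
    have := hausdorffMeasure_pi_real (ι := Fin d)
    rwa [Fintype.card_fin] at this
  rw [e]
  exact measure_ball_pos _ _ (by positivity)


def hS (d : ℕ) : Measure (V (d+1)) := (μH[(d:ℝ)] : Measure (V (d+1))).restrict (sphere (0 : V (d+1)) 1)

lemma hS_univ (d : ℕ) : hS d Set.univ = μH[(d:ℝ)] (sphere (0 : V (d+1)) 1) := by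
  rw [hS, Measure.restrict_apply_univ]

lemma hS_norm (d : ℕ) : ∀ᵐ x ∂(hS d), ‖x‖ = 1 := by
  filter_upwards [ae_restrict_mem (μ := (μH[(d:ℝ)] : Measure (V (d+1)))) (isClosed_sphere (x := (0 : V (d+1))) (ε := 1)).measurableSet] with x hx
  simpa using hx

lemma hS_mp {d : ℕ} (g : V (d+1) ≃ₗᵢ[ℝ] V (d+1)) : MeasurePreserving g (hS d) (hS d) := by
  have h := (g.toIsometryEquiv.measurePreserving_hausdorffMeasure (d:ℝ)).restrict_preimage
    (isClosed_sphere (x := (0 : V (d+1))) (ε := 1)).measurableSet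
  have e : g.toIsometryEquiv ⁻¹' (sphere (0 : V (d+1)) 1) = sphere (0 : V (d+1)) 1 := by
    ext x; simp
  rw [e] at h
  exact h

def kS (d : ℕ) : ℝ≥0∞ := ∫⁻ x, ENNReal.ofReal |x 0| ∂(hS d)

lemma inner_e0 {d : ℕ} (x : V (d+1)) : inner ℝ (EuclideanSpace.single 0 1 : V (d+1)) x = x 0 := by
  simp [EuclideanSpace.inner_single_left]

lemma hS_inner {d : ℕ} (z : V (d+1)) : ∫⁻ x, ENNReal.ofReal |inner ℝ z x| ∂(hS d) = ENNReal.ofReal ‖z‖ * kS d := by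
  obtain ⟨g, hg⟩ := exists_rot (x := ‖z‖ • (EuclideanSpace.single 0 1 : V (d+1))) (y := z) (by simp [norm_smul])
  rw [← (hS_mp g).lintegral_comp (f := fun x => ENNReal.ofReal |inner ℝ z x|) (by fun_prop), kS, ← lintegral_const_mul _ (by fun_prop)]
  apply lintegral_congr
  intro x
  conv_lhs => rw [← hg]
  rw [g.inner_map_map, real_inner_smul_left, inner_e0, abs_mul, abs_of_nonneg (norm_nonneg z), ENNReal.ofReal_mul (norm_nonneg z)]

lemma kS_pos (d : ℕ) : kS d ≠ 0 := by
  intro h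
  have h1 : ∀ i : Fin (d+1), ∀ᵐ x ∂(hS d), x i = 0 := by
    intro i
    have := hS_inner (d := d) (EuclideanSpace.single i 1)
    rw [h, mul_zero, lintegral_eq_zero_iff (by fun_prop)] at this
    filter_upwards [this] with x hx
    simpa [EuclideanSpace.inner_single_left] using hx
  have h2 : ∀ᵐ x ∂(hS d), False := by
    filter_upwards [ae_all_iff.2 h1, hS_norm d] with x hx hx1
    have : x = 0 := by ext i; exact hx i
    rw [this] at hx1; simp at hx1
  have h3 : hS d = 0 := by
    rw [← ae_eq_bot]
    exact Filter.eventually_false_iff_eq_bot.1 h2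
  have := muS_pos d
  rw [← hS_univ, h3] at this
  simp at this

lemma kS_le (d : ℕ) : kS d ≤ hS d Set.univ := by
  rw [kS, ← lintegral_one]
  apply lintegral_mono_ae
  filter_upwards [hS_norm d] with x hx
  rw [ENNReal.ofReal_le_one, ← hx]
  exact coord_le x 0

lemma Kconst_eq (d : ℕ) : Kconst (d+1) 1 = (kS d).toReal / (hS d Set.univ).toReal := by
  unfold Kconst
  rw [dif_neg (Nat.succ_ne_zero d)]
  have e : ((d+1 : ℕ) : ℝ) - 1 = d := by push_cast; ring
  rw [e, setAverage_eq, smul_eq_mul, Measure.real, ← hS_univ]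
  have e2 : ∫ x in sphere (0 : V (d+1)) 1, |x ⟨0, Nat.pos_of_ne_zero (Nat.succ_ne_zero d)⟩| ^ (1:ℝ) ∂(μH[(d:ℝ)]) = (kS d).toReal := by
    rw [kS, integral_eq_lintegral_of_nonneg_ae]
    · simp only [Real.rpow_one]; rfl
    · exact ae_of_all _ fun x => by positivity
    · exact Continuous.aestronglyMeasurable (by simp only [Real.rpow_one]; fun_prop)
  rw [e2, div_eq_inv_mul]

lemma mom_id {d : ℕ} {G : V (d+1) → ℝ} (hG0 : ∀ z, 0 ≤ G z) (hGm : Measurable G) {k : ℝ → ℝ} (hr : ∀ᵐ z, G z = k ‖z‖) :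
    hS d Set.univ * ∫⁻ z, ENNReal.ofReal (|z 0| * G z) = kS d * ∫⁻ z, ENNReal.ofReal (‖z‖ * G z) := by
  have hfm : IsFiniteMeasure (hS d) := ⟨by rw [hS_univ]; exact muS_fin d⟩
  have h1 : ∀ᵐ x ∂(hS d), ∫⁻ z, ENNReal.ofReal (|inner ℝ z x| * G z) = ∫⁻ z, ENNReal.ofReal (|z 0| * G z) := by
    filter_upwards [hS_norm d] with x hx
    obtain ⟨g, hg⟩ := exists_rot (x := (EuclideanSpace.single 0 1 : V (d+1))) (y := x) (by simp [hx])
    rw [← g.measurePreserving.lintegral_comp (f := fun z => ENNReal.ofReal (|inner ℝ z x| * G z)) (by fun_prop)]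
    apply lintegral_congr_ae
    filter_upwards [rot_ae hr g] with z hz
    rw [hz]
    conv_lhs => rw [← hg]
    rw [g.inner_map_map, real_inner_comm, inner_e0]
  have h2 : ∫⁻ x, (∫⁻ z, ENNReal.ofReal (|inner ℝ z x| * G z)) ∂(hS d) = hS d Set.univ * ∫⁻ z, ENNReal.ofReal (|z 0| * G z) := by
    rw [lintegral_congr_ae h1, lintegral_const, mul_comm]
  rw [← h2, lintegral_lintegral_swap (by
    apply Measurable.aemeasurable
    unfold Function.uncurry
    have hc : Measurable fun p : V (d+1) × V (d+1) => G p.2 := hGm.comp measurable_snd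
    have hc2 : Measurable fun p : V (d+1) × V (d+1) => (inner ℝ p.2 p.1 : ℝ) := by fun_prop
    fun_prop), ← lintegral_const_mul _ (by fun_prop)]
  apply lintegral_congr
  intro z
  rw [ENNReal.ofReal_mul (norm_nonneg z), ← mul_assoc, mul_comm (kS d), ← hS_inner, ← lintegral_mul_const _ (by fun_prop)]
  apply lintegral_congr
  intro x
  rw [ENNReal.ofReal_mul (abs_nonneg _)]

lemma mom_two {d : ℕ} {G : V (d+1) → ℝ} (hG : H12 G) : ∫⁻ z, ENNReal.ofReal (|z 0| * G z) = 2 := by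
  obtain ⟨k, _, hr⟩ := hG.radial
  have hGm := hG.measurable
  have hid := mom_id hG.nonneg hGm hr
  have hm0 : hS d Set.univ ≠ 0 := by rw [hS_univ]; exact (muS_pos d).ne'
  have hmt : hS d Set.univ ≠ ⊤ := by rw [hS_univ]; exact (muS_fin d).ne
  have hkt : kS d ≠ ⊤ := ((kS_le d).trans_lt hmt.lt_top).ne
  have hk0 := kS_pos d
  have hf := hG.firstMoment
  rw [Kconst_eq] at hf
  have hk' : 0 < (kS d).toReal := ENNReal.toReal_pos hk0 hkt
  have hm' : 0 < (hS d Set.univ).toReal := ENNReal.toReal_pos hm0 hmt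
  have hp : 0 < 2 / ((kS d).toReal / (hS d Set.univ).toReal) := by positivity
  have hintg : Integrable (fun z => ‖z‖ * G z) := by
    by_contra h
    rw [integral_undef h] at hf
    exact absurd hf hp.ne
  have hl : ∫⁻ z, ENNReal.ofReal (‖z‖ * G z) = ENNReal.ofReal (2 / ((kS d).toReal / (hS d Set.univ).toReal)) := by
    rw [← hf, ofReal_integral_eq_lintegral_ofReal hintg (ae_of_all _ fun z => mul_nonneg (norm_nonneg z) (hG.nonneg z))]
  rw [hl] at hid
  have e : kS d * ENNReal.ofReal (2 / ((kS d).toReal / (hS d Set.univ).toReal)) = hS d Set.univ * 2 := by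
    nth_rewrite 1 [← ENNReal.ofReal_toReal hkt]
    rw [← ENNReal.ofReal_mul hk'.le]
    have : (kS d).toReal * (2 / ((kS d).toReal / (hS d Set.univ).toReal)) = (hS d Set.univ).toReal * 2 := by
      field_simp
    rw [this, ENNReal.ofReal_mul hm'.le, ENNReal.ofReal_toReal hmt]
    simp
  rw [e] at hid
  exact (ENNReal.mul_right_inj hm0 hmt).1 hid


lemma rad_pos (n : ℕ) : ∀ᵐ r ∂(rad n), 0 < r := by
  rw [rad_eq]
  exact (withDensity_absolutelyContinuous _ _).ae_le (ae_restrict_mem measurableSet_Ioi)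

lemma radial_rep {n : ℕ} (hn : 0 < n) {G : V n → ℝ} (hGm : Measurable G) {g : ℝ → ℝ} (hr : ∀ᵐ z, G z = g ‖z‖) :
    ∃ k : ℝ → ℝ, Measurable k ∧ ∀ᵐ z, G z = k ‖z‖ := by
  have h1 : ∀ᵐ p ∂((sph n).prod (rad n)), G (p.2 • p.1) = g ‖p.2 • p.1‖ := (polar_mp hn).quasiMeasurePreserving.ae hr
  have h2 := Measure.ae_ae_of_ae_prod h1
  have hne : NeBot (ae (sph n)) := by
    rw [ae_neBot]
    intro h
    have := NN_pos hn
    rw [NN, h] at this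
    simp at this
  obtain ⟨x0, hx0, hx1⟩ := (h2.and (sph_norm n)).exists
  refine ⟨fun r => G (r • x0), by fun_prop, ?_⟩
  have h3 : ∀ᵐ r ∂(rad n), G (r • x0) = g r := by
    filter_upwards [hx0, rad_pos n] with r hr hr0
    rw [hr, norm_smul, hx1, mul_one, Real.norm_of_nonneg hr0.le]
  obtain ⟨N, hN1, hN2, hN3⟩ := exists_measurable_superset_of_null (ae_iff.1 h3)
  have h4 : ∀ᵐ p ∂((sph n).prod (rad n)), ‖p.2 • p.1‖ ∉ N := by
    have a1 : ∀ᵐ p ∂((sph n).prod (rad n)), ‖p.1‖ = 1 := Measure.quasiMeasurePreserving_fst.ae (sph_norm n)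
    have a2 : ∀ᵐ p ∂((sph n).prod (rad n)), 0 < p.2 := Measure.quasiMeasurePreserving_snd.ae (rad_pos n)
    have a3 : ∀ᵐ p ∂((sph n).prod (rad n)), p.2 ∉ N := Measure.quasiMeasurePreserving_snd.ae (measure_eq_zero_iff_ae_notMem.1 hN3)
    filter_upwards [a1, a2, a3] with p h1 h2 h3
    rwa [norm_smul, h1, mul_one, Real.norm_of_nonneg h2.le]
  have h5 : ∀ᵐ z : V n, ‖z‖ ∉ N := by
    have hms : MeasurableSet {z : V n | ‖z‖ ∉ N} := hN2.compl.preimage measurable_norm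
    rw [← (polar_mp hn).map_eq]
    exact (ae_map_iff (polar_mp hn).measurable.aemeasurable hms).2 h4
  filter_upwards [hr, h5] with z hz hz2
  rw [hz]
  by_contra hcon
  exact hz2 (hN1 fun h => hcon h.symm)

lemma scale_ae {n : ℕ} {G : V n → ℝ} {k : ℝ → ℝ} (hr : ∀ᵐ z, G z = k ‖z‖) {l : ℝ} (hl : 0 < l) :
    ∀ᵐ z, Gscale G l z = l^(n+1) * k (l * ‖z‖) := by
  have h : ∀ᵐ z : V n, G (l • z) = k ‖l • z‖ := by
    rw [ae_iff] at hr ⊢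
    have := Measure.addHaar_preimage_smul (volume : Measure (V n)) hl.ne' {z | ¬ G z = k ‖z‖}
    rw [hr, mul_zero] at this
    exact this
  filter_upwards [h] with z hz
  rw [Gscale, hz, norm_smul, Real.norm_of_nonneg hl.le]

lemma scale_int {n : ℕ} {G : V n → ℝ} (hi : Integrable G) {l : ℝ} (hl : 0 < l) : Integrable (Gscale G l) :=
  (hi.comp_smul hl.ne').const_mul _

lemma scale_mom {d : ℕ} {G : V (d+1) → ℝ} (hG : H12 G) {l : ℝ} (hl : 0 < l) :
    Integrable (fun z => |z 0| * Gscale G l z) ∧ ∫ z, |z 0| * Gscale G l z = 2 := by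
  have h2 := mom_two hG
  have hGm := hG.measurable
  have h0 : ∀ z, 0 ≤ |z 0| * G z := fun z => mul_nonneg (abs_nonneg _) (hG.nonneg z)
  have hI : Integrable (fun z => |z 0| * G z) := by
    refine ⟨by fun_prop, ?_⟩
    rw [hasFiniteIntegral_iff_ofReal (ae_of_all _ h0), h2]
    exact ENNReal.ofNat_lt_top
  have hv : ∫ z, |z 0| * G z = 2 := by
    rw [integral_eq_lintegral_of_nonneg_ae (ae_of_all _ h0) hI.1, h2]; simp
  have e : (fun z => |z 0| * Gscale G l z) = fun z => l^(d+1) * (fun w : V (d+1) => |w 0| * G w) (l • z) := by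
    ext z
    simp only [Gscale, PiLp.smul_apply, smul_eq_mul, abs_mul, abs_of_pos hl]
    ring
  rw [e]
  refine ⟨(hI.comp_smul hl.ne').const_mul _, ?_⟩
  rw [integral_const_mul, Measure.integral_comp_smul volume (fun w : V (d+1) => |w 0| * G w) l, hv]
  simp only [finrank_euclideanSpace, Fintype.card_fin, smul_eq_mul]
  rw [abs_of_pos (by positivity)]
  field_simp

lemma tail_one {n : ℕ} (hn : 2 ≤ n) {G : V n → ℝ} (hG' : H34 G) : ∃ R : ℝ, 1 ≤ R ∧ ∀ w, R ≤ ‖w‖ → |G w| ≤ 1 := by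
  have key : ∀ a : ℝ, 0 ≤ a → (G =o[Bornology.cobounded (V n)] fun x => ‖x‖ ^ (-a)) → ∃ R : ℝ, 1 ≤ R ∧ ∀ w, R ≤ ‖w‖ → |G w| ≤ 1 := by
    intro a ha h
    have := h.def one_pos
    rw [hasBasis_cobounded_norm.eventually_iff] at this
    obtain ⟨R, _, hR⟩ := this
    refine ⟨max R 1, le_max_right _ _, fun w hw => ?_⟩
    have h1 := hR (x := w) ((le_max_left _ _).trans hw)
    have h2 : 1 ≤ ‖w‖ := (le_max_right _ _).trans hw
    rw [one_mul, Real.norm_eq_abs, Real.norm_of_nonneg (by positivity)] at h1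
    exact h1.trans (Real.rpow_le_one_of_one_le_of_nonpos h2 (by linarith))
  rcases Nat.lt_or_ge n 3 with h | h
  · have : n = 2 := by omega
    exact key 3 (by norm_num) (hG'.inftyTwo this)
  · obtain ⟨β, hβ, h⟩ := hG'.inftyHi h
    exact key _ (by positivity) h

lemma scale_om {n : ℕ} (hn : 0 < n) {G : V n → ℝ} (hG : H12 G) {R : ℝ} (hR : ∀ w, R ≤ ‖w‖ → |G w| ≤ 1) {l : ℝ} (hl : 0 < l) (hlR : R ≤ l) :
    IntegrableOn (fun z => Gscale G l z * om z) (ball (0 : V n) 4) := by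
  have hGm := hG.measurable
  have hom := om_meas n
  have hHm : Measurable (Gscale G l) := by unfold Gscale; fun_prop
  have hI := scale_int hG.integrable hl
  refine Integrable.mono' ((hI.integrableOn.const_mul 2).add ((om_int hn).const_mul (l^(n+1)))) (by fun_prop) (ae_of_all _ fun z => ?_)
  have h0 : 0 ≤ Gscale G l z := mul_nonneg (by positivity) (hG.nonneg _)
  have ho := om_nonneg z
  simp only [Pi.add_apply]
  rw [Real.norm_of_nonneg (mul_nonneg h0 ho)]
  rcases lt_or_ge ‖z‖ 1 with h | h
  · have h1 : om z ≤ 2 := by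
      unfold om
      have : (1/2:ℝ) ≤ √|1 - ‖z‖/2| := by
        apply Real.le_sqrt_of_sq_le
        rw [abs_of_pos (by linarith)]
        linarith
      calc (√|1 - ‖z‖/2|)⁻¹ ≤ (1/2:ℝ)⁻¹ := by gcongr
        _ = 2 := by norm_num
    have : 0 ≤ l^(n+1) * om z := by positivity
    nlinarith
  · have h1 : Gscale G l z ≤ l^(n+1) := by
      unfold Gscale
      have : |G (l • z)| ≤ 1 := hR _ (by rw [norm_smul, Real.norm_of_nonneg hl.le]; nlinarith)
      have := (le_abs_self _).trans this
      nlinarith [show 0 < l^(n+1) by positivity]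
    have := mul_le_mul_of_nonneg_right h1 ho
    linarith


lemma W_bound_hi {d : ℕ} (hd : 2 ≤ d) {G : V (d+1) → ℝ} (hG : H12 G) {γ : ℝ} (hγ0 : 0 < γ) (hγ1 : γ < 1)
    {l : ℝ} (hl : 0 < l) :
    γ * (∫ z in ball (0 : V (d+1)) 2, |z 0| * Gscale G l z * Wt d ‖z‖) < 2 := by
  obtain ⟨hI, hv⟩ := scale_mom hG hl
  have hH0 : ∀ z, 0 ≤ Gscale G l z := fun z => mul_nonneg (by positivity) (hG.nonneg _)
  have hm0 : ∀ z, 0 ≤ |z 0| * Gscale G l z := fun z => mul_nonneg (abs_nonneg _) (hH0 z)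
  have hW1 : ∀ r : ℝ, 0 ≤ r → Wt d r ≤ 1 := by
    intro r hr
    unfold Wt
    split_ifs with h
    · have : (2:ℝ) ≤ d := by exact_mod_cast hd
      exact Real.rpow_le_one (by nlinarith) (by nlinarith) (by linarith)
    · exact zero_le_one
  have h1 : ∫ z in ball (0 : V (d+1)) 2, |z 0| * Gscale G l z * Wt d ‖z‖ ≤ ∫ z in ball (0 : V (d+1)) 2, |z 0| * Gscale G l z := by
    refine integral_mono_of_nonneg (ae_of_all _ fun z => mul_nonneg (hm0 z) (Wt_nonneg d (norm_nonneg z))) hI.integrableOn (ae_of_all _ fun z => ?_)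
    exact mul_le_of_le_one_right (hm0 z) (hW1 _ (norm_nonneg z))
  have h2 : ∫ z in ball (0 : V (d+1)) 2, |z 0| * Gscale G l z ≤ 2 := by
    rw [← hv]
    exact setIntegral_le_integral hI (ae_of_all _ hm0)
  nlinarith

lemma W_bound_two {G : V (1+1) → ℝ} (hG : H12 G) (hG' : H34 G) {γ : ℝ} (hγ0 : 0 < γ) (hγ1 : γ < 1) :
    ∃ L : ℝ, 0 < L ∧ ∀ l, L < l →
    γ * (∫ z in ball (0 : V (1+1)) 2, |z 0| * Gscale G l z * Wt 1 ‖z‖) < 2 := by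
  set A : ℝ := (1+γ)/(2*γ) with hA
  have hA1 : 1 < A := by rw [hA, lt_div_iff₀ (by positivity)]; linarith
  obtain ⟨η, hη0, hη2, hη⟩ : ∃ η : ℝ, 0 < η ∧ η < 2 ∧ ∀ r, 0 ≤ r → r < η → Wt 1 r ≤ A := by
    have hc : ContinuousAt (fun r : ℝ => (1-r^2/4)^((((1:ℕ):ℝ)-2)/2)) 0 := by
      refine ContinuousAt.rpow_const (by fun_prop) (Or.inl (by norm_num))
    have := hc.eventually_lt (continuousAt_const (y := A)) (by simpa using hA1)
    obtain ⟨ε, hε, h⟩ := Metric.eventually_nhds_iff.1 this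
    refine ⟨min ε 1, by positivity, by have := min_le_right ε 1; linarith, fun r hr0 hr => ?_⟩
    have h3 := min_le_right ε 1
    have h4 := min_le_left ε 1
    have := h (y := r) (by rw [Real.dist_eq, sub_zero, abs_of_nonneg hr0]; linarith)
    unfold Wt
    rw [if_pos (by linarith)]
    exact this.le
  set O : ℝ := ∫ z in ball (0 : V (1+1)) 2, om z with hO
  have hO0 : 0 ≤ O := integral_nonneg fun z => om_nonneg z
  have hOi : IntegrableOn om (ball (0 : V (1+1)) 2) := (om_int (by norm_num)).mono_set (ball_subset_ball (by norm_num))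
  set D : ℝ := 2*γ*(η^3)⁻¹*O with hD
  have hD0 : 0 ≤ D := by positivity
  set c : ℝ := (1-γ)/(2*(D+1)) with hc
  have hc0 : 0 < c := by apply div_pos <;> linarith
  have hcD : c * D < 1 - γ := by
    rw [hc, div_mul_eq_mul_div, div_lt_iff₀ (by positivity)]
    nlinarith
  have hcη : 0 ≤ 2 * c * (η^3)⁻¹ := by positivity
  clear_value A D c O
  have h3 := (hG'.inftyTwo rfl).def hc0
  rw [hasBasis_cobounded_norm.eventually_iff] at h3
  obtain ⟨R, _, hR⟩ := h3
  refine ⟨max 1 (R/η), by positivity, fun l hl => ?_⟩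
  have hl0 : 0 < l := lt_of_lt_of_le one_pos ((le_max_left _ _).trans hl.le)
  have hlR : R ≤ l * η := by
    rw [← div_le_iff₀ hη0]; exact (le_max_right _ _).trans hl.le
  obtain ⟨hI, hv⟩ := scale_mom hG hl0
  have hH0 : ∀ z, 0 ≤ Gscale G l z := fun z => mul_nonneg (by positivity) (hG.nonneg _)
  have hm0 : ∀ z, 0 ≤ |z 0| * Gscale G l z := fun z => mul_nonneg (abs_nonneg _) (hH0 z)
  have h1 : ∫ z in ball (0 : V (1+1)) 2, |z 0| * Gscale G l z * Wt 1 ‖z‖ ≤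
      ∫ z in ball (0 : V (1+1)) 2, (A * (|z 0| * Gscale G l z) + 2 * c * (η^3)⁻¹ * om z) := by
    refine integral_mono_of_nonneg (ae_of_all _ fun z => mul_nonneg (hm0 z) (Wt_nonneg 1 (norm_nonneg z)))
      ((hI.integrableOn.const_mul A).add (hOi.const_mul _)) ?_
    filter_upwards [ae_restrict_mem measurableSet_ball] with z hz
    have ho := om_nonneg z
    have hz2 : ‖z‖ < 2 := by simpa using hz
    have hW := Wt_le_om (d := 1) one_pos hz
    have hW0 := Wt_nonneg 1 (norm_nonneg z)
    rcases lt_or_ge ‖z‖ η with h | h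
    · have := mul_nonneg hcη ho
      have := mul_le_mul_of_nonneg_left (hη _ (norm_nonneg z) h) (hm0 z)
      linarith
    · have hz0 : 0 < ‖z‖ := hη0.trans_le h
      have e1 : Gscale G l z ≤ c * (η^3)⁻¹ := by
        have a := hR (x := l • z) (by
          simp only [Set.mem_setOf_eq, norm_smul, Real.norm_of_nonneg hl0.le]
          nlinarith)
        rw [Real.norm_of_nonneg (hG.nonneg _), Real.norm_of_nonneg (by positivity), norm_smul, Real.norm_of_nonneg hl0.le,
          Real.rpow_neg (by positivity)] at a
        have e3 : (l * ‖z‖) ^ (3:ℝ) = (l * ‖z‖)^3 := by exact_mod_cast Real.rpow_natCast (l * ‖z‖) 3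
        rw [e3] at a
        calc Gscale G l z = l^3 * G (l • z) := rfl
          _ ≤ l^3 * (c * ((l * ‖z‖)^3)⁻¹) := by gcongr
          _ = c * (‖z‖^3)⁻¹ := by field_simp
          _ ≤ c * (η^3)⁻¹ := by gcongr
      have e2 : |z 0| ≤ 2 := (coord_le z 0).trans hz2.le
      have : 0 ≤ A * (|z 0| * Gscale G l z) := mul_nonneg (by linarith) (hm0 z)
      have e4 : |z 0| * Gscale G l z * Wt 1 ‖z‖ ≤ 2 * (c * (η^3)⁻¹) * om z := by
        have := hH0 z
        gcongr
      linarith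
  have h2 : ∫ z in ball (0 : V (1+1)) 2, |z 0| * Gscale G l z ≤ 2 := by
    rw [← hv]
    exact setIntegral_le_integral hI (ae_of_all _ hm0)
  rw [integral_add (hI.integrableOn.const_mul A) (hOi.const_mul _), integral_const_mul, integral_const_mul, ← hO] at h1
  have h5 := h1.trans (add_le_add_left (mul_le_mul_of_nonneg_left h2 (by linarith : (0:ℝ) ≤ A)) _)
  have h6 := mul_le_mul_of_nonneg_left h5 hγ0.le
  have h7 : γ * (A * 2 + 2 * c * (η^3)⁻¹ * O) = (1+γ) + c * D := by
    rw [hA, hD]; field_simp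
  linarith

theorem statement3_aux (n : ℕ) (hn : 2 ≤ n) (G : V n → ℝ) (hG : H12 G) (hG' : H34 G)
    (γ : ℝ) (hγ0 : 0 < γ) (hγ1 : γ < 1) :
    ∃ ls : ℝ, 0 < ls ∧ ∀ l : ℝ, ls < l → ∀ (X : V n → V n) (Φ : ℝ → V n → V n), IsFlowOf X Φ →
      PreservesVolume Φ (ball (0 : V n) 1) →
      deriv (fun t => Ffun γ G l (Φ t '' ball (0 : V n) 1)) 0 = 0 ∧
      0 ≤ deriv (deriv (fun t => Ffun γ G l (Φ t '' ball (0 : V n) 1))) 0 := by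
  obtain ⟨d, rfl⟩ : ∃ d, n = d + 1 := ⟨n - 1, by omega⟩
  have hd : 0 < d := by omega
  have hGm := hG.measurable
  obtain ⟨L, hL0, hL⟩ : ∃ L : ℝ, 0 < L ∧ ∀ l, L < l →
      γ * (∫ z in ball (0 : V (d+1)) 2, |z 0| * Gscale G l z * Wt d ‖z‖) < 2 := by
    rcases Nat.lt_or_ge d 2 with h | h
    · obtain rfl : d = 1 := by omega
      exact W_bound_two hG hG' hγ0 hγ1
    · exact ⟨1, one_pos, fun l hl => W_bound_hi h hG hγ0 hγ1 (one_pos.trans hl)⟩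
  obtain ⟨R, hR1, hR⟩ := tail_one hn hG'
  obtain ⟨g, -, hg⟩ := hG.radial
  obtain ⟨k, hk, hkr⟩ := radial_rep (Nat.succ_pos d) hGm hg
  refine ⟨max R L, lt_max_of_lt_right hL0, fun l hl X Φ h hv => ?_⟩
  have hlR := (le_max_left R L).trans hl.le
  have hlL := (le_max_right R L).trans_lt hl
  have hl0 : 0 < l := hL0.trans hlL
  exact stab_main hd (H := Gscale G l) (k := fun r => l^(d+1+1) * k (l * r))
    (fun z => mul_nonneg (by positivity) (hG.nonneg _)) (by unfold Gscale; fun_prop)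
    (scale_int hG.integrable hl0) (by fun_prop) (scale_ae hkr hl0)
    (scale_om (Nat.succ_pos d) hG hR hl0 hlR) hγ0 (hL l hlL) h hv

/-- If `0 < γ < 1`, there is `λ_s > 0` such that for all `λ > λ_s` the
unit ball is a volume-constrained stable critical point of `F_{γ,G_λ}`: it is stationary
and the second variation is nonnegative along every smooth compactly supported vector
field inducing a volume-preserving flow on `B₁`. -/
theorem statement3 (n : ℕ) (hn : 2 ≤ n) (G : V n → ℝ) (hG : H12 G) (hG' : H34 G)
    (γ : ℝ) (hγ0 : 0 < γ) (hγ1 : γ < 1) :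
    ∃ ls : ℝ, 0 < ls ∧ ∀ l : ℝ, ls < l →
      ∀ (X : V n → V n) (Φ : ℝ → V n → V n), IsFlowOf X Φ →
        PreservesVolume Φ (ball (0 : V n) 1) →
        deriv (fun t => Ffun γ G l (Φ t '' ball (0 : V n) 1)) 0 = 0 ∧
        0 ≤ deriv (deriv (fun t => Ffun γ G l (Φ t '' ball (0 : V n) 1))) 0 := by
  exact statement3_aux n hn G hG hG' γ hγ0 hγ1
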